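/- The set {M ∈ N : S(R_M) < s(|R_M|)} has positive lower asymptotic density, i.e. liminf_{N→∞} |{M ≤ N : S(R_M) < s(|R_M|)}|/N > 0. -/

import Mathlib

open Finset

/-- The set of quadratic residues modulo `M`, as a finset of `ZMod M`. -/
def QR (M : ℕ) : Finset (ZMod M) := (Finset.range M).image (fun a : ℕ => ((a : ZMod M)) ^ 2)

/-- The "universe" finset of `ZMod M` (all residues), valid for any `M ≥ 1`. -/
def univM (M : ℕ) : Finset (ZMod M) := (Finset.range M).image (fun a : ℕ => (a : ZMod M))

/-- The cyclic gap from `u` to the next element of `U`: the least `k ≥ 1` with `u + k ∈ U`. -/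
noncomputable def cycGap (M : ℕ) (U : Finset (ZMod M)) (u : ZMod M) : ℕ :=
  sInf {k : ℕ | 0 < k ∧ u + (k : ZMod M) ∈ U}

/-- The stochasticity parameter `S(U)`: the sum of the squares of the consecutive
(cyclic) distances between elements of `U`. -/
noncomputable def stoch (M : ℕ) (U : Finset (ZMod M)) : ℕ :=
  ∑ u ∈ U, (cycGap M U u) ^ 2

/-- `s(k) = s(k, Z_M)`: the average of `S(U)` over all subsets `U ⊆ Z_M` of size `k`. -/
noncomputable def savg (M k : ℕ) : ℚ :=
  (∑ U ∈ (univM M).powersetCard k, (stoch M U : ℚ)) / (Nat.choose M k : ℚ)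

theorem univM_eq_univ (M : ℕ) [NeZero M] : univM M = univ := by
  ext x
  simp only [univM, mem_image, mem_range, mem_univ, iff_true]
  exact ⟨x.val, x.val_lt, ZMod.natCast_zmod_val x⟩

theorem mem_QR_iff {M : ℕ} [NeZero M] (x : ZMod M) : x ∈ QR M ↔ IsSquare x := by
  simp only [QR, mem_image, mem_range]
  constructor
  · rintro ⟨a, -, rfl⟩
    exact ⟨a, by ring⟩
  · rintro ⟨y, rfl⟩
    exact ⟨y.val, y.val_lt, by rw [ZMod.natCast_zmod_val]; ring⟩

/-- The number of `x` for which none of `x + 1, …, x + L` lies in `U`. -/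
def gapCount (M : ℕ) [NeZero M] (U : Finset (ZMod M)) (L : ℕ) : ℕ :=
  #{x : ZMod M | ∀ i ∈ Icc 1 L, x + (i : ZMod M) ∉ U}

section
variable {M : ℕ} [NeZero M]

theorem gapCount_zero (U : Finset (ZMod M)) : gapCount M U 0 = M := by
  simp [gapCount, ZMod.card]

theorem gapCount_self {U : Finset (ZMod M)} (hU : U.Nonempty) : gapCount M U M = 0 := by
  rw [gapCount, card_eq_zero, filter_eq_empty_iff]
  intro x _ h
  obtain ⟨u, hu⟩ := hU
  have hM : 0 < M := Nat.pos_of_ne_zero (NeZero.ne M)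
  by_cases h0 : (u - x).val = 0
  · apply h M (by simp; omega)
    rw [ZMod.val_eq_zero, sub_eq_zero] at h0
    simpa [← h0] using hu
  · apply h (u - x).val (by simp [(ZMod.val_lt (u - x)).le]; omega)
    simpa using hu

theorem cycGap_spec {U : Finset (ZMod M)} {u : ZMod M} (hu : u ∈ U) :
    cycGap M U u ≤ M ∧ ∀ L, L < cycGap M U u ↔ ∀ i ∈ Icc 1 L, u + (i : ZMod M) ∉ U := by
  have hM : 0 < M := Nat.pos_of_ne_zero (NeZero.ne M)
  have hmem : M ∈ {k : ℕ | 0 < k ∧ u + (k : ZMod M) ∈ U} := by simp [hM, hu]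
  refine ⟨Nat.sInf_le hmem, fun L => ⟨fun h i hi hiU => ?_, fun h => ?_⟩⟩
  · rw [mem_Icc] at hi
    have : cycGap M U u ≤ i := Nat.sInf_le ⟨by omega, hiU⟩
    omega
  · by_contra hlt
    have := Nat.sInf_mem ⟨M, hmem⟩
    exact h (cycGap M U u) (by rw [mem_Icc]; exact ⟨this.1, by omega⟩) this.2

theorem gapCount_succ (U : Finset (ZMod M)) (L : ℕ) :
    gapCount M U L = #{u ∈ U | ∀ i ∈ Icc 1 L, u + (i : ZMod M) ∉ U} + gapCount M U (L + 1) := by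
  rw [gapCount, ← card_filter_add_card_filter_not (fun x => x ∈ U)]
  congr 1
  · congr 1
    ext x
    simp [and_comm]
  · rw [gapCount]
    refine card_bij' (fun x _ => x - 1) (fun x _ => x + 1) ?_ ?_ ?_ ?_
    · intro x hx
      simp only [mem_filter, mem_univ, true_and, mem_Icc] at hx ⊢
      intro i hi
      rcases Nat.exists_eq_add_of_le hi.1 with ⟨j, rfl⟩
      rcases Nat.eq_zero_or_pos j with rfl | hj
      · simpa using hx.2
      · have := hx.1 j (by omega)
        push_cast
        rwa [show x - 1 + (1 + (j : ZMod M)) = x + j by ring]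
    · intro x hx
      simp only [mem_filter, mem_univ, true_and, mem_Icc] at hx ⊢
      constructor
      · intro i hi
        have := hx (i + 1) (by omega)
        push_cast at this
        rwa [show x + 1 + (i : ZMod M) = x + (i + 1) by ring]
      · simpa using hx 1 (by omega)
    · simp
    · simp

theorem sum_odd_range (n : ℕ) : ∑ L ∈ range n, (2 * L + 1) = n ^ 2 := by
  induction n with
  | zero => simp
  | succ n ih => rw [sum_range_succ, ih]; ring

theorem stoch_eq {U : Finset (ZMod M)} (hU : U.Nonempty) :
    stoch M U = M + 2 * ∑ L ∈ Ico 1 M, gapCount M U L := by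
  have hM : 0 < M := Nat.pos_of_ne_zero (NeZero.ne M)
  have h1 : stoch M U = ∑ L ∈ range M, (2 * L + 1) *
      #{u ∈ U | ∀ i ∈ Icc 1 L, u + (i : ZMod M) ∉ U} := by
    rw [stoch]
    simp_rw [card_filter, mul_sum]
    rw [sum_comm]
    refine sum_congr rfl fun u hu => ?_
    obtain ⟨hle, hlt⟩ := cycGap_spec hu
    simp_rw [← hlt, mul_ite, mul_one, mul_zero, ← sum_filter]
    rw [← sum_odd_range]
    congr 1
    ext L
    simp
    omega
  have h2 : ∀ n, (∑ L ∈ range (n + 1), (2 * L + 1) *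
      #{u ∈ U | ∀ i ∈ Icc 1 L, u + (i : ZMod M) ∉ U}) + (2 * n + 1) * gapCount M U (n + 1) =
      M + 2 * ∑ L ∈ Ico 1 (n + 1), gapCount M U L := by
    intro n
    induction n with
    | zero =>
      have := gapCount_succ U 0
      rw [gapCount_zero] at this
      simp only [zero_add, range_one, sum_singleton, mul_zero, one_mul, Ico_self, sum_empty,
        add_zero] at this ⊢
      exact this.symm
    | succ n ih =>
      rw [sum_range_succ, sum_Ico_succ_top (by omega)]
      have := gapCount_succ U (n + 1)
      linear_combination ih - (2 * n + 3) * this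
  obtain ⟨n, rfl⟩ : ∃ n, M = n + 1 := ⟨M - 1, by omega⟩
  rw [h1, ← h2, gapCount_self hU]
  simp

theorem sum_gapCount {L : ℕ} (hL : L < M) (k : ℕ) :
    ∑ U ∈ (univM M).powersetCard k, gapCount M U L = M * (M - L).choose k := by
  rw [univM_eq_univ]
  simp_rw [gapCount, card_filter]
  rw [sum_comm]
  have : ∀ x : ZMod M, (∑ U ∈ (univ : Finset (ZMod M)).powersetCard k,
      if ∀ i ∈ Icc 1 L, x + (i : ZMod M) ∉ U then 1 else 0) = (M - L).choose k := by
    intro x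
    rw [← card_filter]
    set T : Finset (ZMod M) := (Icc 1 L).image (fun i : ℕ => x + (i : ZMod M)) with hT
    have hTc : #T = L := by
      rw [hT, card_image_of_injOn, Nat.card_Icc]; · omega
      intro i hi j hj hij
      simp only [coe_Icc, Set.mem_Icc] at hi hj
      have h := add_left_cancel hij
      rw [ZMod.natCast_eq_natCast_iff', Nat.mod_eq_of_lt (by omega),
        Nat.mod_eq_of_lt (by omega)] at h
      exact h
    have : {U ∈ (univ : Finset (ZMod M)).powersetCard k |
        ∀ i ∈ Icc 1 L, x + (i : ZMod M) ∉ U} = (Tᶜ).powersetCard k := by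
      ext U
      simp only [mem_filter, mem_powersetCard, subset_univ, true_and]
      rw [and_comm]
      refine and_congr ⟨fun h u hu => ?_, fun h i hi hiU => ?_⟩ Iff.rfl
      · rw [mem_compl, hT, mem_image]
        rintro ⟨i, hi, rfl⟩
        exact h i hi hu
      · exact mem_compl.1 (h hiU) (mem_image_of_mem _ hi)
    rw [this, card_powersetCard, card_compl, ZMod.card, hTc]
  rw [sum_congr rfl fun x _ => this x]
  simp [ZMod.card]

theorem savg_eq {k : ℕ} (hk : 1 ≤ k) (hkM : k ≤ M) :
    savg M k = M + 2 * M * ((M - k : ℚ) / (k + 1)) := by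
  have h1 : ∑ U ∈ (univM M).powersetCard k, stoch M U =
      M * M.choose k + 2 * (M * M.choose (k + 1)) := by
    have : ∀ U ∈ (univM M).powersetCard k,
        stoch M U = M + 2 * ∑ L ∈ Ico 1 M, gapCount M U L := by
      intro U hU
      rw [mem_powersetCard] at hU
      exact stoch_eq (card_pos.1 (by omega))
    rw [sum_congr rfl this, sum_add_distrib, ← mul_sum, sum_comm,
      sum_congr rfl fun L hL => sum_gapCount (mem_Ico.1 hL).2 k, ← mul_sum]
    have hs : ∑ L ∈ Ico 1 M, (M - L).choose k = M.choose (k + 1) := by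
      rw [sum_Ico_reflect (fun j => j.choose k) 1 (Nat.le_succ M)]
      simp only [Nat.add_sub_cancel_left, Nat.add_sub_cancel]
      obtain ⟨n, rfl⟩ : ∃ n, M = n + 1 := ⟨M - 1, by omega⟩
      rw [← Nat.sum_Icc_choose, ← Ico_add_one_right_eq_Icc]
      symm
      apply sum_subset
      · intro x; simp only [mem_Ico]; omega
      · intro x hx hx'
        simp only [mem_Ico] at hx hx'
        exact Nat.choose_eq_zero_of_lt (by omega)
    rw [hs, sum_const, card_powersetCard, univM_eq_univ, card_univ, ZMod.card, smul_eq_mul]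
    ring
  have hc : (0 : ℚ) < M.choose k := by exact_mod_cast Nat.choose_pos hkM
  have h2 : (M.choose (k + 1) : ℚ) * (k + 1) = M.choose k * (M - k : ℚ) := by
    have := Nat.choose_succ_right_eq M k
    rw [← Nat.cast_sub hkM]
    exact_mod_cast this
  rw [savg, ← Nat.cast_sum, h1]
  push_cast
  have : (M.choose (k + 1) : ℚ) = M.choose k * ((M - k : ℚ) / (k + 1)) := by
    field_simp
    linarith
  rw [this]
  field_simp

theorem one_le_card_QR : 1 ≤ #(QR M) :=
  card_pos.2 ⟨0, (mem_QR_iff 0).2 ⟨0, by simp⟩⟩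

theorem card_QR_le : #(QR M) ≤ M := by
  simpa [ZMod.card] using card_le_univ (QR M)

/-- The stochasticity inequality follows from a bound for the mean gap counts. -/
theorem stoch_lt_savg_of_sum_gapCount_lt
    (h : ∑ L ∈ Ico 1 M, (gapCount M (QR M) L : ℝ) / M < (M + 1) / (#(QR M) + 1) - 1) :
    (stoch M (QR M) : ℚ) < savg M #(QR M) := by
  have hM : (0 : ℚ) < M := by exact_mod_cast Nat.pos_of_ne_zero (NeZero.ne M)
  have h' : (∑ L ∈ Ico 1 M, (gapCount M (QR M) L : ℚ) / M) < (M + 1) / (#(QR M) + 1) - 1 := by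
    have : ((∑ L ∈ Ico 1 M, (gapCount M (QR M) L : ℚ) / M : ℚ) : ℝ) <
      (((M + 1) / (#(QR M) + 1) - 1 : ℚ) : ℝ) := by push_cast; exact h
    exact_mod_cast this
  have hk := card_pos.1 (one_le_card_QR (M := M))
  rw [savg_eq one_le_card_QR card_QR_le, stoch_eq hk]
  rw [← sum_div, div_lt_iff₀ hM] at h'
  push_cast
  have hk0 : (0 : ℚ) < #(QR M) + 1 := by positivity
  have : (M + 1 : ℚ) / (#(QR M) + 1) - 1 = (M - #(QR M)) / (#(QR M) + 1) := by
    field_simp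
    ring
  rw [this] at h'
  linarith

end

section Stepanov
open Polynomial

variable {K : Type*} [Field K]

/-- The linear operator `r ↦ r_k` such that the `k`-th derivative of `F ^ m * r` is
`F ^ (m - k) * r_k`. -/
noncomputable def derivNumerator (F : K[X]) (m : ℕ) : ℕ → K[X] →ₗ[K] K[X]
  | 0 => LinearMap.id
  | k + 1 => LinearMap.mulLeft K (C ((m - k : ℕ) : K) * derivative F) ∘ₗ derivNumerator F m k +
      LinearMap.mulLeft K F ∘ₗ derivative ∘ₗ derivNumerator F m k

theorem iterate_derivative_pow_mul (F r : K[X]) {m k : ℕ} (hk : k ≤ m) :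
    derivative^[k] (F ^ m * r) = F ^ (m - k) * derivNumerator F m k r := by
  induction k with
  | zero => simp [derivNumerator]
  | succ k ih =>
    rw [Function.iterate_succ_apply', ih (by omega), derivative_mul, derivative_pow]
    obtain ⟨j, rfl⟩ : ∃ j, m = j + (k + 1) := ⟨m - (k + 1), by omega⟩
    have h1 : j + (k + 1) - k = j + 1 := by omega
    have h2 : j + (k + 1) - (k + 1) = j := by omega
    simp only [h1, h2, derivNumerator, LinearMap.add_apply, LinearMap.comp_apply,
      LinearMap.mulLeft_apply, Nat.add_sub_cancel]
    ring

theorem natDegree_derivNumerator_le (F r : K[X]) (m k : ℕ) :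
    (derivNumerator F m k r).natDegree ≤ r.natDegree + F.natDegree * k := by
  induction k with
  | zero => simp [derivNumerator]
  | succ k ih =>
    simp only [derivNumerator, LinearMap.add_apply, LinearMap.comp_apply, LinearMap.mulLeft_apply]
    refine (natDegree_add_le _ _).trans (max_le ?_ ?_)
    · refine natDegree_mul_le.trans ?_
      have := (natDegree_C_mul_le ((m - k : ℕ) : K) (derivative F)).trans (natDegree_derivative_le F)
      rw [mul_add]
      omega
    · refine natDegree_mul_le.trans ?_
      have := natDegree_derivative_le (derivNumerator F m k r)
      rw [mul_add]
      omega

variable {p : ℕ} [Fact p.Prime]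

theorem iterate_derivative_X_pow_mul (j k : ℕ) (f : (ZMod p)[X]) :
    derivative^[k] (X ^ (j * p) * f) = X ^ (j * p) * derivative^[k] f := by
  induction k with
  | zero => simp
  | succ k ih =>
    rw [Function.iterate_succ_apply', ih, derivative_mul, derivative_X_pow,
      Function.iterate_succ_apply']
    simp

theorem eq_zero_of_X_pow_dvd_add {F r s : (ZMod p)[X]} {e D : ℕ} (he : 2 * e + 1 = p)
    {c : ZMod p} (hc : Odd (F.rootMultiplicity c)) (hF0 : F.eval 0 ≠ 0)
    (hD : 2 * D + F.natDegree ≤ p) (hr : r.natDegree < D) (hs : s.natDegree < D)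
    (h : X ^ p ∣ r + F ^ e * s) : r = 0 ∧ s = 0 := by
  have hF : F ≠ 0 := by rintro rfl; simp at hF0
  have h1 : X ^ p ∣ r ^ 2 * F - s ^ 2 * C (F.eval 0) := by
    have h2 : X ^ p ∣ F ^ p - C (F.eval 0) := by
      have : expand (ZMod p) p (F - C (F.eval 0)) = expand (ZMod p) p F - C (F.eval 0) := by simp
      obtain ⟨q, hq⟩ : X ∣ F - C (F.eval 0) := by
        rw [X_dvd_iff, coeff_zero_eq_eval_zero]; simp
      rw [← ZMod.expand_card F, ← this, hq, map_mul, ← expand_X]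
      exact dvd_mul_right _ _
    have h3 : r ^ 2 * F - s ^ 2 * C (F.eval 0) =
        (r + F ^ e * s) * ((r - F ^ e * s) * F) + s ^ 2 * (F ^ p - C (F.eval 0)) := by
      have h4 : F ^ p = F ^ (2 * e + 1) := by congr 1; exact he.symm
      rw [h4]; ring
    rw [h3]
    exact dvd_add (h.mul_right _) (h2.mul_left _)
  have h2 : r ^ 2 * F = s ^ 2 * C (F.eval 0) := by
    rw [← sub_eq_zero]
    by_contra hne
    have := natDegree_le_of_dvd h1 hne
    rw [natDegree_X_pow] at this
    have hle : (r ^ 2 * F - s ^ 2 * C (F.eval 0)).natDegree ≤ 2 * (D - 1) + F.natDegree := by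
      refine (natDegree_sub_le _ _).trans (max_le ?_ ?_)
      · refine natDegree_mul_le.trans (Nat.add_le_add_right (natDegree_pow_le.trans ?_) _)
        omega
      · refine (natDegree_mul_C_le _ _).trans (natDegree_pow_le.trans ?_)
        omega
    omega
  by_cases hs0 : s = 0
  · refine ⟨?_, hs0⟩
    simpa [hs0, hF] using h2
  · exfalso
    have hr0 : r ≠ 0 := by
      rintro rfl
      have := h2.symm
      simp [hs0, hF0] at this
    have h3 := congrArg (rootMultiplicity c) h2
    have hC : (C (F.eval 0) : (ZMod p)[X]) ≠ 0 := by simpa using hF0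
    rw [rootMultiplicity_mul (mul_ne_zero (pow_ne_zero _ hr0) hF),
      rootMultiplicity_mul (mul_ne_zero (pow_ne_zero _ hs0) hC), rootMultiplicity_C,
      sq, sq, rootMultiplicity_mul (mul_ne_zero hr0 hr0),
      rootMultiplicity_mul (mul_ne_zero hs0 hs0)] at h3
    obtain ⟨m, hm⟩ := hc
    omega

theorem sum_X_pow_mul_ne_zero {F : (ZMod p)[X]} {e D J : ℕ} (he : 2 * e + 1 = p)
    {c : ZMod p} (hc : Odd (F.rootMultiplicity c)) (hF0 : F.eval 0 ≠ 0)
    (hD : 2 * D + F.natDegree ≤ p) (r s : Fin J → (ZMod p)[X])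
    (hr : ∀ j, (r j).natDegree < D) (hs : ∀ j, (s j).natDegree < D)
    (h : ∑ j : Fin J, X ^ (j.val * p) * (r j + F ^ e * s j) = 0) (j : Fin J) :
    r j = 0 ∧ s j = 0 := by
  obtain ⟨i, rfl⟩ : ∃ i : Fin J, i = j := ⟨j, rfl⟩
  have key : ∀ n : ℕ, ∀ hn : n < J, r ⟨n, hn⟩ = 0 ∧ s ⟨n, hn⟩ = 0 := by
    intro n
    induction n using Nat.strong_induction_on with
    | _ n ih =>
    intro hn
    apply eq_zero_of_X_pow_dvd_add he hc hF0 hD (hr _) (hs _)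
    rw [← add_sum_erase _ _ (mem_univ (⟨n, hn⟩ : Fin J))] at h
    have hdvd : X ^ (n * p) * X ^ p ∣ ∑ j ∈ univ.erase (⟨n, hn⟩ : Fin J),
        X ^ (j.val * p) * (r j + F ^ e * s j) := by
      apply dvd_sum
      intro j hj
      rcases lt_or_ge j.val n with hlt | hge
      · obtain ⟨h1, h2⟩ := ih j.val hlt j.isLt
        simp only [Fin.eta] at h1 h2
        simp [h1, h2]
      · have : j.val ≠ n := fun h' => (mem_erase.1 hj).1 (Fin.ext h')
        rw [← pow_add]
        apply Dvd.dvd.mul_right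
        apply pow_dvd_pow
        have : n + 1 ≤ j.val := by omega
        calc n * p + p = (n + 1) * p := by ring
          _ ≤ _ := Nat.mul_le_mul_right _ this
    have h4 := (eq_neg_of_add_eq_zero_left h) ▸ (dvd_neg.2 hdvd)
    exact (mul_dvd_mul_iff_left (pow_ne_zero _ X_ne_zero)).1 h4
  exact key i.val i.isLt

theorem exists_auxiliary_pair (F : (ZMod p)[X]) {e l D J : ℕ} (hD0 : 0 < D)
    (hcount : l * (D + F.natDegree * l + J) < 2 * J * D) (a : ZMod p) :
    ∃ r s : Fin J → (ZMod p)[X], (∀ j, (r j).natDegree < D) ∧ (∀ j, (s j).natDegree < D) ∧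
      (∃ j, ¬(r j = 0 ∧ s j = 0)) ∧ ∀ k < l, ∑ j : Fin J, X ^ j.val *
        (derivNumerator F l k (r j) + C a * derivNumerator F (l + e) k (s j)) = 0 := by
  set E := D + F.natDegree * l + J with hE
  let ψ : (Fin J → (degreeLT (ZMod p) D × degreeLT (ZMod p) D)) →ₗ[ZMod p]
      (Fin l → Fin E → ZMod p) :=
    LinearMap.pi fun k => LinearMap.pi fun i => (lcoeff (ZMod p) i.val) ∘ₗ
      ∑ j : Fin J, (LinearMap.mulLeft (ZMod p) (X ^ j.val)) ∘ₗ
        (derivNumerator F l k ∘ₗ (degreeLT (ZMod p) D).subtype ∘ₗ LinearMap.fst _ _ _ +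
          LinearMap.mulLeft (ZMod p) (C a) ∘ₗ derivNumerator F (l + e) k ∘ₗ
            (degreeLT (ZMod p) D).subtype ∘ₗ LinearMap.snd _ _ _) ∘ₗ LinearMap.proj j
  have : Module.Finite (ZMod p) (degreeLT (ZMod p) D) :=
    Module.Finite.equiv (degreeLTEquiv (ZMod p) D).symm
  have hfr : Module.finrank (ZMod p) (degreeLT (ZMod p) D) = D := by
    rw [(degreeLTEquiv (ZMod p) D).finrank_eq]; simp
  have hker : LinearMap.ker ψ ≠ ⊥ := by
    apply LinearMap.ker_ne_bot_of_finrank_lt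
    simp only [Module.finrank_pi_fintype, Module.finrank_self, sum_const, card_univ,
      Fintype.card_fin, smul_eq_mul, mul_one, Module.finrank_prod, hfr]
    calc l * E < 2 * J * D := hcount
      _ = J * (D + D) := by ring
  obtain ⟨v, hv, hv0⟩ := (Submodule.ne_bot_iff _).1 hker
  have hdeg : ∀ q : degreeLT (ZMod p) D, (q : (ZMod p)[X]).natDegree < D := by
    intro q
    by_cases hq : (q : (ZMod p)[X]) = 0
    · simpa [hq] using hD0
    · exact (natDegree_lt_iff_degree_lt hq).2 (mem_degreeLT.1 q.2)
  refine ⟨fun j => (v j).1, fun j => (v j).2, fun j => hdeg _, fun j => hdeg _, ?_, ?_⟩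
  · by_contra hcon
    push Not at hcon
    apply hv0
    ext1 j
    obtain ⟨h1, h2⟩ := hcon j
    ext1
    · exact Subtype.ext h1
    · exact Subtype.ext h2
  · intro k hk
    ext i
    rw [coeff_zero]
    by_cases hi : i < E
    · have := congrFun (congrFun (LinearMap.mem_ker.1 hv) ⟨k, hk⟩) ⟨i, hi⟩
      simpa [ψ] using this
    · apply coeff_eq_zero_of_natDegree_lt
      refine lt_of_lt_of_le ?_ (not_lt.1 hi)
      have hJ : 0 < J := by
        rcases Nat.eq_zero_or_pos J with rfl | h
        · simp at hcount
        · exact h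
      have hkl : F.natDegree * k ≤ F.natDegree * l := Nat.mul_le_mul_left _ hk.le
      refine lt_of_le_of_lt (natDegree_sum_le_of_forall_le (n := J - 1 + (D - 1 + F.natDegree * l))
        _ _ ?_) (by omega)
      intro j _
      refine natDegree_mul_le.trans (Nat.add_le_add ?_ ?_)
      · rw [natDegree_X_pow]; omega
      · refine (natDegree_add_le _ _).trans (max_le ?_ ?_)
        · refine (natDegree_derivNumerator_le _ _ _ _).trans ?_
          have : ((v j).1 : (ZMod p)[X]).natDegree ≤ D - 1 := Nat.le_sub_one_of_lt (hdeg (v j).1)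
          exact Nat.add_le_add this hkl
        · refine (natDegree_C_mul_le _ _).trans ((natDegree_derivNumerator_le _ _ _ _).trans ?_)
          have : ((v j).2 : (ZMod p)[X]).natDegree ≤ D - 1 := Nat.le_sub_one_of_lt (hdeg (v j).2)
          exact Nat.add_le_add this hkl

theorem stepanov_count {F : (ZMod p)[X]} {e l D J : ℕ} (he : 2 * e + 1 = p)
    {c : ZMod p} (hc : Odd (F.rootMultiplicity c)) (hF0 : F.eval 0 ≠ 0)
    (hD : 2 * D + F.natDegree ≤ p) (hD0 : 0 < D) (hl0 : 0 < l) (hl : l ≤ p)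
    (hcount : l * (D + F.natDegree * l + J) < 2 * J * D) (a : ZMod p) :
    l * #{x : ZMod p | F.eval x ^ e = a} ≤ F.natDegree * (l + e) + D + J * p := by
  obtain ⟨r, s, hr, hs, ⟨j0, hj0⟩, hk⟩ := exists_auxiliary_pair F (e := e) hD0 hcount a
  set P : (ZMod p)[X] := F ^ l * ∑ j : Fin J, X ^ (j.val * p) * (r j + F ^ e * s j) with hP
  have hF : F ≠ 0 := by rintro rfl; simp at hF0
  have hP0 : P ≠ 0 := by
    intro h0
    apply hj0
    apply sum_X_pow_mul_ne_zero he hc hF0 hD r s hr hs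
    exact (mul_eq_zero.1 h0).resolve_left (pow_ne_zero _ hF)
  have hdegP : P.natDegree ≤ F.natDegree * (l + e) + D + J * p := by
    refine natDegree_mul_le.trans ?_
    have h1 : (F ^ l).natDegree ≤ F.natDegree * l := by
      rw [mul_comm]; exact natDegree_pow_le
    have h2 : (∑ j : Fin J, X ^ (j.val * p) * (r j + F ^ e * s j)).natDegree ≤
        J * p + (F.natDegree * e + D) := by
      apply natDegree_sum_le_of_forall_le
      intro j _
      refine natDegree_mul_le.trans (Nat.add_le_add ?_ ?_)
      · rw [natDegree_X_pow]
        exact Nat.mul_le_mul_right _ j.isLt.le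
      · refine (natDegree_add_le _ _).trans (max_le ?_ ?_)
        · have := hr j; omega
        · refine natDegree_mul_le.trans (Nat.add_le_add ?_ (hs j).le)
          rw [mul_comm]; exact natDegree_pow_le
    rw [mul_add]
    omega
  have hPexp : P = ∑ j : Fin J, X ^ (j.val * p) * (F ^ l * r j + F ^ (l + e) * s j) := by
    rw [hP, mul_sum]
    refine sum_congr rfl fun j _ => ?_
    rw [pow_add]; ring
  have hmult : ∀ x : ZMod p, F.eval x ^ e = a → l ≤ P.rootMultiplicity x := by
    intro x hx
    obtain ⟨m, rfl⟩ : ∃ m, l = m + 1 := ⟨l - 1, by omega⟩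
    apply Nat.succ_le_of_lt
    apply lt_rootMultiplicity_of_isRoot_iterate_derivative_of_mem_nonZeroDivisors' hP0
    · intro k hkm
      rw [hPexp, iterate_derivative_sum, IsRoot.def]
      have h1 : ∀ j : Fin J, derivative^[k] (X ^ (j.val * p) *
          (F ^ (m + 1) * r j + F ^ (m + 1 + e) * s j)) = X ^ (j.val * p) *
          (F ^ (m + 1 - k) * (derivNumerator F (m + 1) k (r j) +
            F ^ e * derivNumerator F (m + 1 + e) k (s j))) := by
        intro j
        rw [iterate_derivative_X_pow_mul, iterate_map_add,
          iterate_derivative_pow_mul _ _ (by omega), iterate_derivative_pow_mul _ _ (by omega),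
          show m + 1 + e - k = (m + 1 - k) + e by omega, pow_add]
        ring
      have h2 := congrArg (eval x) (hk k (by omega))
      rw [sum_congr rfl fun j _ => h1 j, eval_finsetSum]
      rw [eval_finsetSum] at h2
      have h3 : ∀ j : Fin J, eval x (X ^ (j.val * p) *
          (F ^ (m + 1 - k) * (derivNumerator F (m + 1) k (r j) +
            F ^ e * derivNumerator F (m + 1 + e) k (s j)))) = eval x F ^ (m + 1 - k) *
          eval x (X ^ j.val * (derivNumerator F (m + 1) k (r j) +
            C a * derivNumerator F (m + 1 + e) k (s j))) := by
        intro j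
        simp only [eval_mul, eval_pow, eval_X, eval_add, eval_C, hx]
        rw [mul_comm j.val p, pow_mul, ZMod.pow_card]
        ring
      rw [sum_congr rfl fun j _ => h3 j, ← mul_sum, h2, eval_zero, mul_zero]
    · intro k hkm hk0
      apply mem_nonZeroDivisors_of_ne_zero
      rw [Ne, ZMod.natCast_eq_zero_iff]
      intro hdvd
      have := Nat.le_of_dvd (by omega) hdvd
      omega
  have hcard : #{x : ZMod p | F.eval x ^ e = a} * l ≤ P.natDegree := by
    refine le_trans ?_ (card_roots' P)
    have hsub : l • ({x : ZMod p | F.eval x ^ e = a} : Finset (ZMod p)).val ≤ P.roots := by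
      rw [Multiset.le_iff_count]
      intro x
      rw [Multiset.count_nsmul, count_roots]
      by_cases hx : F.eval x ^ e = a
      · have h1 : Multiset.count x ({x : ZMod p | F.eval x ^ e = a} : Finset (ZMod p)).val = 1 := by
          apply Multiset.count_eq_one_of_mem (nodup _)
          simpa using hx
        rw [h1, mul_one]
        exact hmult x hx
      · rw [Multiset.count_eq_zero_of_notMem]
        · simp
        · simpa using hx
    have := Multiset.card_le_card hsub
    rw [Multiset.card_nsmul, mul_comm] at this
    exact this
  rw [mul_comm]
  exact hcard.trans hdegP

end Stepanov

section CharacterSums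
open Polynomial

variable {p : ℕ} [Fact p.Prime] {ι : Type*} [Fintype ι]

theorem rootMultiplicity_prod_X_add_C (f : ι → ZMod p) (c : ZMod p) :
    (∏ i, (X + C (f i))).rootMultiplicity (-c) = #{i | f i = c} := by
  have h : ∏ i, (X + C (f i)) =
      (((univ : Finset ι).val.map (fun i => -f i)).map fun a => X - C a).prod := by
    rw [Multiset.map_map, prod_eq_multiset_prod]
    simp
  rw [h, ← count_roots, roots_multiset_prod_X_sub_C, Multiset.count_map, card_def]
  congr 1
  rw [filter_val]
  apply Multiset.filter_congr
  intro x _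
  rw [neg_inj, eq_comm]

theorem stepanov_parameters {n p s : ℕ} (hn : 1 ≤ n) (hs : 100 * n ≤ s) (h1 : s * s ≤ p) :
    s * ((p - n) / 2 + n * s + (s / 2 + 2 * n + 5)) <
      2 * (s / 2 + 2 * n + 5) * ((p - n) / 2) ∧ 0 < (p - n) / 2 := by
  have hp : 100 * n * s ≤ p := by nlinarith
  have hp' : 10000 * n ≤ p := by nlinarith
  obtain ⟨D, hD⟩ : ∃ D, D = (p - n) / 2 := ⟨_, rfl⟩
  obtain ⟨t, ht⟩ : ∃ t, t = s / 2 := ⟨_, rfl⟩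
  rw [← hD, ← ht]
  have hD1 : p ≤ 2 * D + n + 1 := by omega
  have ht1 : s ≤ 2 * t + 1 := by omega
  have ht2 : 2 * t ≤ s := by omega
  refine ⟨?_, by omega⟩
  have e1 : s * D ≤ (2 * t + 1) * D := Nat.mul_le_mul_right _ ht1
  have e2 : n * (s * s) ≤ n * p := Nat.mul_le_mul_left _ h1
  have e3 : s * (2 * t) ≤ s * s := Nat.mul_le_mul_left _ ht2
  have e4 : n * p ≤ n * (2 * D + n + 1) := Nat.mul_le_mul_left _ hD1
  have e5 : n * 10000 * n ≤ n * p := by nlinarith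
  have e6 : n ≤ n * n := Nat.le_mul_self n
  nlinarith

theorem stepanov_bound {n p s e N : ℕ} (hn : 1 ≤ n) (hs : 100 * n ≤ s)
    (h2 : p < (s + 1) * (s + 1)) (he : 2 * e + 1 = p)
    (h : s * N ≤ n * (s + e) + (p - n) / 2 + (s / 2 + 2 * n + 5) * p) :
    2 * N ≤ p + 20 * n * s := by
  obtain ⟨D, hD⟩ : ∃ D, D = (p - n) / 2 := ⟨_, rfl⟩
  obtain ⟨t, ht⟩ : ∃ t, t = s / 2 := ⟨_, rfl⟩
  rw [← hD, ← ht] at h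
  have hD1 : 2 * D ≤ p := by omega
  have ht2 : 2 * t ≤ s := by omega
  have e1 : 2 * t * p ≤ s * p := Nat.mul_le_mul_right _ ht2
  have e2 : n * (2 * e) ≤ n * p := Nat.mul_le_mul_left _ (by omega)
  have e3 : p ≤ n * p := Nat.le_mul_of_pos_left _ hn
  have e4 : s * (2 * N) ≤ 2 * n * s + n * p + p + s * p + (4 * n + 10) * p := by nlinarith
  have e5 : s * (2 * N) ≤ s * p + 2 * n * s + 16 * (n * p) := by nlinarith
  have e6 : n * p ≤ n * (s * s + 2 * s) := Nat.mul_le_mul_left _ (by nlinarith)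
  have e7 : s * (2 * N) ≤ s * (p + 2 * n + 16 * n * s + 32 * n) := by nlinarith
  have e8 := Nat.le_of_mul_le_mul_left e7 (by omega)
  have e9 : n * 100 ≤ n * s := Nat.mul_le_mul_left _ (by omega)
  nlinarith

theorem card_pow_eq_le (hp2 : p ≠ 2) (f : ι → ZMod p) {c : ZMod p} (hc : Odd #{i | f i = c})
    (hf : ∀ i, f i ≠ 0) (hcard : 100 * Fintype.card ι ≤ p.sqrt) (a : ZMod p) :
    2 * #{x : ZMod p | (∏ i, (x + f i)) ^ (p / 2) = a} ≤ p + 20 * Fintype.card ι * p.sqrt := by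
  have hι : 1 ≤ Fintype.card ι := by
    obtain ⟨i, -⟩ := card_pos.1 hc.pos
    exact Fintype.card_pos_iff.2 ⟨i⟩
  have hp : Odd p := (Fact.out : p.Prime).odd_of_ne_two hp2
  have he : 2 * (p / 2) + 1 = p := Nat.two_mul_div_two_add_one_of_odd hp
  have hs1 := Nat.sqrt_le p
  have hs2 := Nat.sqrt_lt_self (Fact.out : p.Prime).one_lt
  obtain ⟨hcount, hD0⟩ := stepanov_parameters hι hcard hs1
  have hdeg : (∏ i, (X + C (f i))).natDegree = Fintype.card ι := by
    rw [natDegree_prod_of_monic _ _ fun i _ => monic_X_add_C _]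
    simp
  have := stepanov_count (F := ∏ i, (X + C (f i))) (D := (p - Fintype.card ι) / 2)
    (l := p.sqrt) (J := p.sqrt / 2 + 2 * Fintype.card ι + 5) he (c := -c)
    (by rw [rootMultiplicity_prod_X_add_C]; exact hc)
    (by simp [eval_prod, prod_ne_zero_iff, hf]) (by rw [hdeg]; omega) hD0 (by omega) hs2.le
    (by rw [hdeg]; exact hcount) a
  rw [hdeg] at this
  simp only [eval_prod, eval_add, eval_X, eval_C] at this
  exact stepanov_bound hι hcard
    (Nat.sqrt_lt'.1 (Nat.lt_succ_self _) |>.trans_le (by rw [sq])) he this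

theorem abs_sum_quadraticChar_prod_le_of_ne_zero (hp2 : p ≠ 2) (f : ι → ZMod p) {c : ZMod p}
    (hc : Odd #{i | f i = c}) (hf : ∀ i, f i ≠ 0) (hcard : 100 * Fintype.card ι ≤ p.sqrt) :
    |∑ x : ZMod p, quadraticChar (ZMod p) (∏ i, (x + f i))| ≤ 21 * Fintype.card ι * p.sqrt := by
  have hp : Odd p := (Fact.out : p.Prime).odd_of_ne_two hp2
  have hring : ringChar (ZMod p) ≠ 2 := by rwa [ZMod.ringChar_zmod_n]
  have hne : (1 : ZMod p) ≠ -1 := by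
    intro h
    exact hring ((neg_one_eq_one_iff.1 h.symm))
  have key : ∀ y : ZMod p, (quadraticChar (ZMod p) y = 1 ↔ y ^ (p / 2) = 1) ∧
      (quadraticChar (ZMod p) y = -1 ↔ y ^ (p / 2) = -1) := by
    intro y
    have h := quadraticChar_eq_pow_of_char_ne_two' hring y
    rw [ZMod.card] at h
    rw [← h]
    rcases eq_or_ne y 0 with rfl | hy
    · simp
    · rcases quadraticChar_dichotomy hy with h1 | h1 <;> rw [h1] <;> simp [hne, hne.symm]
  have h1 := card_pow_eq_le hp2 f hc hf hcard 1
  have h2 := card_pow_eq_le hp2 f hc hf hcard (-1)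
  simp_rw [← (key _).1] at h1
  simp_rw [← (key _).2] at h2
  set χ : ZMod p → ℤ := fun x => quadraticChar (ZMod p) (∏ i, (x + f i)) with hχ
  have hval : ∀ x, χ x = (if χ x = 1 then 1 else 0) - (if χ x = -1 then 1 else 0) := by
    intro x
    by_cases h0 : ∏ i, (x + f i) = 0
    · simp only [hχ, h0, quadraticChar_zero]; simp
    · rcases quadraticChar_dichotomy h0 with h1 | h1 <;> simp only [hχ, h1] <;> simp
  have hsum : ∑ x, χ x = (#{x | χ x = 1} : ℤ) - #{x | χ x = -1} := by
    rw [sum_congr rfl fun x _ => hval x, sum_sub_distrib, card_filter, card_filter]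
    push_cast
    rfl
  have htot : p ≤ #{x | χ x = 1} + #{x | χ x = -1} + Fintype.card ι := by
    have hz : #{x | χ x = 0} ≤ Fintype.card ι := by
      have : ({x | χ x = 0} : Finset (ZMod p)) ⊆ univ.image (fun i => -f i) := by
        intro x hx
        simp only [mem_filter, mem_univ, true_and, hχ, quadraticChar_eq_zero_iff,
          prod_eq_zero_iff] at hx
        obtain ⟨i, hi⟩ := hx
        exact mem_image.2 ⟨i, mem_univ _, (eq_neg_of_add_eq_zero_left hi).symm⟩
      exact (card_le_card this).trans card_image_le
    have hall : (univ : Finset (ZMod p)) ⊆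
        (univ.filter (fun x => χ x = 1) ∪ univ.filter (fun x => χ x = -1)) ∪
          univ.filter (fun x => χ x = 0) := by
      intro x _
      by_cases h0 : ∏ i, (x + f i) = 0
      · simp only [mem_union, mem_filter, mem_univ, true_and, hχ, h0, quadraticChar_zero]; simp
      · rcases quadraticChar_dichotomy h0 with h1 | h1 <;>
          simp only [mem_union, mem_filter, mem_univ, true_and, hχ, h1] <;> simp
    have h3 := card_le_card hall
    rw [card_univ, ZMod.card] at h3
    have h4 := card_union_le (univ.filter (fun x => χ x = 1) ∪ univ.filter (fun x => χ x = -1))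
      (univ.filter (fun x => χ x = 0))
    have h5 := card_union_le (univ.filter (fun x => χ x = 1)) (univ.filter (fun x => χ x = -1))
    omega
  have hn : Fintype.card ι ≤ Fintype.card ι * p.sqrt := by
    rcases Nat.eq_zero_or_pos (Fintype.card ι) with h | h
    · simp [h]
    · exact Nat.le_mul_of_pos_right _ (by omega)
  rw [hsum, abs_le]
  constructor <;> nlinarith

/-- **Weil bound** for products of quadratic characters at shifted arguments, with an explicit
nonoptimal constant. -/
theorem abs_sum_quadraticChar_prod_le (hp2 : p ≠ 2) (f : ι → ZMod p) {c : ZMod p}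
    (hc : Odd #{i | f i = c}) :
    |∑ x : ZMod p, ((quadraticChar (ZMod p) (∏ i, (x + f i)) : ℤ) : ℝ)| ≤
      200 * Fintype.card ι * √p := by
  have hι : 1 ≤ Fintype.card ι := by
    obtain ⟨i, -⟩ := card_pos.1 hc.pos
    exact Fintype.card_pos_iff.2 ⟨i⟩
  have hp0 : 0 < p := (Fact.out : p.Prime).pos
  have hsq : (p.sqrt : ℝ) ≤ √p := Real.nat_sqrt_le_real_sqrt
  by_cases hcard : 100 * Fintype.card ι ≤ p.sqrt
  · obtain ⟨t, ht⟩ : ∃ t : ZMod p, t ∉ univ.image (fun i => -f i) := by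
      by_contra! hcon
      have h1 : (univ : Finset (ZMod p)) ⊆ univ.image (fun i => -f i) := fun x _ => hcon x
      have h2 := (card_le_card h1).trans card_image_le
      rw [card_univ, card_univ, ZMod.card] at h2
      have := Nat.sqrt_le_self p
      omega
    have h1 := abs_sum_quadraticChar_prod_le_of_ne_zero hp2 (fun i => t + f i) (c := t + c)
      (by simpa using hc) (fun i h => ht (mem_image.2 ⟨i, mem_univ _,
        (eq_neg_of_add_eq_zero_left h).symm⟩)) hcard
    have h2 : ∑ x : ZMod p, quadraticChar (ZMod p) (∏ i, (x + (t + f i))) =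
        ∑ x : ZMod p, quadraticChar (ZMod p) (∏ i, (x + f i)) := by
      rw [← Equiv.sum_comp (Equiv.addRight t)
        (fun x => quadraticChar (ZMod p) (∏ i, (x + f i)))]
      simp only [Equiv.coe_addRight, add_assoc]
    rw [h2] at h1
    have h3 : |∑ x : ZMod p, ((quadraticChar (ZMod p) (∏ i, (x + f i)) : ℤ) : ℝ)| ≤
        21 * Fintype.card ι * p.sqrt := by exact_mod_cast h1
    refine h3.trans ?_
    gcongr
    norm_num
  · have h1 : |∑ x : ZMod p, ((quadraticChar (ZMod p) (∏ i, (x + f i)) : ℤ) : ℝ)| ≤ p := by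
      refine (abs_sum_le_sum_abs _ _).trans ?_
      have : ∀ x : ZMod p, |((quadraticChar (ZMod p) (∏ i, (x + f i)) : ℤ) : ℝ)| ≤ 1 := by
        intro x
        by_cases h0 : ∏ i, (x + f i) = 0
        · simp [h0]
        · rcases quadraticChar_dichotomy h0 with h1 | h1 <;> simp [h1]
      refine (sum_le_sum fun x _ => this x).trans ?_
      simp [ZMod.card]
    refine h1.trans ?_
    have h2 : (√p : ℝ) ≤ 200 * Fintype.card ι := by
      have h3 : √(p : ℝ) < p.sqrt + 1 := Real.real_sqrt_lt_nat_sqrt_succ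
      have h4 : (p.sqrt : ℝ) + 1 ≤ 100 * Fintype.card ι := by exact_mod_cast (not_le.1 hcard)
      linarith
    calc (p : ℝ) = √p * √p := (Real.mul_self_sqrt (Nat.cast_nonneg _)).symm
      _ ≤ 200 * Fintype.card ι * √p := by gcongr

end CharacterSums

section Averages

/-- The average of `f` over the residues modulo `d`. -/
noncomputable def av (d : ℕ) (f : ℤ → ℝ) : ℝ := (∑ x ∈ range d, f x) / d

theorem av_mono {d : ℕ} {f g : ℤ → ℝ} (h : ∀ x : ℕ, f x ≤ g x) : av d f ≤ av d g :=
  div_le_div_of_nonneg_right (sum_le_sum fun x _ => h x) (Nat.cast_nonneg d)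

theorem av_nonneg {d : ℕ} {f : ℤ → ℝ} (h : ∀ x : ℕ, 0 ≤ f x) : 0 ≤ av d f :=
  div_nonneg (sum_nonneg fun x _ => h x) (Nat.cast_nonneg d)

theorem av_const {d : ℕ} (hd : d ≠ 0) (c : ℝ) : av d (fun _ => c) = c := by
  have : (d : ℝ) ≠ 0 := by exact_mod_cast hd
  simp [av]
  field_simp

theorem av_add (d : ℕ) (f g : ℤ → ℝ) : av d (fun x => f x + g x) = av d f + av d g := by
  simp [av, sum_add_distrib, add_div]

theorem av_mul_left (d : ℕ) (c : ℝ) (f : ℤ → ℝ) : av d (fun x => c * f x) = c * av d f := by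
  simp [av, ← mul_sum, mul_div_assoc]

theorem av_sum {ι : Type*} (d : ℕ) (s : Finset ι) (f : ι → ℤ → ℝ) :
    av d (fun x => ∑ i ∈ s, f i x) = ∑ i ∈ s, av d (f i) := by
  simp only [av]
  rw [sum_comm, sum_div]

theorem av_add_const {d : ℕ} {f : ℤ → ℝ} {c : ℝ} (hd : d ≠ 0) :
    av d (fun x => f x + c) = av d f + c := by
  rw [av_add, av_const hd]

/-- Summing over the residues modulo a product of coprime moduli. -/
theorem sum_range_mul_of_coprime {m n : ℕ} (hm : 0 < m) (hn : 0 < n) (h : m.Coprime n)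
    (F : ℤ → ℤ → ℝ) (h1 : ∀ x x' y, x ≡ x' [ZMOD m] → F x y = F x' y)
    (h2 : ∀ x y y', y ≡ y' [ZMOD n] → F x y = F x y') :
    ∑ x ∈ range (m * n), F x x = ∑ x ∈ range m, ∑ y ∈ range n, F x y := by
  rw [← sum_product']
  refine sum_bij' (fun x _ => (x % m, x % n))
    (fun z _ => (Nat.chineseRemainder h z.1 z.2 : ℕ)) ?_ ?_ ?_ ?_ ?_
  · intro x _
    simp [Nat.mod_lt, hm, hn]
  · intro z _
    rw [mem_range]
    exact Nat.chineseRemainder_lt_mul h _ _ hm.ne' hn.ne'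
  · intro x hx
    have h3 := Nat.chineseRemainder_modEq_unique h (a := x % m) (b := x % n) (z := x)
      (Nat.mod_modEq x m).symm (Nat.mod_modEq x n).symm
    have h4 := Nat.chineseRemainder_lt_mul h (x % m) (x % n) hm.ne' hn.ne'
    exact (Nat.ModEq.eq_of_lt_of_lt h3 (mem_range.1 hx) h4).symm
  · rintro ⟨a, b⟩ hab
    simp only [mem_product, mem_range] at hab
    have h3 := (Nat.chineseRemainder h a b).2
    ext
    · exact Eq.trans (show _ % m = a % m from h3.1) (Nat.mod_eq_of_lt hab.1)
    · exact Eq.trans (show _ % n = b % n from h3.2) (Nat.mod_eq_of_lt hab.2)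
  · intro x _
    rw [h1 x ((x % m : ℕ) : ℤ) x (by push_cast; exact (Int.mod_modEq x m).symm),
      h2 _ x ((x % n : ℕ) : ℤ) (by push_cast; exact (Int.mod_modEq x n).symm)]

theorem av_mul_of_coprime {m n : ℕ} (hm : 0 < m) (hn : 0 < n) (h : m.Coprime n)
    (F : ℤ → ℤ → ℝ) (h1 : ∀ x x' y, x ≡ x' [ZMOD m] → F x y = F x' y)
    (h2 : ∀ x y y', y ≡ y' [ZMOD n] → F x y = F x y') :
    av (m * n) (fun x => F x x) = av m fun x => av n fun y => F x y := by
  simp only [av]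
  rw [sum_range_mul_of_coprime hm hn h F h1 h2, ← sum_div, div_div]
  push_cast
  rw [mul_comm (m : ℝ)]

theorem sum_range_eq_sum_zmod {d : ℕ} [NeZero d] (f : ℤ → ℝ) :
    ∑ x ∈ range d, f x = ∑ z : ZMod d, f z.val := by
  symm
  refine sum_bij' (fun z _ => z.val) (fun x _ => (x : ZMod d)) ?_ ?_ ?_ ?_ ?_
  · intro z _; exact mem_range.2 z.val_lt
  · simp
  · intro z _; simp
  · intro x hx; exact ZMod.val_cast_of_lt (mem_range.1 hx)
  · simp

theorem sum_range_comp_of_bijective {d : ℕ} [NeZero d] {f : ℤ → ℝ}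
    (hf : ∀ x x', x ≡ x' [ZMOD d] → f x = f x') (g : ℤ → ℤ) (e : ZMod d → ZMod d)
    (he : e.Bijective) (hg : ∀ x : ℤ, ((g x : ℤ) : ZMod d) = e x) :
    ∑ x ∈ range d, f (g x) = ∑ x ∈ range d, f x := by
  rw [sum_range_eq_sum_zmod f, sum_range_eq_sum_zmod (fun x => f (g x)),
    ← he.sum_comp (fun z : ZMod d => f z.val)]
  refine sum_congr rfl fun z _ => hf _ _ ?_
  rw [← ZMod.intCast_eq_intCast_iff, hg]
  simp

theorem sum_range_add_left {d : ℕ} (hd : d ≠ 0) {f : ℤ → ℝ}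
    (hf : ∀ x x', x ≡ x' [ZMOD d] → f x = f x') (t : ℤ) :
    ∑ x ∈ range d, f (x + t) = ∑ x ∈ range d, f x := by
  have : NeZero d := ⟨hd⟩
  exact sum_range_comp_of_bijective hf (fun x => x + t) (fun z => z + t)
    (Equiv.addRight (t : ZMod d)).bijective (by simp)

theorem sum_prod_range_of_primes (S : Finset ℕ) (hS : ∀ p ∈ S, p.Prime) (f : ℕ → ℤ → ℝ)
    (hf : ∀ p ∈ S, ∀ x x', x ≡ x' [ZMOD p] → f p x = f p x') :
    ∑ x ∈ range (∏ p ∈ S, p), ∏ p ∈ S, f p x = ∏ p ∈ S, ∑ x ∈ range p, f p x := by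
  induction S using Finset.induction_on with
  | empty => simp
  | insert p S hp ih =>
    have hSS : ∀ r ∈ S, r.Prime := fun r hr => hS r (mem_insert_of_mem hr)
    simp_rw [prod_insert hp]
    rw [← ih hSS fun r hr => hf r (mem_insert_of_mem hr)]
    have hpp := hS p (mem_insert_self _ _)
    rw [sum_range_mul_of_coprime hpp.pos (prod_pos fun r hr => (hSS r hr).pos)
      (Nat.Coprime.prod_right fun r hr => (Nat.coprime_primes hpp (hSS r hr)).2
        (fun h => hp (h ▸ hr))) (fun x y => f p x * ∏ r ∈ S, f r y)]
    · simp_rw [← mul_sum, sum_mul]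
    · intro x x' y h
      rw [hf p (mem_insert_self _ _) x x' h]
    · intro x y y' h
      congr 1
      refine prod_congr rfl fun r hr => hf r (mem_insert_of_mem hr) _ _ (h.of_dvd ?_)
      exact_mod_cast dvd_prod_of_mem (fun r => r) hr

end Averages

section Jacobi

/-- The product of the quadratic characters modulo the primes in `S`. -/
noncomputable def chi (S : Finset ℕ) (x : ℤ) : ℝ := ((∏ p ∈ S, jacobiSym x p : ℤ) : ℝ)

theorem chi_congr (S : Finset ℕ) {x x' : ℤ} (h : x ≡ x' [ZMOD (∏ p ∈ S, p : ℕ)]) :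
    chi S x = chi S x' := by
  rw [chi, chi]
  congr 1
  refine prod_congr rfl fun p hp => jacobiSym.mod_left' (h.of_dvd ?_)
  exact_mod_cast dvd_prod_of_mem (fun r => r) hp

theorem chi_mul (S : Finset ℕ) (x y : ℤ) : chi S (x * y) = chi S x * chi S y := by
  simp [chi, jacobiSym.mul_left, prod_mul_distrib]

theorem abs_chi_le (S : Finset ℕ) (x : ℤ) : |chi S x| ≤ 1 := by
  rw [chi, Int.cast_prod, abs_prod]
  refine prod_le_one (fun _ _ => abs_nonneg _) fun p _ => ?_
  rcases jacobiSym.trichotomy x p with h | h | h <;> simp [h]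

theorem chi_singleton (p : ℕ) (x : ℤ) : chi {p} x = jacobiSym x p := by simp [chi]

theorem chi_eq_prod (S : Finset ℕ) (x : ℤ) : chi S x = ∏ p ∈ S, chi {p} x := by simp [chi]

theorem abs_sum_prod_chi_le {p : ℕ} (hp : p.Prime) (hp2 : p ≠ 2) {ι : Type*} (s : Finset ι)
    (f : ι → ℤ) {c : ℤ} (hc : Odd #{i ∈ s | f i ≡ c [ZMOD p]}) :
    |∑ x ∈ range p, ∏ i ∈ s, chi {p} (x + f i)| ≤ 200 * #s * √p := by
  have : Fact p.Prime := ⟨hp⟩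
  have hc' : Odd #{i : s | ((f i : ℤ) : ZMod p) = (c : ZMod p)} := by
    convert hc using 1
    simp_rw [← ZMod.intCast_eq_intCast_iff]
    rw [← card_map (Function.Embedding.subtype _)]
    congr 1
    ext i
    simp [and_comm]
  have h := abs_sum_quadraticChar_prod_le hp2 (fun i : s => ((f i : ℤ) : ZMod p)) hc'
  rw [Fintype.card_coe] at h
  refine le_trans (le_of_eq ?_) h
  congr 1
  rw [sum_range_eq_sum_zmod (fun x => ∏ i ∈ s, chi {p} (x + f i))]
  refine sum_congr rfl fun z _ => ?_
  rw [map_prod, ← prod_coe_sort]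
  push_cast
  refine prod_congr rfl fun i _ => ?_
  rw [chi_singleton, ← jacobiSym.legendreSym.to_jacobiSym, legendreSym]
  simp

end Jacobi

section Thinning

/-- The density `(1 + χ_p(x)) / 2`, a lower bound for the indicator of the squares modulo `p`. -/
noncomputable def halfChi (p : ℕ) (x : ℤ) : ℝ := (1 + chi {p} x) / 2

theorem halfChi_nonneg (p : ℕ) (x : ℤ) : 0 ≤ halfChi p x := by
  have := (abs_le.1 (abs_chi_le {p} x)).1
  rw [halfChi]; linarith

theorem halfChi_le_one (p : ℕ) (x : ℤ) : halfChi p x ≤ 1 := by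
  have := (abs_le.1 (abs_chi_le {p} x)).2
  rw [halfChi]; linarith

theorem halfChi_congr {p : ℕ} {x x' : ℤ} (h : x ≡ x' [ZMOD p]) : halfChi p x = halfChi p x' := by
  rw [halfChi, halfChi, chi_congr {p} (by simpa using h)]

theorem prod_halfChi_congr (S : Finset ℕ) {x x' : ℤ} (h : x ≡ x' [ZMOD (∏ p ∈ S, p : ℕ)]) :
    ∏ p ∈ S, halfChi p x = ∏ p ∈ S, halfChi p x' := by
  refine prod_congr rfl fun p hp => halfChi_congr (h.of_dvd ?_)
  exact_mod_cast dvd_prod_of_mem (fun r => r) hp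

theorem prod_halfChi_mem (S : Finset ℕ) (x : ℤ) :
    0 ≤ ∏ p ∈ S, halfChi p x ∧ ∏ p ∈ S, halfChi p x ≤ 1 :=
  ⟨prod_nonneg fun p _ => halfChi_nonneg p x,
    prod_le_one (fun p _ => halfChi_nonneg p x) fun p _ => halfChi_le_one p x⟩

theorem av_prod_one_sub_halfChi_le {p L : ℕ} (hp : p.Prime) (hp2 : p ≠ 2) (hL : L ≤ p)
    {T : Finset ℕ} (hT : T ⊆ Icc 1 L) {c : ℕ → ℝ} (hc : ∀ t, 0 ≤ c t ∧ c t ≤ 1) :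
    av p (fun x => ∏ t ∈ T, (1 - c t * halfChi p (x + t))) ≤
      ∏ t ∈ T, (1 - c t / 2) + 200 * L / √p := by
  have hp0 : (0 : ℝ) < p := by exact_mod_cast hp.pos
  have hcard : (#T : ℝ) ≤ L := by exact_mod_cast (card_le_card hT).trans (by simp)
  have e : ∀ x : ℤ, ∏ t ∈ T, (1 - c t * halfChi p (x + t)) =
      ∑ U ∈ T.powerset, (∏ t ∈ U, (-(c t / 2))) * (∏ t ∈ T \ U, (1 - c t / 2)) *
        ∏ t ∈ U, chi {p} (x + t) := by
    intro x
    have : ∀ t ∈ T, 1 - c t * halfChi p (x + t) = -(c t / 2) * chi {p} (x + t) + (1 - c t / 2) := by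
      intro t _
      rw [halfChi]; ring
    rw [prod_congr rfl this, prod_add]
    refine sum_congr rfl fun U _ => ?_
    rw [prod_mul_distrib]; ring
  simp_rw [e]
  rw [av_sum, ← add_sum_erase _ _ (empty_mem_powerset T)]
  have e0 : av p (fun x => (∏ t ∈ ∅, (-(c t / 2))) * (∏ t ∈ T \ ∅, (1 - c t / 2)) *
      ∏ t ∈ ∅, chi {p} (x + (t : ℕ))) = ∏ t ∈ T, (1 - c t / 2) := by
    simp only [prod_empty, sdiff_empty, one_mul, mul_one]
    exact av_const hp.ne_zero _
  rw [e0]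
  refine add_le_add le_rfl ?_
  have hU : ∀ U ∈ T.powerset.erase ∅, av p (fun x => (∏ t ∈ U, (-(c t / 2))) *
      (∏ t ∈ T \ U, (1 - c t / 2)) * ∏ t ∈ U, chi {p} (x + (t : ℕ))) ≤
      ((∏ t ∈ U, (c t / 2)) * ∏ t ∈ T \ U, (1 - c t / 2)) * (200 * L / √p) := by
    intro U hU
    rw [mem_erase, mem_powerset] at hU
    obtain ⟨t0, ht0⟩ := nonempty_iff_ne_empty.2 hU.1
    rw [av_mul_left]
    refine (le_abs_self _).trans ?_
    rw [abs_mul, abs_mul, abs_prod, abs_prod]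
    have h1 : ∏ t ∈ U, |(-(c t / 2))| = ∏ t ∈ U, (c t / 2) := prod_congr rfl fun t _ => by
      rw [abs_neg, abs_of_nonneg]; linarith [(hc t).1]
    have h2 : ∏ t ∈ T \ U, |1 - c t / 2| = ∏ t ∈ T \ U, (1 - c t / 2) :=
      prod_congr rfl fun t _ => by rw [abs_of_nonneg]; linarith [(hc t).2]
    rw [h1, h2]
    refine mul_le_mul_of_nonneg_left ?_ (mul_nonneg
      (prod_nonneg fun t _ => by linarith [(hc t).1])
      (prod_nonneg fun t _ => by linarith [(hc t).2]))
    have h3 := abs_sum_prod_chi_le hp hp2 U (fun t => (t : ℤ)) (c := t0) (by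
      have : U.filter (fun t : ℕ => (t : ℤ) ≡ t0 [ZMOD p]) = {t0} := by
        ext t
        simp only [mem_filter, mem_singleton]
        constructor
        · rintro ⟨ht, h⟩
          rw [Int.natCast_modEq_iff] at h
          have m1 := mem_Icc.1 (hT (hU.2 ht))
          have m2 := mem_Icc.1 (hT (hU.2 ht0))
          have h4 : t - 1 ≡ t0 - 1 [MOD p] := by
            refine Nat.ModEq.add_right_cancel' 1 ?_
            rwa [Nat.sub_add_cancel m1.1, Nat.sub_add_cancel m2.1]
          have := h4.eq_of_lt_of_lt (by omega) (by omega)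
          omega
        · rintro rfl; exact ⟨ht0, Int.ModEq.refl _⟩
      rw [this]; simp)
    rw [av, abs_div, abs_of_pos hp0, div_le_div_iff₀ hp0 (Real.sqrt_pos.2 hp0)]
    have hUc : (#U : ℝ) ≤ L := le_trans (by exact_mod_cast card_le_card hU.2) hcard
    calc _ ≤ (200 * #U * √p) * √p := by gcongr
      _ = 200 * #U * p := by rw [mul_assoc, Real.mul_self_sqrt hp0.le]
      _ ≤ _ := by gcongr
  refine (sum_le_sum hU).trans ?_
  rw [← sum_mul]
  refine mul_le_of_le_one_left (by positivity) ?_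
  refine (sum_le_sum_of_subset_of_nonneg (erase_subset _ _) fun U _ _ => mul_nonneg
      (prod_nonneg fun t _ => by linarith [(hc t).1])
      (prod_nonneg fun t _ => by linarith [(hc t).2])).trans ?_
  rw [← prod_add]
  simp

theorem av_prod_one_sub_prod_halfChi_le {L : ℕ} {S : Finset ℕ}
    (hS : ∀ p ∈ S, p.Prime ∧ p ≠ 2 ∧ L ≤ p)
    {T : Finset ℕ} (hT : T ⊆ Icc 1 L) {c : ℕ → ℝ} (hc : ∀ t, 0 ≤ c t ∧ c t ≤ 1) :
    av (∏ p ∈ S, p) (fun y => ∏ t ∈ T, (1 - c t * ∏ p ∈ S, halfChi p (y + t))) ≤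
      ∏ t ∈ T, (1 - c t / 2 ^ #S) + ∑ p ∈ S, 200 * L / √p := by
  induction S using Finset.induction_on generalizing c with
  | empty => simp [av]
  | insert p S hp ih =>
    have hSS : ∀ r ∈ S, r.Prime ∧ r ≠ 2 ∧ L ≤ r := fun r hr => hS r (mem_insert_of_mem hr)
    obtain ⟨hpp, hp2, hpL⟩ := hS p (mem_insert_self _ _)
    have hpos : 0 < ∏ r ∈ S, r := prod_pos fun r hr => (hSS r hr).1.pos
    have hcop : p.Coprime (∏ r ∈ S, r) := Nat.Coprime.prod_right fun r hr =>
      (Nat.coprime_primes hpp (hSS r hr).1).2 (fun h => hp (h ▸ hr))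
    have e : ∀ y : ℤ, ∏ t ∈ T, (1 - c t * ∏ r ∈ insert p S, halfChi r (y + t)) =
        (fun x y : ℤ => ∏ t ∈ T, (1 - (c t * halfChi p (x + t)) * ∏ r ∈ S, halfChi r (y + t))) y y := by
      intro y
      simp only
      refine prod_congr rfl fun t _ => ?_
      rw [prod_insert hp]; ring
    simp_rw [e]
    rw [prod_insert hp, av_mul_of_coprime hpp.pos hpos hcop (fun x y : ℤ => ∏ t ∈ T,
      (1 - (c t * halfChi p (x + t)) * ∏ r ∈ S, halfChi r (y + t)))]
    · have step : ∀ x : ℕ, av (∏ r ∈ S, r) (fun y => ∏ t ∈ T, (1 - (c t * halfChi p ((x : ℤ) + t)) *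
          ∏ r ∈ S, halfChi r (y + t))) ≤
          ∏ t ∈ T, (1 - (c t / 2 ^ #S) * halfChi p ((x : ℤ) + t)) + ∑ r ∈ S, 200 * L / √r := by
        intro x
        refine (ih hSS (c := fun t => c t * halfChi p ((x : ℤ) + t)) fun t => ⟨mul_nonneg (hc t).1
          (halfChi_nonneg _ _), mul_le_one₀ (hc t).2 (halfChi_nonneg _ _)
          (halfChi_le_one _ _)⟩).trans (le_of_eq ?_)
        congr 1
        refine prod_congr rfl fun t _ => by ring
      refine (av_mono (g := fun x : ℤ => ∏ t ∈ T, (1 - (c t / 2 ^ #S) * halfChi p (x + t)) +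
        ∑ r ∈ S, 200 * L / √r) step).trans ?_
      rw [av_add_const hpp.ne_zero, sum_insert hp, ← add_assoc]
      refine add_le_add ((av_prod_one_sub_halfChi_le hpp hp2 hpL hT (c := fun t => c t / 2 ^ #S)
        fun t => ⟨by have := (hc t).1; positivity,
          div_le_one_of_le₀ ((hc t).2.trans (one_le_pow₀ one_le_two)) (by positivity)⟩).trans
        (le_of_eq ?_)) le_rfl
      congr 1
      refine prod_congr rfl fun t _ => ?_
      rw [card_insert_of_notMem hp, pow_succ, div_div]
    · intro x x' y h
      refine prod_congr rfl fun t _ => ?_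
      rw [halfChi_congr (h.add_right (t : ℤ))]
    · intro x y y' h
      refine prod_congr rfl fun t _ => ?_
      rw [prod_halfChi_congr S (h.add_right (t : ℤ))]

end Thinning

section Gaps

theorem isSquare_of_coprime {m n : ℕ} (h : m.Coprime n) {x : ℤ} (h1 : IsSquare (x : ZMod m))
    (h2 : IsSquare (x : ZMod n)) : IsSquare (x : ZMod (m * n)) := by
  obtain ⟨r, hr⟩ := h1
  obtain ⟨s, hs⟩ := h2
  refine ⟨(ZMod.chineseRemainder h).symm (r, s), ?_⟩
  rw [← map_mul, Prod.mk_mul_mk, ← hr, ← hs, RingEquiv.eq_symm_apply, map_intCast]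
  rfl

theorem isSquare_of_chi_ne {p : ℕ} (hp : p.Prime) {x : ℤ} (h : chi {p} x ≠ -1) :
    IsSquare (x : ZMod p) := by
  have : Fact p.Prime := ⟨hp⟩
  by_contra h1
  rw [← legendreSym.eq_neg_one_iff, jacobiSym.legendreSym.to_jacobiSym] at h1
  exact h (by rw [chi_singleton, h1]; simp)

theorem isSquare_mul_prod {a : ℕ} {S : Finset ℕ} (hS : ∀ p ∈ S, p.Prime)
    (ha : ∀ p ∈ S, a.Coprime p) {x : ℤ} (h1 : IsSquare (x : ZMod a))
    (h2 : ∀ p ∈ S, chi {p} x ≠ -1) : IsSquare (x : ZMod (a * ∏ p ∈ S, p)) := by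
  induction S using Finset.induction_on with
  | empty => rw [prod_empty, mul_one]; exact h1
  | insert p S hp ih =>
    have := ih (fun r hr => hS r (mem_insert_of_mem hr)) (fun r hr => ha r (mem_insert_of_mem hr))
      (fun r hr => h2 r (mem_insert_of_mem hr))
    have hpp := hS p (mem_insert_self _ _)
    have h3 := isSquare_of_coprime (Nat.Coprime.mul_left (ha p (mem_insert_self _ _))
      (Nat.Coprime.prod_left fun r hr => (Nat.coprime_primes (hS r (mem_insert_of_mem hr)) hpp).2
        (fun h => hp (h ▸ hr)))) this (isSquare_of_chi_ne hpp (h2 p (mem_insert_self _ _)))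
    have e : a * ∏ p ∈ insert p S, p = a * (∏ p ∈ S, p) * p := by
      rw [prod_insert hp]; ring
    rw [e]; exact h3

theorem gapCount_eq_card_range {M : ℕ} [NeZero M] (L : ℕ) :
    gapCount M (QR M) L =
      #{x ∈ range M | ∀ i ∈ Icc 1 L, ¬ IsSquare ((((x : ℕ) : ℤ) + ((i : ℕ) : ℤ) : ℤ) : ZMod M)} := by
  rw [gapCount]
  refine card_bij' (fun z _ => z.val) (fun x _ => (x : ZMod M)) ?_ ?_ ?_ ?_
  · intro z hz
    simp only [mem_filter, mem_univ, true_and, mem_QR_iff] at hz ⊢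
    exact ⟨mem_range.2 z.val_lt, by simpa using hz⟩
  · intro x hx
    simp only [mem_filter, mem_univ, true_and, mem_QR_iff] at hx ⊢
    simpa using hx.2
  · simp
  · intro x hx
    exact ZMod.val_cast_of_lt (mem_range.1 (mem_filter.1 hx).1)

open Classical in
/-- The number of squares modulo `a` among `x + 1, ..., x + L`. -/
noncomputable def sqCount (a L : ℕ) (x : ℤ) : ℕ :=
  #{i ∈ Icc 1 L | IsSquare ((x + ((i : ℕ) : ℤ) : ℤ) : ZMod a)}

theorem gapCount_div_le_av {M a L : ℕ} [NeZero M] {S : Finset ℕ} (hM : M = a * ∏ p ∈ S, p)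
    (hS : ∀ p ∈ S, p.Prime ∧ p ≠ 2 ∧ L ≤ p) (ha : ∀ p ∈ S, a.Coprime p) :
    (gapCount M (QR M) L : ℝ) / M ≤
      av a (fun x => (1 - 1 / 2 ^ #S) ^ sqCount a L x) + ∑ p ∈ S, 200 * L / √p := by
  classical
  have hM0 : M ≠ 0 := NeZero.ne M
  have ha0 : 0 < a := Nat.pos_of_ne_zero (by rintro rfl; simp at hM; exact hM0 hM)
  have hpos : 0 < ∏ r ∈ S, r := prod_pos fun r hr => (hS r hr).1.pos
  let F : ℤ → ℤ → ℝ := fun x y => ∏ t ∈ (Icc 1 L).filter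
    (fun i : ℕ => IsSquare ((x + (i : ℤ) : ℤ) : ZMod a)), (1 - 1 * ∏ p ∈ S, halfChi p (y + t))
  have h1 : (gapCount M (QR M) L : ℝ) / M ≤ av M (fun x => F x x) := by
    rw [av, gapCount_eq_card_range, card_filter]
    simp only [Nat.cast_sum, Nat.cast_ite, Nat.cast_one, Nat.cast_zero]
    refine div_le_div_of_nonneg_right (sum_le_sum fun x _ => ?_) (Nat.cast_nonneg _)
    split_ifs with h
    · refine ge_of_eq (prod_eq_one fun t ht => ?_)
      rw [mem_filter] at ht
      have := h t ht.1
      have h2 : ∃ p ∈ S, chi {p} ((x : ℤ) + t) = -1 := by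
        by_contra! hcon
        rw [hM] at this
        exact this (isSquare_mul_prod (fun p hp => (hS p hp).1) ha ht.2 hcon)
      obtain ⟨p, hp, hpe⟩ := h2
      rw [prod_eq_zero hp (by rw [halfChi, hpe]; norm_num)]
      simp
    · exact prod_nonneg fun t _ => by linarith [(prod_halfChi_mem S ((x : ℤ) + t)).2]
  refine h1.trans ?_
  have hF : av M (fun x => F x x) = av a fun x => av (∏ p ∈ S, p) fun y => F x y := by
    rw [hM]
    refine av_mul_of_coprime ha0 hpos (Nat.Coprime.prod_right fun r hr => ha r hr) F ?_ ?_
    · intro x x' y h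
      have e : ∀ i : ℕ, ((x + (i : ℤ) : ℤ) : ZMod a) = ((x' + (i : ℤ) : ℤ) : ZMod a) := fun i =>
        (ZMod.intCast_eq_intCast_iff _ _ _).2 (h.add_right _)
      simp only [F, e]
    · intro x y y' h
      refine prod_congr rfl fun t _ => ?_
      rw [prod_halfChi_congr S (h.add_right (t : ℤ))]
  rw [hF, ← av_add_const ha0.ne']
  refine av_mono fun x => (av_prod_one_sub_prod_halfChi_le hS (filter_subset _ _)
    (c := fun _ => 1) (fun _ => ⟨zero_le_one, le_rfl⟩)).trans (le_of_eq ?_)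
  rw [prod_const, sqCount]

/-- The incomplete character sum of length `H` starting at `u`. -/
noncomputable def incSum (R : Finset ℕ) (H : ℕ) (u : ℤ) : ℝ := ∑ t ∈ range H, chi R (u + t)

theorem incSum_congr (R : Finset ℕ) (H : ℕ) {x x' : ℤ} (h : x ≡ x' [ZMOD (∏ p ∈ R, p : ℕ)]) :
    incSum R H x = incSum R H x' :=
  sum_congr rfl fun _ _ => chi_congr R (h.add_right _)

open Classical in
/-- The starting points modulo `∏ p ∈ R, p` with an incomplete sum of size at least `θ`. -/
noncomputable def bigSet (R : Finset ℕ) (H : ℕ) (θ : ℝ) : Finset ℕ :=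
  {u ∈ range (∏ p ∈ R, p) | θ ≤ |incSum R H (u : ℤ)|}

theorem card_filter_div_eq {S R : Finset ℕ} (hS : ∀ p ∈ S, p.Prime) (hR : R ⊆ S)
    {P : ℤ → Prop} [DecidablePred P] (hP : ∀ x x', x ≡ x' [ZMOD (∏ p ∈ R, p : ℕ)] → (P x ↔ P x')) :
    (#{u ∈ range (∏ p ∈ S, p) | P (u : ℕ)} : ℝ) / (∏ p ∈ S, p : ℕ) =
      (#{u ∈ range (∏ p ∈ R, p) | P (u : ℕ)} : ℝ) / (∏ p ∈ R, p : ℕ) := by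
  have hpos : ∀ T ⊆ S, 0 < ∏ p ∈ T, p := fun T hT => prod_pos fun r hr => (hS r (hT hr)).pos
  have hcop : (∏ p ∈ R, p).Coprime (∏ p ∈ S \ R, p) :=
    Nat.Coprime.prod_left fun p hp => Nat.Coprime.prod_right fun r hr =>
      (Nat.coprime_primes (hS p (hR hp)) (hS r (sdiff_subset hr))).2
        (by rintro rfl; exact (mem_sdiff.1 hr).2 hp)
  have h := av_mul_of_coprime (hpos R hR) (hpos (S \ R) sdiff_subset) hcop
    (fun x _y => if P x then 1 else 0) (fun x x' y h => by simp only [hP x x' h]) (fun _ _ _ _ => rfl)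
  simp only [av_const (hpos (S \ R) sdiff_subset).ne'] at h
  rw [mul_comm, prod_sdiff hR] at h
  simp only [av, sum_boole] at h
  exact h

theorem gapCount_div_le_sum {M a L H : ℕ} [NeZero M] {S : Finset ℕ} (hM : M = a * ∏ p ∈ S, p)
    (hS : ∀ p ∈ S, p.Prime) (ha : ∀ p ∈ S, a.Coprime p) (hH : a * H ≤ L) (hH0 : 0 < H) :
    (gapCount M (QR M) L : ℝ) / M ≤
      ∑ R ∈ S.powerset.erase ∅, (#(bigSet R H (H / 2 ^ #S)) : ℝ) / (∏ p ∈ R, p : ℕ) := by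
  classical
  have hM0 : M ≠ 0 := NeZero.ne M
  have ha0 : 0 < a := Nat.pos_of_ne_zero (by rintro rfl; simp at hM; exact hM0 hM)
  have hpos : 0 < ∏ r ∈ S, r := prod_pos fun r hr => (hS r hr).pos
  let P : ℤ → Prop := fun u => ∃ R ∈ S.powerset.erase ∅, (H : ℝ) / 2 ^ #S ≤ |incSum R H u|
  have key : ∀ z : ℤ, (∀ t < H, ¬ IsSquare ((a * (z + (t : ℕ)) : ℤ) : ZMod M)) → P z := by
    intro z hz
    have h0 : ∀ t ∈ range H, ∏ p ∈ S, (chi {p} (a * (z + (t : ℕ))) + 1) = 0 := by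
      intro t ht
      have := hz t (mem_range.1 ht)
      by_contra hcon
      rw [hM] at this
      refine this (isSquare_mul_prod hS ha (by simp) fun p hp h => hcon (prod_eq_zero hp ?_))
      rw [h]; norm_num
    have h1 : ∑ t ∈ range H, ∏ p ∈ S, (chi {p} (a * (z + (t : ℕ))) + 1) = 0 := sum_eq_zero h0
    simp_rw [prod_add_one, ← chi_eq_prod, chi_mul] at h1
    rw [sum_comm] at h1
    simp_rw [← mul_sum] at h1
    rw [← add_sum_erase _ _ (empty_mem_powerset S)] at h1
    have h2 : chi ∅ (a : ℤ) * ∑ t ∈ range H, chi ∅ (z + (t : ℕ)) = H := by simp [chi]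
    rw [h2] at h1
    by_contra hcon
    have hcon' : ∀ R ∈ S.powerset.erase ∅, |incSum R H z| < (H : ℝ) / 2 ^ #S := by
      intro R hR
      by_contra h; exact hcon ⟨R, hR, not_lt.1 h⟩
    have h3 : (H : ℝ) ≤ ∑ R ∈ S.powerset.erase ∅, |incSum R H z| := by
      have : (H : ℝ) = |∑ R ∈ S.powerset.erase ∅, chi R a * incSum R H z| := by
        have e : ∑ R ∈ S.powerset.erase ∅, chi R a * incSum R H z = -(H : ℝ) := by
          simp only [incSum]; linarith
        rw [e, abs_neg, abs_of_nonneg (Nat.cast_nonneg _)]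
      rw [this]
      refine (abs_sum_le_sum_abs _ _).trans (sum_le_sum fun R _ => ?_)
      rw [abs_mul]
      exact mul_le_of_le_one_left (abs_nonneg _) (abs_chi_le _ _)
    have h4 : ∑ R ∈ S.powerset.erase ∅, |incSum R H z| ≤
        ∑ R ∈ S.powerset.erase ∅, (H : ℝ) / 2 ^ #S := sum_le_sum fun R hR => (hcon' R hR).le
    rw [sum_const, card_erase_of_mem (empty_mem_powerset S), card_powerset, nsmul_eq_mul,
      Nat.cast_sub Nat.one_le_two_pow] at h4
    push_cast at h4
    have h5 : ((2 : ℝ) ^ #S - 1) * (H / 2 ^ #S) < H := by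
      have : (0 : ℝ) < 2 ^ #S := by positivity
      have hH' : (0 : ℝ) < H := by exact_mod_cast hH0
      rw [sub_mul, mul_div_cancel₀ _ this.ne']
      have : 0 < (H : ℝ) / 2 ^ #S := by positivity
      linarith
    linarith
  have hPc : ∀ x x', x ≡ x' [ZMOD (∏ p ∈ S, p : ℕ)] → (P x ↔ P x') := by
    intro x x' h
    simp only [P]
    refine exists_congr fun R => and_congr_right fun hR => ?_
    rw [incSum_congr R H (h.of_dvd ?_)]
    exact_mod_cast prod_dvd_prod_of_subset _ _ _ (mem_powerset.1 (mem_erase.1 hR).2)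
  have h1 : gapCount M (QR M) L ≤ a * #{u ∈ range (∏ p ∈ S, p) | P ((u : ℕ) : ℤ)} := by
    rw [gapCount_eq_card_range]
    refine card_le_mul_card_image_of_maps_to (f := fun x => (x / a + 1) % ∏ p ∈ S, p) ?_ a ?_
    · intro x hx
      rw [mem_filter] at hx ⊢
      refine ⟨mem_range.2 (Nat.mod_lt _ hpos), ?_⟩
      push_cast
      rw [hPc _ ((x : ℤ) / a + 1) (by push_cast; exact Int.mod_modEq _ _)]
      refine key _ fun t ht => ?_
      have hxm := Nat.mod_lt x ha0
      have hxd := Nat.div_add_mod x a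
      have h8 := (Nat.mul_le_mul_left a (Nat.succ_le_of_lt ht)).trans hH
      rw [Nat.succ_eq_add_one, mul_add] at h8
      have h6 := hx.2 (a - x % a + a * t) (mem_Icc.2 ⟨by omega, by omega⟩)
      have h7 : (x : ℤ) + ((a - x % a + a * t : ℕ) : ℤ) = a * ((x : ℤ) / a + 1 + t) := by
        rw [Nat.cast_add, Nat.cast_sub hxm.le]
        push_cast
        have := Int.mul_ediv_add_emod (x : ℤ) a
        linarith
      rwa [h7] at h6
    · intro u hu
      have : #(Ico (a * ((u + (∏ p ∈ S, p) - 1) % ∏ p ∈ S, p))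
          (a * ((u + (∏ p ∈ S, p) - 1) % ∏ p ∈ S, p) + a)) = a := by simp
      refine le_trans (card_le_card ?_) this.le
      intro x hx
      rw [mem_filter, mem_filter, mem_range] at hx
      set q := ∏ p ∈ S, p
      have hxq : x / a < q := Nat.div_lt_of_lt_mul (hM ▸ hx.1.1)
      have e : (u + q - 1) % q = x / a := by
        rw [← hx.2]
        generalize x / a = k at hxq
        rcases Nat.lt_or_ge (k + 1) q with h | h
        · rw [Nat.mod_eq_of_lt h, show k + 1 + q - 1 = k + q by omega, Nat.add_mod_right,
            Nat.mod_eq_of_lt hxq]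
        · rw [show k + 1 = q by omega, Nat.mod_self, Nat.mod_eq_of_lt (by omega)]
          omega
      rw [e, mem_Ico]
      have hxm := Nat.mod_lt x ha0
      have hxd := Nat.div_add_mod x a
      omega
  have h2 : (gapCount M (QR M) L : ℝ) / M ≤
      (#{u ∈ range (∏ p ∈ S, p) | P ((u : ℕ) : ℤ)} : ℝ) / (∏ p ∈ S, p : ℕ) := by
    have hMr : (M : ℝ) = a * (∏ p ∈ S, p : ℕ) := by exact_mod_cast hM
    have haR : (0 : ℝ) < a := by exact_mod_cast ha0
    have hqR : (0 : ℝ) < (∏ p ∈ S, p : ℕ) := by exact_mod_cast hpos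
    rw [hMr, div_le_div_iff₀ (by positivity) hqR]
    have : (gapCount M (QR M) L : ℝ) ≤ a * #{u ∈ range (∏ p ∈ S, p) | P ((u : ℕ) : ℤ)} := by
      exact_mod_cast h1
    nlinarith
  refine h2.trans ?_
  have h3 : ∀ R ∈ S.powerset.erase ∅,
      (#(bigSet R H (H / 2 ^ #S)) : ℝ) / (∏ p ∈ R, p : ℕ) =
      (#{u ∈ range (∏ p ∈ S, p) | (H : ℝ) / 2 ^ #S ≤ |incSum R H ((u : ℕ) : ℤ)|} : ℝ) /
        (∏ p ∈ S, p : ℕ) := by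
    intro R hR
    rw [card_filter_div_eq hS (mem_powerset.1 (mem_erase.1 hR).2)
      (P := fun u => (H : ℝ) / 2 ^ #S ≤ |incSum R H u|)
      (fun x x' h => by rw [incSum_congr R H h]), bigSet]
  rw [sum_congr rfl h3, ← sum_div]
  refine div_le_div_of_nonneg_right ?_ (Nat.cast_nonneg _)
  rw [← Nat.cast_sum, Nat.cast_le]
  refine le_trans (card_le_card ?_) card_biUnion_le
  intro u hu
  rw [mem_filter] at hu
  obtain ⟨h, R, hR, h4⟩ := hu
  rw [mem_biUnion]
  exact ⟨R, hR, mem_filter.2 ⟨h, h4⟩⟩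

end Gaps

section Periodic

open Classical in
/-- The indicator of the squares modulo `a`. -/
noncomputable def sqInd (a : ℕ) (x : ℤ) : ℝ := if IsSquare (x : ZMod a) then 1 else 0

theorem sqInd_congr {a : ℕ} {x x' : ℤ} (h : x ≡ x' [ZMOD a]) : sqInd a x = sqInd a x' := by
  rw [sqInd, sqInd, (ZMod.intCast_eq_intCast_iff _ _ _).2 h]

theorem sum_sqInd {a : ℕ} [NeZero a] : ∑ x ∈ range a, sqInd a x = #(QR a) := by
  classical
  rw [sum_range_eq_sum_zmod]
  simp only [sqInd]
  have h : QR a = univ.filter fun z : ZMod a => IsSquare (((z.val : ℕ) : ℤ) : ZMod a) := by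
    ext z
    simp [mem_QR_iff]
  rw [h, card_filter]
  simp only [Nat.cast_sum, Nat.cast_ite, Nat.cast_one, Nat.cast_zero]
  congr!

theorem sqCount_eq_sum (a L : ℕ) (x : ℤ) :
    (sqCount a L x : ℝ) = ∑ i ∈ range L, sqInd a (x + 1 + i) := by
  classical
  rw [sqCount, card_filter]
  simp only [Nat.cast_sum, Nat.cast_ite, Nat.cast_one, Nat.cast_zero]
  rw [range_eq_Ico, ← Finset.Ico_succ_right_eq_Icc, sum_Ico_eq_sum_range, ← range_eq_Ico]
  refine sum_congr rfl fun i _ => ?_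
  rw [sqInd]
  have : x + ((1 + i : ℕ) : ℤ) = x + 1 + i := by push_cast; ring
  rw [this]

theorem sqCount_le (a L : ℕ) (x : ℤ) : sqCount a L x ≤ L := by
  classical
  rw [sqCount]
  exact (card_filter_le _ _).trans (by simp)

theorem sqCount_add_period (a L : ℕ) [NeZero a] (x : ℤ) :
    sqCount a (a + L) x = sqCount a L x + #(QR a) := by
  have h : (sqCount a (a + L) x : ℝ) = sqCount a L x + #(QR a) := by
    rw [sqCount_eq_sum, sqCount_eq_sum, add_comm a, sum_range_add, ← sum_sqInd]
    congr 1
    rw [← sum_range_add_left (NeZero.ne a) (fun x x' h => sqInd_congr h) (x + 1 + L)]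
    refine sum_congr rfl fun i _ => ?_
    congr 1
    push_cast; ring
  exact_mod_cast h

theorem av_sqCount (a L : ℕ) [NeZero a] : av a (fun x => (sqCount a L x : ℝ)) = #(QR a) * L / a := by
  simp_rw [sqCount_eq_sum]
  rw [av_sum]
  have : ∀ i ∈ range L, av a (fun x => sqInd a (x + 1 + (i : ℕ))) = #(QR a) / a := by
    intro i _
    rw [av, ← sum_sqInd, ← sum_range_add_left (NeZero.ne a) (fun x x' h => sqInd_congr h) (1 + i)]
    simp_rw [add_assoc]
  rw [sum_congr rfl this]
  simp; ring

theorem card_QR_le_half {a : ℕ} (ha : 4 ∣ a) : 2 * #(QR a) ≤ a := by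
  obtain ⟨b, rfl⟩ := ha
  have : QR (4 * b) ⊆ (range (2 * b)).image (fun x : ℕ => (x : ZMod (4 * b)) ^ 2) := by
    intro z hz
    obtain ⟨x, hx, rfl⟩ := mem_image.1 hz
    rw [mem_range] at hx
    rcases Nat.lt_or_ge x (2 * b) with h | h
    · exact mem_image_of_mem _ (mem_range.2 h)
    · refine mem_image.2 ⟨x - 2 * b, mem_range.2 (by omega), ?_⟩
      obtain ⟨y, rfl⟩ := Nat.exists_eq_add_of_le h
      have h0 : ((4 * b : ℕ) : ZMod (4 * b)) = 0 := ZMod.natCast_self _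
      push_cast at h0
      simp only [Nat.add_sub_cancel_left]
      push_cast
      linear_combination (-(b : ZMod (4 * b)) - y) * h0
  have h2 := (card_le_card this).trans card_image_le
  rw [card_range] at h2
  omega

theorem one_sub_pow_le {ρ : ℝ} (h0 : 0 ≤ ρ) (h1 : ρ ≤ 1) (N : ℕ) :
    (1 - ρ) ^ N ≤ 1 - N * ρ + N * (N - 1) / 2 * ρ ^ 2 := by
  induction N with
  | zero => simp
  | succ N ih =>
    rw [pow_succ']
    refine (mul_le_mul_of_nonneg_left ih (by linarith)).trans ?_
    push_cast
    have : 0 ≤ (N : ℝ) * (N - 1) := by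
      rcases N with _ | N
      · simp
      · push_cast; nlinarith [(Nat.cast_nonneg N : (0:ℝ) ≤ N)]
    nlinarith [mul_nonneg this (pow_nonneg h0 3)]

theorem sum_av_pow_sqCount_le {a : ℕ} [NeZero a] (ha : 4 ∣ a) {ρ : ℝ} (h0 : 0 < ρ)
    (h1 : ρ * a ≤ 1) (n : ℕ) :
    ∑ L ∈ range n, av a (fun x => (1 - ρ) ^ sqCount a L x) ≤
      a / (ρ * #(QR a)) - 1 / 2 + 3 * ρ * a ^ 3 := by
  set G : ℕ → ℝ := fun L => av a (fun x => (1 - ρ) ^ sqCount a L x) with hG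
  set k : ℕ := #(QR a) with hk
  have ha0 : (1 : ℝ) ≤ a := by exact_mod_cast Nat.one_le_iff_ne_zero.2 (NeZero.ne a)
  have hρ1 : ρ ≤ 1 := by nlinarith
  have hk1 : (1 : ℝ) ≤ k := by exact_mod_cast one_le_card_QR
  have hka : 2 * (k : ℝ) ≤ a := by exact_mod_cast card_QR_le_half ha
  have hG0 : ∀ L, 0 ≤ G L := fun L => av_nonneg fun x => pow_nonneg (by linarith) _
  set θ : ℝ := (1 - ρ) ^ k
  set P : ℝ := ∑ L ∈ range a, G L
  have hθ0 : 0 ≤ θ := pow_nonneg (by linarith) _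
  have hθ : θ ≤ 1 - k * ρ + k * (k - 1) / 2 * ρ ^ 2 := one_sub_pow_le h0.le hρ1 k
  have hkρ : k * ρ ≤ 1 / 2 := by nlinarith
  have hP0 : 0 ≤ P := sum_nonneg fun L _ => hG0 L
  set z : ℝ := (k - 1) * ρ / 2 with hz
  have hz0 : 0 ≤ z := by apply div_nonneg (mul_nonneg _ h0.le) <;> linarith
  have hz1 : z ≤ 1 / 4 := by rw [hz]; nlinarith
  have hθz : k * ρ * (1 - z) ≤ 1 - θ := by rw [hz]; nlinarith
  have hkρ0 : 0 < k * ρ := by positivity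
  have hθ1 : 0 < 1 - θ := lt_of_lt_of_le (by apply mul_pos hkρ0; linarith) hθz
  have hshift : ∀ L, G (a + L) = θ * G L := by
    intro L
    rw [hG]
    simp only [sqCount_add_period, pow_add]
    rw [← av_mul_left]
    simp only [θ, mul_comm, hk]
  have hblock : ∀ m, ∑ L ∈ range (a * m), G L ≤ P / (1 - θ) := by
    intro m
    induction m with
    | zero => simp; positivity
    | succ m ih =>
      rw [mul_add, mul_one, add_comm, sum_range_add]
      simp_rw [hshift]
      rw [← mul_sum]
      calc P + θ * ∑ L ∈ range (a * m), G L ≤ P + θ * (P / (1 - θ)) := by gcongr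
        _ = P / (1 - θ) := by field_simp; ring
  have hsum : ∑ L ∈ range n, G L ≤ P / (1 - θ) := by
    refine (sum_le_sum_of_subset_of_nonneg (range_mono ?_) fun L _ _ => hG0 L).trans (hblock n)
    exact Nat.le_mul_of_pos_left n (Nat.pos_of_ne_zero (NeZero.ne a))
  have hGle : ∀ L ∈ range a, G L ≤ 1 - ρ * (k / a) * L + ρ ^ 2 * a ^ 2 / 2 := by
    intro L hL
    have hLa : (L : ℝ) ≤ a := by exact_mod_cast (mem_range.1 hL).le
    have e : 1 - ρ * (k / a) * L + ρ ^ 2 * a ^ 2 / 2 =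
        av a (fun x => (-ρ) * (sqCount a L x : ℝ) + (1 + ρ ^ 2 * a ^ 2 / 2)) := by
      rw [av_add_const (NeZero.ne a), av_mul_left, av_sqCount]
      ring
    rw [e]
    refine av_mono fun x => (one_sub_pow_le h0.le hρ1 _).trans ?_
    have : (sqCount a L x : ℝ) ≤ a := le_trans (by exact_mod_cast sqCount_le a L x) hLa
    have h2 : (0 : ℝ) ≤ sqCount a L x := Nat.cast_nonneg _
    have h3 : (sqCount a L x : ℝ) * (sqCount a L x - 1) ≤ a ^ 2 := by nlinarith
    nlinarith [mul_le_mul_of_nonneg_right h3 (sq_nonneg ρ)]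
  have hP : P ≤ a - ρ * k * (a - 1) / 2 + ρ ^ 2 * a ^ 3 / 2 := by
    refine (sum_le_sum hGle).trans (le_of_eq ?_)
    rw [sum_add_distrib, sum_sub_distrib, ← mul_sum, ← Nat.cast_sum]
    have h2 : ((∑ i ∈ range a, i : ℕ) : ℝ) * 2 = a * (a - 1) := by
      have := Finset.sum_range_id_mul_two a
      have h3 : (((∑ i ∈ range a, i) * 2 : ℕ) : ℝ) = ((a * (a - 1) : ℕ) : ℝ) := by rw [this]
      rw [Nat.cast_mul, Nat.cast_mul, Nat.cast_sub (Nat.one_le_iff_ne_zero.2 (NeZero.ne a))] at h3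
      simpa using h3
    have h3 : ((∑ i ∈ range a, i : ℕ) : ℝ) = a * (a - 1) / 2 := by linarith
    rw [h3]
    simp only [sum_const, card_range, nsmul_eq_mul, mul_one]
    field_simp
  refine hsum.trans ?_
  have hz2 : 0 < 1 - z := by linarith
  have h3 : P / (1 - θ) ≤ P / (k * ρ * (1 - z)) :=
    div_le_div_of_nonneg_left hP0 (mul_pos hkρ0 hz2) hθz
  refine h3.trans ?_
  rw [div_le_iff₀ (mul_pos hkρ0 hz2)]
  refine hP.trans ?_
  have e : (a / (ρ * k) - 1 / 2 + 3 * ρ * a ^ 3) * (k * ρ * (1 - z)) =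
      (a - 1 / 2 * (k * ρ) + 3 * ρ * a ^ 3 * (k * ρ)) * (1 - z) := by
    field_simp
  rw [e]
  have hρa : 0 ≤ ρ ^ 2 * (a : ℝ) ^ 3 := by positivity
  have hρk : ρ ^ 2 * (a : ℝ) ^ 3 ≤ ρ ^ 2 * a ^ 3 * k := by nlinarith
  have h4 : 3 * ρ * (a : ℝ) ^ 3 * (k * ρ) * (1 - z) ≥ 9 / 4 * (ρ ^ 2 * a ^ 3) * k := by
    have : 0 ≤ 3 * ρ * (a : ℝ) ^ 3 * (k * ρ) := by positivity
    nlinarith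
  have h5 : (a : ℝ) * z ≤ ρ * k * (a - 1) / 2 - 1 / 2 * (k * ρ) := by
    rw [hz]; nlinarith
  nlinarith [mul_nonneg hkρ0.le hz0]

end Periodic

section Moments

theorem exists_factor_of_even_fibers {r B : ℕ} (hB : 0 < B) (f : Fin (2 * r) → ℕ)
    (hf : ∀ i, f i ∈ range B) (he : ∀ c, Even #{i | f i = c}) :
    ∃ g ∈ Fintype.piFinset fun _ : Fin r => range B, ∃ j : Fin (2 * r) → Fin r, f = g ∘ j := by
  classical
  have h1 : 2 * #(univ.image f) ≤ 2 * r := by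
    have := card_eq_sum_card_image f univ
    rw [card_univ, Fintype.card_fin] at this
    refine le_trans ?_ this.ge
    rw [mul_comm, ← smul_eq_mul]
    refine card_nsmul_le_sum _ _ _ fun c hc => ?_
    obtain ⟨i, _, hi⟩ := mem_image.1 hc
    obtain ⟨k, hk⟩ := he c
    have : 0 < #{i | f i = c} := card_pos.2 ⟨i, by simpa using hi⟩
    omega
  have h2 : Fintype.card (univ.image f) ≤ Fintype.card (Fin r) := by
    rw [Fintype.card_coe, Fintype.card_fin]; omega
  obtain ⟨e⟩ := Function.Embedding.nonempty_of_card_le h2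
  refine ⟨Function.extend e Subtype.val fun _ => 0, ?_,
    fun i => e ⟨f i, mem_image_of_mem f (mem_univ i)⟩, ?_⟩
  · rw [Fintype.mem_piFinset]
    intro k
    by_cases hk : ∃ a, e a = k
    · obtain ⟨a, rfl⟩ := hk
      rw [e.injective.extend_apply]
      obtain ⟨i, _, hi⟩ := mem_image.1 a.2
      rw [← hi]; exact hf i
    · rw [Function.extend_apply' _ _ _ hk]
      exact mem_range.2 hB
  · funext i
    simp only [Function.comp]
    rw [e.injective.extend_apply]

open Classical in
theorem card_even_fibers_le {r B : ℕ} (hB : 0 < B) :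
    #{f ∈ Fintype.piFinset fun _ : Fin (2 * r) => range B | ∀ c, Even #{i | f i = c}} ≤
      r ^ (2 * r) * B ^ r := by
  have h : {f ∈ Fintype.piFinset fun _ : Fin (2 * r) => range B | ∀ c, Even #{i | f i = c}} ⊆
      ((Fintype.piFinset fun _ : Fin r => range B) ×ˢ
        (univ : Finset (Fin (2 * r) → Fin r))).image (fun z => z.1 ∘ z.2) := by
    intro f hf
    rw [mem_filter, Fintype.mem_piFinset] at hf
    obtain ⟨g, hg, j, rfl⟩ := exists_factor_of_even_fibers hB f hf.1 hf.2
    exact mem_image.2 ⟨(g, j), mem_product.2 ⟨hg, mem_univ _⟩, rfl⟩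
  refine (card_le_card h).trans (card_image_le.trans (le_of_eq ?_))
  rw [card_product, Fintype.card_piFinset]
  simp [mul_comm]

theorem sum_incSum_pow_le {S : Finset ℕ} {B : ℕ} (r : ℕ) (hB : 0 < B)
    (hS : ∀ p ∈ S, p.Prime ∧ p ≠ 2 ∧ B ≤ p) :
    ∑ u ∈ range (∏ p ∈ S, p), incSum S B u ^ (2 * r) ≤
      r ^ (2 * r) * B ^ r * (∏ p ∈ S, p : ℕ) + B ^ (2 * r) * ∏ p ∈ S, (400 * r * √p) := by
  classical
  set d := ∏ p ∈ S, p
  set E := Fintype.piFinset fun _ : Fin (2 * r) => range B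
  have e : ∀ u : ℤ, incSum S B u ^ (2 * r) = ∑ f ∈ E, ∏ i, chi S (u + f i) := by
    intro u
    rw [← prod_univ_sum (fun _ : Fin (2 * r) => range B) (fun _ t => chi S (u + t)), prod_const,
      card_univ, Fintype.card_fin, incSum]
  simp_rw [e]
  rw [sum_comm, ← sum_filter_add_sum_filter_not E (fun f => ∀ c, Even #{i | f i = c})]
  refine add_le_add ?_ ?_
  · have : ∀ f ∈ E.filter (fun f => ∀ c, Even #{i | f i = c}),
        ∑ u ∈ range d, ∏ i, chi S ((u : ℕ) + (f i : ℤ)) ≤ d := by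
      intro f _
      refine (sum_le_card_nsmul _ _ 1 fun u _ => ?_).trans (by simp)
      refine (le_abs_self _).trans ?_
      rw [abs_prod]
      exact prod_le_one (fun _ _ => abs_nonneg _) fun i _ => abs_chi_le _ _
    refine (sum_le_card_nsmul _ _ _ this).trans ?_
    rw [nsmul_eq_mul]
    gcongr
    exact_mod_cast card_even_fibers_le hB
  · have : ∀ f ∈ E.filter (fun f => ¬ ∀ c, Even #{i | f i = c}),
        ∑ u ∈ range d, ∏ i, chi S ((u : ℕ) + (f i : ℤ)) ≤ ∏ p ∈ S, (400 * r * √p) := by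
      intro f hf
      rw [mem_filter, Fintype.mem_piFinset] at hf
      obtain ⟨hfB, hfc⟩ := hf
      push Not at hfc
      obtain ⟨c, hc⟩ := hfc
      rw [Nat.not_even_iff_odd] at hc
      have hcB : c < B := by
        obtain ⟨i, hi⟩ := card_pos.1 hc.pos
        rw [← (mem_filter.1 hi).2]
        exact mem_range.1 (hfB i)
      have e2 : ∑ u ∈ range d, ∏ i, chi S ((u : ℕ) + (f i : ℤ)) =
          ∏ p ∈ S, ∑ x ∈ range p, ∏ i, chi {p} ((x : ℕ) + (f i : ℤ)) := by
        rw [← sum_prod_range_of_primes S (fun p hp => (hS p hp).1)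
          (fun p x => ∏ i, chi {p} (x + (f i : ℤ)))]
        · refine sum_congr rfl fun u _ => ?_
          rw [prod_comm]
          exact prod_congr rfl fun i _ => chi_eq_prod _ _
        · intro p _ x x' h
          exact prod_congr rfl fun i _ => chi_congr {p} (by simpa using h.add_right _)
      rw [e2]
      refine (le_abs_self _).trans ?_
      rw [abs_prod]
      refine prod_le_prod (fun _ _ => abs_nonneg _) fun p hp => ?_
      have h3 := abs_sum_prod_chi_le (hS p hp).1 (hS p hp).2.1 univ (fun i => (f i : ℤ)) (c := c) (by
        convert hc using 3 with i
        rw [Int.natCast_modEq_iff]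
        exact ⟨fun h => h.eq_of_lt_of_lt ((mem_range.1 (hfB i)).trans_le (hS p hp).2.2)
          (hcB.trans_le (hS p hp).2.2), fun h => by rw [h]⟩)
      refine h3.trans (le_of_eq ?_)
      rw [card_univ, Fintype.card_fin]
      push_cast
      ring
    refine (sum_le_card_nsmul _ _ _ this).trans ?_
    rw [nsmul_eq_mul]
    refine mul_le_mul_of_nonneg_right ?_ (prod_nonneg fun p _ => by positivity)
    have : #(E.filter (fun f => ¬ ∀ c, Even #{i | f i = c})) ≤ B ^ (2 * r) :=
      (card_filter_le _ _).trans (by simp [E, Fintype.card_piFinset])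
    exact_mod_cast this

theorem card_bigSet_mul_pow_le {S : Finset ℕ} {B : ℕ} (r : ℕ) (hB : 0 < B)
    (hS : ∀ p ∈ S, p.Prime ∧ p ≠ 2 ∧ B ≤ p) {θ : ℝ} (hθ : 0 ≤ θ) :
    #(bigSet S B θ) * θ ^ (2 * r) ≤
      r ^ (2 * r) * B ^ r * (∏ p ∈ S, p : ℕ) + B ^ (2 * r) * ∏ p ∈ S, (400 * r * √p) := by
  refine le_trans ?_ (sum_incSum_pow_le r hB hS)
  rw [← nsmul_eq_mul]
  refine (card_nsmul_le_sum _ _ _ fun u hu => ?_).trans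
    (sum_le_sum_of_subset_of_nonneg (filter_subset _ _) fun u _ _ => ?_)
  · rw [← (even_two_mul r).pow_abs (incSum S B u)]
    exact pow_le_pow_left₀ hθ (mem_filter.1 hu).2 _
  · exact (even_two_mul r).pow_nonneg _

end Moments

section BadSet

theorem prod_sqrt_natCast (S : Finset ℕ) : ∏ p ∈ S, √(p : ℝ) = √((∏ p ∈ S, p : ℕ) : ℝ) := by
  rw [Nat.cast_prod, Real.sqrt_prod _ fun _ _ => Nat.cast_nonneg _]

theorem card_mul_log_le {S : Finset ℕ} {V C : ℕ} (hV : 0 < V) (hS : ∀ p ∈ S, V ^ C ≤ p) :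
    (#S : ℝ) * (C * Real.log V) ≤ Real.log (∏ p ∈ S, p : ℕ) := by
  rw [← Real.log_pow, ← Real.log_pow]
  refine Real.log_le_log (by positivity) ?_
  have := pow_card_le_prod S (fun p => p) (V ^ C) hS
  exact_mod_cast this

theorem card_bigSet_le {S : Finset ℕ} {V : ℕ} {X : ℝ} (hV : 400 ≤ V) (hX1 : 1 ≤ X) (hX : X ≤ V)
    (hS : ∀ p ∈ S, p.Prime ∧ V ^ 40000 ≤ p) (hSn : S.Nonempty) (hd : ∏ p ∈ S, p ≤ 2 ^ V) :
    (#(bigSet S (V ^ 400) ((V ^ 400 : ℕ) / (8 * X))) : ℝ) ≤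
      Real.exp (0.54 * Real.log (∏ p ∈ S, p : ℕ)) := by
  set B := V ^ 400 with hB
  set d := ∏ p ∈ S, p with hdd
  set r := Nat.clog B d with hr
  set v := Real.log V with hv
  set D := Real.log d with hD
  have hV0 : 0 < V := by omega
  have hVR : (400 : ℝ) ≤ V := by exact_mod_cast hV
  have hB1 : 1 < B := Nat.one_lt_pow (by norm_num) (by omega)
  have hv1 : 1 ≤ v := by
    rw [hv, Real.le_log_iff_exp_le (by positivity)]
    have := Real.exp_one_lt_d9
    linarith
  have hcard : (1 : ℝ) ≤ #S := by exact_mod_cast hSn.card_pos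
  have h3 : (#S : ℝ) * (40000 * v) ≤ D := by
    have := card_mul_log_le (C := 40000) hV0 fun p hp => (hS p hp).2
    exact_mod_cast this
  have hD0 : 40000 * v ≤ D := by nlinarith
  have hd1 : 1 < d := by
    by_contra h
    have : d = 0 ∨ d = 1 := by omega
    have : D = 0 := by rcases this with h | h <;> simp [hD, h]
    linarith
  have hdR : (0 : ℝ) < d := by exact_mod_cast (by omega : 0 < d)
  have hdr : d ≤ B ^ r := Nat.le_pow_clog hB1 d
  have h1 : D ≤ r * (400 * v) := by
    have := Real.log_le_log hdR (y := ((B ^ r : ℕ) : ℝ)) (by exact_mod_cast hdr)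
    rw [hB] at this
    push_cast at this
    rwa [Real.log_pow, Real.log_pow] at this
  have h2 : ((r : ℝ) - 1) * (400 * v) ≤ D := by
    have h := Nat.pow_pred_clog_lt_self hB1 hd1
    rcases Nat.eq_zero_or_pos r with h0 | h0
    · rw [h0]; push_cast; nlinarith
    have := Real.log_le_log (x := ((B ^ (r - 1) : ℕ) : ℝ)) (y := d) (by positivity)
      (by exact_mod_cast h.le)
    rw [hB] at this
    push_cast at this
    rw [Real.log_pow, Real.log_pow, Nat.cast_sub h0] at this
    simpa using this
  have h4 : 396 * (r * v) ≤ D := by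
    have : (100 : ℝ) ≤ r := by
      by_contra h
      nlinarith
    nlinarith
  have h5 : D ≤ V := by
    have := Real.log_le_log hdR (y := ((2 ^ V : ℕ) : ℝ)) (by exact_mod_cast hd)
    push_cast at this
    rw [Real.log_pow] at this
    have := Real.log_two_lt_d9
    nlinarith
  have hrV : (r : ℝ) ≤ V := by
    have : (0 : ℝ) ≤ r := Nat.cast_nonneg _
    nlinarith
  set θ : ℝ := (B : ℕ) / (8 * X) with hθ
  have hBR : (0 : ℝ) < B := by exact_mod_cast (by omega : 0 < B)
  have hθ0 : 0 < θ := by positivity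
  have hmain := card_bigSet_mul_pow_le (S := S) (B := B) r (by omega) (fun p hp => ⟨(hS p hp).1, by
    have : V ≤ V ^ 40000 := Nat.le_self_pow (by norm_num) V
    have := (hS p hp).2
    omega, (Nat.pow_le_pow_right hV0 (by norm_num)).trans (hS p hp).2⟩) hθ0.le
  have hBθ : (B : ℝ) ^ (2 * r) = θ ^ (2 * r) * (8 * X) ^ (2 * r) := by
    rw [← mul_pow, hθ, div_mul_cancel₀ _ (by positivity)]
  have hVexp : ∀ n : ℕ, (V : ℝ) ^ n = Real.exp (n * v) := by
    intro n
    rw [Real.exp_nat_mul, hv, Real.exp_log (by positivity)]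
  have hQ : (8 * X) ^ (2 * r) ≤ Real.exp (4 * (r * v)) := by
    calc (8 * X) ^ (2 * r) ≤ ((V : ℝ) ^ 2) ^ (2 * r) := by
          gcongr
          nlinarith
      _ = Real.exp (4 * (r * v)) := by
          rw [← pow_mul, hVexp]; push_cast; ring_nf
  have hR : (r : ℝ) ^ (2 * r) ≤ Real.exp (2 * (r * v)) := by
    calc (r : ℝ) ^ (2 * r) ≤ (V : ℝ) ^ (2 * r) := by gcongr
      _ = Real.exp (2 * (r * v)) := by rw [hVexp]; push_cast; ring_nf
  have hsq : √(d : ℝ) = Real.exp (D / 2) := by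
    rw [Real.exp_half, hD, Real.exp_log hdR]
  have hP : ∏ p ∈ S, (400 * r * √(p : ℝ)) ≤ Real.exp (2 * (#S * v) + D / 2) := by
    rw [prod_mul_distrib, prod_const, prod_sqrt_natCast, Real.exp_add, hsq]
    gcongr
    calc (400 * (r : ℝ)) ^ #S ≤ ((V : ℝ) ^ 2) ^ #S := by
          gcongr
          nlinarith
      _ = Real.exp (2 * (#S * v)) := by
          rw [← pow_mul, hVexp]; push_cast; ring_nf
  have t1 : (r : ℝ) ^ (2 * r) * B ^ r * d ≤ θ ^ (2 * r) * Real.exp (0.52 * D) := by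
    calc (r : ℝ) ^ (2 * r) * B ^ r * d ≤ (r : ℝ) ^ (2 * r) * B ^ r * B ^ r := by
          gcongr; exact_mod_cast hdr
      _ = θ ^ (2 * r) * ((8 * X) ^ (2 * r) * (r : ℝ) ^ (2 * r)) := by
          rw [mul_assoc, ← pow_add, ← two_mul, hBθ]; ring
      _ ≤ θ ^ (2 * r) * (Real.exp (4 * (r * v)) * Real.exp (2 * (r * v))) := by gcongr
      _ ≤ _ := by
          rw [← Real.exp_add]
          gcongr
          linarith
  have t2 : (B : ℝ) ^ (2 * r) * ∏ p ∈ S, (400 * r * √(p : ℝ)) ≤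
      θ ^ (2 * r) * Real.exp (0.52 * D) := by
    calc (B : ℝ) ^ (2 * r) * ∏ p ∈ S, (400 * r * √(p : ℝ))
        ≤ θ ^ (2 * r) * Real.exp (4 * (r * v)) * Real.exp (2 * (#S * v) + D / 2) := by
          rw [hBθ]; gcongr
      _ ≤ _ := by
          rw [mul_assoc, ← Real.exp_add]
          gcongr
          linarith
  have hfin : (#(bigSet S B θ) : ℝ) * θ ^ (2 * r) ≤ (2 * Real.exp (0.52 * D)) * θ ^ (2 * r) := by
    refine hmain.trans ((add_le_add t1 t2).trans (le_of_eq (by ring)))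
  refine (le_of_mul_le_mul_right hfin (by positivity)).trans ?_
  calc 2 * Real.exp (0.52 * D) ≤ Real.exp (0.02 * D) * Real.exp (0.52 * D) := by
        gcongr
        have := Real.add_one_le_exp (0.02 * D)
        linarith
    _ = Real.exp (0.54 * D) := by rw [← Real.exp_add]; ring_nf

end BadSet

section Shifting

theorem abs_incSum_add_sub_le (S : Finset ℕ) (H : ℕ) (u : ℤ) (s : ℕ) :
    |incSum S H (u + s) - incSum S H u| ≤ 2 * s := by
  induction s with
  | zero => simp
  | succ s ih =>
    have e : incSum S H (u + (s + 1 : ℕ)) - incSum S H (u + s) =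
        chi S (u + s + H) - chi S (u + s) := by
      have h1 := sum_range_succ (fun t : ℕ => chi S (u + s + t)) H
      have h2 := sum_range_succ' (fun t : ℕ => chi S (u + s + t)) H
      have h3 : incSum S H (u + (s + 1 : ℕ)) = ∑ t ∈ range H, chi S (u + s + ((t + 1 : ℕ) : ℤ)) :=
        sum_congr rfl fun t _ => by congr 1; push_cast; ring
      rw [h3, incSum]
      simp only [Nat.cast_zero, add_zero] at h2
      linarith
    have h4 := abs_chi_le S (u + s + H)
    have h5 := abs_chi_le S (u + s)
    rw [abs_le] at *
    push_cast at *
    constructor <;> linarith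

theorem abs_incSum_le (S : Finset ℕ) (H : ℕ) (u : ℤ) : |incSum S H u| ≤ H := by
  refine (abs_sum_le_sum_abs _ _).trans ((sum_le_card_nsmul _ _ 1 fun t _ => abs_chi_le _ _).trans
    (by simp))

open Classical in
theorem card_filter_incSum_ge {S : Finset ℕ} {H B α : ℕ} {β u : ℤ} {η : ℝ} (hB : 0 < B)
    (hη : 0 < η) (hβ : α * β ≡ 1 [ZMOD (∏ p ∈ S, p : ℕ)]) (hu : η * H ≤ |incSum S H u|)
    (hH : 4 * α * B ≤ η * H) :
    η * H / 4 ≤ #{t ∈ range H | η * B / 4 ≤ |incSum S B (β * (u + (t : ℕ)))|} := by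
  have hBR : (0 : ℝ) < B := by exact_mod_cast hB
  have h1 : |∑ b ∈ range B, incSum S H (u + (α * b : ℕ)) - B * incSum S H u| ≤
      2 * α * B * B := by
    have : ∑ b ∈ range B, incSum S H (u + (α * b : ℕ)) - B * incSum S H u =
        ∑ b ∈ range B, (incSum S H (u + (α * b : ℕ)) - incSum S H u) := by
      rw [sum_sub_distrib]; simp
    rw [this]
    have hcard : #(range B) • (2 * α * B : ℝ) = 2 * α * B * B := by
      rw [card_range, nsmul_eq_mul]; ring
    rw [← hcard]
    refine (abs_sum_le_sum_abs _ _).trans (sum_le_card_nsmul _ _ _ fun b hb => ?_)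
    refine (abs_incSum_add_sub_le S H u (α * b)).trans ?_
    have : (b : ℝ) ≤ B := by exact_mod_cast (mem_range.1 hb).le
    push_cast
    rw [mul_assoc]
    gcongr
  have h2 : ∑ b ∈ range B, incSum S H (u + (α * b : ℕ)) =
      ∑ t ∈ range H, chi S α * incSum S B (β * (u + (t : ℕ))) := by
    simp only [incSum]
    rw [sum_comm]
    refine sum_congr rfl fun t _ => ?_
    rw [mul_sum]
    refine sum_congr rfl fun b _ => ?_
    rw [← chi_mul]
    refine chi_congr S ?_
    have : (α : ℤ) * (β * (u + t) + b) = (α * β) * (u + t) + α * b := by ring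
    rw [this]
    have h3 := (hβ.mul_right (u + t)).add_right (α * b : ℤ)
    refine Int.ModEq.trans ?_ h3.symm
    rw [show u + ((α * b : ℕ) : ℤ) + t = 1 * (u + t) + α * b by push_cast; ring]
  have h3 : |∑ b ∈ range B, incSum S H (u + (α * b : ℕ))| ≤
      ∑ t ∈ range H, |incSum S B (β * (u + (t : ℕ)))| := by
    rw [h2]
    refine (abs_sum_le_sum_abs _ _).trans (sum_le_sum fun t _ => ?_)
    rw [abs_mul]
    exact mul_le_of_le_one_left (abs_nonneg _) (abs_chi_le _ _)
  have h4 : B * |incSum S H u| - 2 * α * B * B ≤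
      |∑ b ∈ range B, incSum S H (u + (α * b : ℕ))| := by
    have := abs_sub_abs_le_abs_sub ((B : ℝ) * incSum S H u)
      (∑ b ∈ range B, incSum S H (u + (α * b : ℕ)))
    rw [abs_sub_comm, abs_mul, Nat.abs_cast] at this
    linarith
  have h5 : ∑ t ∈ range H, |incSum S B (β * (u + (t : ℕ)))| ≤
      ∑ t ∈ range H, (η * B / 4 + if η * B / 4 ≤ |incSum S B (β * (u + (t : ℕ)))| then (B : ℝ)
        else 0) := by
    refine sum_le_sum fun t _ => ?_
    split_ifs with h
    · have := abs_incSum_le S B (β * (u + (t : ℕ)))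
      have : 0 ≤ η * B / 4 := by positivity
      linarith
    · linarith
  rw [sum_add_distrib, ← sum_filter, sum_const, sum_const, nsmul_eq_mul, nsmul_eq_mul,
    card_range] at h5
  have h6 : B * (η * H / 4) ≤
      B * #{t ∈ range H | η * B / 4 ≤ |incSum S B (β * (u + (t : ℕ)))|} := by
    nlinarith
  exact le_of_mul_le_mul_left h6 hBR

theorem mem_bigSet {S : Finset ℕ} {B : ℕ} {θ : ℝ} (hd : 0 < ∏ p ∈ S, p) (v : ℤ) :
    (v % (∏ p ∈ S, p : ℕ)).toNat ∈ bigSet S B θ ↔ θ ≤ |incSum S B v| := by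
  have hd' : (0 : ℤ) < (∏ p ∈ S, p : ℕ) := by exact_mod_cast hd
  have h0 := Int.emod_nonneg v hd'.ne'
  rw [bigSet, mem_filter, Int.toNat_of_nonneg h0, incSum_congr S B (Int.mod_modEq v _), mem_range]
  have : (v % (∏ p ∈ S, p : ℕ)).toNat < ∏ p ∈ S, p := by
    have := Int.emod_lt_of_pos v hd'
    omega
  exact and_iff_right this

theorem card_bigSet_mul_le {S : Finset ℕ} {H B : ℕ} {η : ℝ} (hd : 0 < ∏ p ∈ S, p) (hB : 0 < B)
    (hη : 0 < η) (hH : 4 * B ≤ η * H) :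
    #(bigSet S H (η * H)) * (η / 4) ≤ #(bigSet S B (η * B / 4)) := by
  classical
  set d := ∏ p ∈ S, p
  have hBR : (0 : ℝ) < B := by exact_mod_cast hB
  have hHR : (0 : ℝ) < H := by
    by_contra h
    have : (H : ℝ) = 0 := le_antisymm (not_lt.1 h) (Nat.cast_nonneg H)
    rw [this] at hH; linarith
  let f : ℤ → ℝ := fun u => if η * B / 4 ≤ |incSum S B u| then 1 else 0
  have hf : ∀ x x', x ≡ x' [ZMOD d] → f x = f x' := fun x x' h => by
    simp only [f, incSum_congr S B h]
  have h1 : #(bigSet S H (η * H)) • (η * H / 4) ≤ ∑ u ∈ range d, ∑ t ∈ range H, f (u + (t : ℕ)) := by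
    refine (card_nsmul_le_sum (bigSet S H (η * H)) (fun u : ℕ => ∑ t ∈ range H, f (u + (t : ℕ))) _
      fun u hu => ?_).trans (sum_le_sum_of_subset_of_nonneg (filter_subset _ _) fun u _ _ =>
        sum_nonneg fun t _ => by simp only [f]; split_ifs <;> norm_num)
    have := card_filter_incSum_ge (α := 1) (β := 1) hB hη (by simp) (mem_filter.1 hu).2
      (by simpa using hH)
    simpa [f, sum_boole] using this
  have h2 : ∑ u ∈ range d, ∑ t ∈ range H, f (u + (t : ℕ)) = H * #(bigSet S B (η * B / 4)) := by
    rw [sum_comm]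
    have : ∀ t ∈ range H, ∑ u ∈ range d, f ((u : ℕ) + (t : ℕ)) = #(bigSet S B (η * B / 4)) := by
      intro t _
      rw [sum_range_add_left hd.ne' hf, bigSet]
      simp [f, sum_boole, d]
    rw [sum_congr rfl this]
    simp
  rw [h2, nsmul_eq_mul] at h1
  have h3 : (H : ℝ) * (#(bigSet S H (η * H)) * (η / 4)) ≤ H * #(bigSet S B (η * B / 4)) := by
    linarith
  exact le_of_mul_le_mul_left h3 hHR

end Shifting

section Collisions

theorem card_le_of_modEq {T : Finset ℕ} {H a : ℕ} (hT : T ⊆ range H)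
    (h : ∀ x ∈ T, ∀ y ∈ T, x ≡ y [MOD a]) : #T ≤ H / a + 1 := by
  rw [← card_range (H / a + 1)]
  refine card_le_card_of_injOn (fun x => x / a) (fun x hx => ?_) fun x hx y hy hxy => ?_
  · have := mem_range.1 (hT hx)
    exact mem_coe.2 (mem_range.2 (Nat.lt_succ_of_le (Nat.div_le_div_right this.le)))
  · have h1 : x % a = y % a := h x hx y hy
    have h2 := Nat.div_add_mod x a
    have h3 := Nat.div_add_mod y a
    simp only at hxy
    rw [← h2, ← h3, hxy, h1]

open Classical in
theorem card_collisions_le {d A k H Q α α' : ℕ} {u : ℤ} (hα : α ∈ Ioc A (A + k))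
    (hα' : α' ∈ Ioc A (A + k)) (hd : 2 * (A + k) * H ≤ d) (hQ : ∀ a, A < a * k → H / a ≤ Q)
    (hne : α ≠ α') :
    #{z ∈ range H ×ˢ range H | α' * (u + (z.1 : ℕ)) ≡ α * (u + (z.2 : ℕ)) [ZMOD d]} ≤ Q + 1 := by
  rw [mem_Ioc] at hα hα'
  set Z := {z ∈ range H ×ˢ range H | α' * (u + (z.1 : ℕ)) ≡ α * (u + (z.2 : ℕ)) [ZMOD d]}
  have key : ∀ z ∈ Z, ∀ w ∈ Z, (α' : ℤ) * (z.1 - w.1) = α * (z.2 - w.2) := by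
    intro z hz w hw
    simp only [Z, mem_filter, mem_product, mem_range] at hz hw
    have h1 := hz.2.sub hw.2
    have h2 : (α' : ℤ) * (z.1 - w.1) ≡ α * (z.2 - w.2) [ZMOD d] := by
      convert h1 using 1 <;> ring
    have b1 : |(α' : ℤ) * (z.1 - w.1)| < (A + k) * H := by
      rw [abs_mul, Nat.abs_cast]
      have : |(z.1 : ℤ) - w.1| < H := by rw [abs_lt]; omega
      have hα'' : (α' : ℤ) ≤ A + k := by omega
      have : 0 < (α' : ℤ) := by omega
      nlinarith [abs_nonneg ((z.1 : ℤ) - w.1)]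
    have b2 : |(α : ℤ) * (z.2 - w.2)| < (A + k) * H := by
      rw [abs_mul, Nat.abs_cast]
      have : |(z.2 : ℤ) - w.2| < H := by rw [abs_lt]; omega
      have hα'' : (α : ℤ) ≤ A + k := by omega
      have : 0 < (α : ℤ) := by omega
      nlinarith [abs_nonneg ((z.2 : ℤ) - w.2)]
    have hdZ : 2 * ((A : ℤ) + k) * H ≤ d := by exact_mod_cast hd
    have h3 := Int.eq_zero_of_abs_lt_dvd h2.dvd (by
      rw [abs_lt] at b1 b2 ⊢
      constructor <;> linarith)
    linarith
  have hα0 : (α : ℤ) ≠ 0 := by omega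
  have hinj : Set.InjOn Prod.fst (Z : Set (ℕ × ℕ)) := by
    intro z hz w hw hzw
    have := key z hz w hw
    rw [hzw, sub_self, mul_zero, eq_comm, mul_eq_zero, sub_eq_zero] at this
    exact Prod.ext hzw (by have := this.resolve_left hα0; exact_mod_cast this)
  rw [← card_image_of_injOn hinj]
  have hg0 : 0 < α.gcd α' := Nat.gcd_pos_of_pos_left _ (by omega)
  have hgk : α.gcd α' ≤ k := by
    have h1 : ((α.gcd α' : ℕ) : ℤ) ∣ (α : ℤ) - α' :=
      dvd_sub (by exact_mod_cast Nat.gcd_dvd_left α α') (by exact_mod_cast Nat.gcd_dvd_right α α')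
    have h2 := Int.le_of_dvd (abs_pos.2 (sub_ne_zero.2 (by exact_mod_cast hne))) ((dvd_abs _ _).2 h1)
    have h3 : |(α : ℤ) - α'| ≤ k := by rw [abs_le]; omega
    exact_mod_cast h2.trans h3
  have ha : α / α.gcd α' * α.gcd α' = α := Nat.div_mul_cancel (Nat.gcd_dvd_left _ _)
  have ha' : α' / α.gcd α' * α.gcd α' = α' := Nat.div_mul_cancel (Nat.gcd_dvd_right _ _)
  refine (card_le_of_modEq (H := H) (a := α / α.gcd α') ?_ ?_).trans
    (Nat.add_le_add_right (hQ _ ?_) 1)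
  · intro t ht
    obtain ⟨z, hz, rfl⟩ := mem_image.1 ht
    exact (mem_product.1 (mem_filter.1 hz).1).1
  · intro t ht t' ht'
    obtain ⟨z, hz, rfl⟩ := mem_image.1 ht
    obtain ⟨w, hw, rfl⟩ := mem_image.1 ht'
    have h1 := key w hw z hz
    have hcop : IsCoprime ((α / α.gcd α' : ℕ) : ℤ) ((α' / α.gcd α' : ℕ) : ℤ) :=
      Nat.isCoprime_iff_coprime.2 (Nat.coprime_div_gcd_div_gcd hg0)
    have h2 : ((α' / α.gcd α' : ℕ) : ℤ) * (w.1 - z.1) =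
        ((α / α.gcd α' : ℕ) : ℤ) * (w.2 - z.2) := by
      have hgZ : ((α.gcd α' : ℕ) : ℤ) ≠ 0 := by exact_mod_cast hg0.ne'
      apply mul_left_cancel₀ hgZ
      have e1 : ((α / α.gcd α' : ℕ) : ℤ) * (α.gcd α' : ℕ) = α := by exact_mod_cast ha
      have e2 : ((α' / α.gcd α' : ℕ) : ℤ) * (α.gcd α' : ℕ) = α' := by exact_mod_cast ha'
      calc _ = (((α' / α.gcd α' : ℕ) : ℤ) * (α.gcd α' : ℕ)) * (w.1 - z.1) := by ring
        _ = _ := by rw [e2, h1, ← e1]; ring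
    have h3 : ((α / α.gcd α' : ℕ) : ℤ) ∣ (w.1 : ℤ) - z.1 :=
      hcop.dvd_of_dvd_mul_left (Dvd.intro _ h2.symm)
    rw [Nat.modEq_iff_dvd]
    exact h3
  · calc A < α := hα.1
      _ = α / α.gcd α' * α.gcd α' := ha.symm
      _ ≤ _ := Nat.mul_le_mul_left _ hgk

open Classical in
theorem sq_sum_card_le {S : Finset ℕ} {B A k H Q : ℕ} {θ : ℝ} {𝒜 : Finset ℕ} {β : ℕ → ℤ} (u : ℤ)
    (h𝒜 : 𝒜 ⊆ Ioc A (A + k)) (hβ : ∀ α ∈ 𝒜, α * β α ≡ 1 [ZMOD (∏ p ∈ S, p : ℕ)])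
    (hd0 : 0 < ∏ p ∈ S, p)
    (hd : 2 * (A + k) * H ≤ ∏ p ∈ S, p) (hQ : ∀ a, A < a * k → H / a ≤ Q) :
    (∑ α ∈ 𝒜, #{t ∈ range H | θ ≤ |incSum S B (β α * (u + (t : ℕ)))|}) ^ 2 ≤
      #(bigSet S B θ) * (k * H + k ^ 2 * (Q + 1)) := by
  set d := ∏ p ∈ S, p
  let P : Finset (Σ _ : ℕ, ℕ) :=
    𝒜.sigma fun α => {t ∈ range H | θ ≤ |incSum S B (β α * (u + (t : ℕ)))|}
  let φ : (Σ _ : ℕ, ℕ) → ℕ := fun x => ((β x.1 * (u + (x.2 : ℕ))) % (d : ℕ)).toNat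
  have hφ : ∀ x ∈ P, φ x ∈ bigSet S B θ := by
    intro x hx
    simp only [P, mem_sigma, mem_filter] at hx
    exact (mem_bigSet hd0 _).2 hx.2.2
  have hP : ∑ α ∈ 𝒜, #{t ∈ range H | θ ≤ |incSum S B (β α * (u + (t : ℕ)))|} = #P :=
    (card_sigma _ _).symm
  have hd' : (0 : ℤ) < (d : ℕ) := by exact_mod_cast hd0
  have hφe : ∀ α α' t t', φ ⟨α, t⟩ = φ ⟨α', t'⟩ →
      β α * (u + (t : ℕ)) ≡ β α' * (u + (t' : ℕ)) [ZMOD d] := by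
    intro α α' t t' h
    simp only [φ] at h
    have h1 := Int.emod_nonneg (β α * (u + (t : ℕ))) hd'.ne'
    have h2 := Int.emod_nonneg (β α' * (u + (t' : ℕ))) hd'.ne'
    rw [Int.ModEq]
    omega
  rw [hP, card_eq_sum_card_fiberwise hφ]
  refine sq_sum_le_card_mul_sum_sq.trans (Nat.mul_le_mul_left _ ?_)
  have hE : ∑ v ∈ bigSet S B θ, #{x ∈ P | φ x = v} ^ 2 ≤
      ∑ α ∈ 𝒜, ∑ α' ∈ 𝒜, #{z ∈ range H ×ˢ range H | φ ⟨α, z.1⟩ = φ ⟨α', z.2⟩} := by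
    have e1 : ∀ v ∈ bigSet S B θ, #{x ∈ P | φ x = v} ^ 2 =
        #{w ∈ {w ∈ P ×ˢ P | φ w.1 = φ w.2} | φ w.1 = v} := by
      intro v _
      rw [sq, ← card_product]
      congr 1
      ext w
      simp only [mem_filter, mem_product]
      constructor
      · rintro ⟨⟨h1, h2⟩, h3, h4⟩; exact ⟨⟨⟨h1, h3⟩, h2.trans h4.symm⟩, h2⟩
      · rintro ⟨⟨⟨h1, h3⟩, h2⟩, h4⟩; exact ⟨⟨h1, h4⟩, h3, h2 ▸ h4⟩
    rw [sum_congr rfl e1, ← card_eq_sum_card_fiberwise (f := fun w => φ w.1)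
      (fun w hw => hφ _ (mem_product.1 (mem_filter.1 hw).1).1)]
    have e2 : ∑ α ∈ 𝒜, ∑ α' ∈ 𝒜, #{z ∈ range H ×ˢ range H | φ ⟨α, z.1⟩ = φ ⟨α', z.2⟩} =
        #((𝒜 ×ˢ 𝒜).sigma fun a => {z ∈ range H ×ˢ range H | φ ⟨a.1, z.1⟩ = φ ⟨a.2, z.2⟩}) := by
      rw [card_sigma, sum_product]
    rw [e2]
    refine card_le_card_of_injOn (fun w => ⟨(w.1.1, w.2.1), (w.1.2, w.2.2)⟩) ?_ ?_
    · intro w hw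
      simp only [P, mem_coe, mem_filter, mem_product, mem_sigma] at hw ⊢
      exact ⟨⟨hw.1.1.1, hw.1.2.1⟩, ⟨hw.1.1.2.1, hw.1.2.2.1⟩, hw.2⟩
    · rintro ⟨⟨a, b⟩, ⟨c, e⟩⟩ _ ⟨⟨a', b'⟩, ⟨c', e'⟩⟩ _ h
      simp only [Sigma.mk.injEq, Prod.mk.injEq, heq_eq_eq] at h
      obtain ⟨⟨rfl, rfl⟩, rfl, rfl⟩ := h
      rfl
  refine hE.trans ?_
  have h𝒜k : #𝒜 ≤ k := (card_le_card h𝒜).trans (by simp)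
  have hrow : ∀ α ∈ 𝒜, ∑ α' ∈ 𝒜, #{z ∈ range H ×ˢ range H | φ ⟨α, z.1⟩ = φ ⟨α', z.2⟩} ≤
      H + k * (Q + 1) := by
    intro α hα
    rw [← add_sum_erase _ _ hα]
    refine add_le_add ?_ ?_
    · refine le_of_le_of_eq ?_ (card_range H)
      refine card_le_card_of_injOn Prod.fst ?_ ?_
      · intro z hz
        exact (mem_product.1 (mem_filter.1 hz).1).1
      · have hdiag : ∀ z ∈ ({z ∈ range H ×ˢ range H | φ ⟨α, z.1⟩ = φ ⟨α, z.2⟩} : Finset (ℕ × ℕ)),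
            z.1 = z.2 := by
          intro z hz
          obtain ⟨hz1, hz2⟩ := mem_filter.1 hz
          rw [mem_product, mem_range, mem_range] at hz1
          have h1 := (hφe _ _ _ _ hz2).mul_left (α : ℤ)
          rw [← mul_assoc, ← mul_assoc] at h1
          have h2 : u + (z.1 : ℤ) ≡ u + z.2 [ZMOD d] := by
            have m1 := (hβ α hα).mul_right (u + (z.1 : ℤ))
            have m2 := (hβ α hα).mul_right (u + (z.2 : ℤ))
            rw [one_mul] at m1 m2
            exact m1.symm.trans (h1.trans m2)
          have h3 := Int.natCast_modEq_iff.1 (h2.add_left_cancel' u)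
          have hαpos := mem_Ioc.1 (h𝒜 hα)
          have hHd : H ≤ d := le_trans (Nat.le_mul_of_pos_left H (by omega)) hd
          exact h3.eq_of_lt_of_lt (by omega) (by omega)
        intro z hz w hw h
        exact Prod.ext h (by rw [← hdiag z hz, ← hdiag w hw]; exact h)
    · refine (sum_le_card_nsmul _ _ (Q + 1) fun α' hα' => ?_).trans ?_
      · rw [mem_erase] at hα'
        refine le_trans (card_le_card ?_) (card_collisions_le (u := u) (h𝒜 hα) (h𝒜 hα'.2) hd hQ
          (Ne.symm hα'.1))
        intro z hz
        rw [mem_filter] at hz ⊢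
        refine ⟨hz.1, ?_⟩
        have h1 := ((hφe _ _ _ _ hz.2).mul_left (α : ℤ)).mul_left (α' : ℤ)
        have m1 := ((hβ α hα).mul_right (u + (z.1 : ℤ))).mul_left (α' : ℤ)
        have m2 := ((hβ α' hα'.2).mul_right (u + (z.2 : ℤ))).mul_left (α : ℤ)
        rw [one_mul] at m1 m2
        refine m1.symm.trans (Int.ModEq.trans ?_ (h1.trans (Int.ModEq.trans ?_ m2)))
        · rw [mul_assoc]
        · rw [show (α' : ℤ) * (α * (β α' * (u + z.2))) = α * (α' * β α' * (u + z.2)) by ring]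
      · rw [smul_eq_mul]
        exact Nat.mul_le_mul_right _ ((card_le_card (erase_subset _ _)).trans h𝒜k)
  refine (sum_le_card_nsmul _ _ _ hrow).trans ?_
  rw [smul_eq_mul]
  refine (Nat.mul_le_mul_right _ h𝒜k).trans (le_of_eq (by ring))

end Collisions

section UniformBound

theorem card_Ioc_filter_dvd_le (A k p : ℕ) : #{x ∈ Ioc A (A + k) | p ∣ x} ≤ k / p + 1 := by
  have hinj : Set.InjOn (fun x => x - (A + 1)) ({x ∈ Ioc A (A + k) | p ∣ x} : Finset ℕ) := by
    intro x hx y hy hxy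
    have h1 := mem_Ioc.1 (mem_filter.1 (mem_coe.1 hx)).1
    have h2 := mem_Ioc.1 (mem_filter.1 (mem_coe.1 hy)).1
    simp only at hxy
    omega
  rw [← card_image_of_injOn hinj]
  refine card_le_of_modEq ?_ ?_
  · intro t ht
    obtain ⟨x, hx, rfl⟩ := mem_image.1 ht
    have h1 := mem_Ioc.1 (mem_filter.1 hx).1
    exact mem_range.2 (by omega)
  · intro t ht t' ht'
    obtain ⟨x, hx, rfl⟩ := mem_image.1 ht
    obtain ⟨y, hy, rfl⟩ := mem_image.1 ht'
    rw [mem_filter, mem_Ioc] at hx hy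
    refine Nat.ModEq.add_right_cancel' (A + 1) ?_
    rw [Nat.sub_add_cancel hx.1.1, Nat.sub_add_cancel hy.1.1]
    exact ((Nat.modEq_zero_iff_dvd).2 hx.2).trans ((Nat.modEq_zero_iff_dvd).2 hy.2).symm

theorem half_le_card_coprime {S : Finset ℕ} {A k V : ℕ} (hV : 0 < V) (hS : ∀ p ∈ S, p.Prime ∧ 4 * V ≤ p)
    (hSV : #S ≤ V) (hk : 4 * V ≤ k) :
    (k : ℝ) / 2 ≤ #{α ∈ Ioc A (A + k) | α.Coprime (∏ p ∈ S, p)} := by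
  have h1 := card_filter_add_card_filter_not (s := Ioc A (A + k)) (fun α => α.Coprime (∏ p ∈ S, p))
  rw [Nat.card_Ioc, Nat.add_sub_cancel_left] at h1
  have h2 : #{α ∈ Ioc A (A + k) | ¬ α.Coprime (∏ p ∈ S, p)} ≤
      ∑ p ∈ S, #{α ∈ Ioc A (A + k) | p ∣ α} := by
    refine le_trans (card_le_card fun α hα => ?_) card_biUnion_le
    rw [mem_filter, Nat.coprime_prod_right_iff] at hα
    obtain ⟨h, hcop⟩ := hα
    push Not at hcop
    obtain ⟨p, hp, hpα⟩ := hcop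
    have hpα' : ¬ Nat.Coprime p α := fun h => hpα (Nat.coprime_comm.1 h)
    rw [(hS p hp).1.coprime_iff_not_dvd, not_not] at hpα'
    exact mem_biUnion.2 ⟨p, hp, mem_filter.2 ⟨h, hpα'⟩⟩
  have hVR : (0 : ℝ) < V := by exact_mod_cast hV
  have hkR : 4 * (V : ℝ) ≤ k := by exact_mod_cast hk
  have hSR : (#S : ℝ) ≤ V := by exact_mod_cast hSV
  have h3 : ∀ p ∈ S, (#{α ∈ Ioc A (A + k) | p ∣ α} : ℝ) ≤ k / (2 * V) := by
    intro p hp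
    have hpR : 4 * (V : ℝ) ≤ p := by exact_mod_cast (hS p hp).2
    have h4 : (#{α ∈ Ioc A (A + k) | p ∣ α} : ℝ) ≤ (k / p : ℕ) + 1 := by
      exact_mod_cast card_Ioc_filter_dvd_le A k p
    have h5 : ((k / p : ℕ) : ℝ) ≤ k / p := Nat.cast_div_le
    have h6 : (k : ℝ) / p ≤ k / (4 * V) := by gcongr
    have h7 : 1 ≤ (k : ℝ) / (4 * V) := by rw [le_div_iff₀ (by positivity)]; linarith
    have h8 : (k : ℝ) / (2 * V) = k / (4 * V) + k / (4 * V) := by field_simp; ring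
    linarith
  have h4 : (#{α ∈ Ioc A (A + k) | ¬ α.Coprime (∏ p ∈ S, p)} : ℝ) ≤ k / 2 := by
    calc (#{α ∈ Ioc A (A + k) | ¬ α.Coprime (∏ p ∈ S, p)} : ℝ)
        ≤ ∑ p ∈ S, (#{α ∈ Ioc A (A + k) | p ∣ α} : ℝ) := by exact_mod_cast h2
      _ ≤ #S • ((k : ℝ) / (2 * V)) := sum_le_card_nsmul _ _ _ h3
      _ ≤ V * ((k : ℝ) / (2 * V)) := by rw [nsmul_eq_mul]; gcongr
      _ = k / 2 := by field_simp
  have h5 : (#{α ∈ Ioc A (A + k) | α.Coprime (∏ p ∈ S, p)} : ℝ) +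
      #{α ∈ Ioc A (A + k) | ¬ α.Coprime (∏ p ∈ S, p)} = k := by exact_mod_cast h1
  linarith

theorem exists_root (n d : ℕ) (hn : n ≠ 0) : ∃ y : ℕ, y ^ n ≤ d ∧ d < (y + 1) ^ n := by
  refine ⟨Nat.findGreatest (fun y => y ^ n ≤ d) d, ?_, ?_⟩
  · exact Nat.findGreatest_spec (P := fun y => y ^ n ≤ d) (Nat.zero_le d) (by simp [hn])
  · by_contra h
    rw [not_lt] at h
    have h1 : Nat.findGreatest (fun y => y ^ n ≤ d) d + 1 ≤ d := (Nat.le_self_pow hn _).trans h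
    have := Nat.le_findGreatest (P := fun y => y ^ n ≤ d) h1 h
    omega

theorem four_mul_mul_le {X V : ℝ} {B y α : ℕ} (hy : 0 < y) (hX0 : 0 < X) (hX : X ≤ V)
    (hα : α ≤ y ^ 15 + y ^ 7) (hB : 16 * V * B ≤ y) :
    4 * (α : ℝ) * B ≤ 1 / (2 * X) * (y ^ 16 : ℕ) := by
  have hαy : (α : ℝ) ≤ 2 * y ^ 15 := by
    have h3 : y ^ 7 ≤ y ^ 15 := Nat.pow_le_pow_right hy (by norm_num)
    have h4 : α ≤ 2 * y ^ 15 := hα.trans (by linarith)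
    exact_mod_cast h4
  rw [div_mul_eq_mul_div, one_mul, le_div_iff₀ (by positivity)]
  push_cast
  calc 4 * (α : ℝ) * B * (2 * X) ≤ 4 * (2 * (y : ℝ) ^ 15) * B * (2 * V) := by gcongr
    _ = (y : ℝ) ^ 15 * (16 * V * B) := by ring
    _ ≤ (y : ℝ) ^ 15 * y := by gcongr
    _ = (y : ℝ) ^ 16 := by ring

theorem two_mul_pow_add_pow_le {y : ℕ} (hy : 4 ≤ y) :
    2 * (y ^ 15 + y ^ 7) * y ^ 16 ≤ y ^ 40 := by
  have hy0 : 0 < y := by omega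
  have h3 : y ^ 7 ≤ y ^ 15 := Nat.pow_le_pow_right hy0 (by norm_num)
  calc 2 * (y ^ 15 + y ^ 7) * y ^ 16 ≤ 2 * (y ^ 15 + y ^ 15) * y ^ 16 := by gcongr
    _ = (4 * y ^ 15) * y ^ 16 := by ring
    _ ≤ (y * y ^ 15) * y ^ 16 := by gcongr
    _ = y ^ 32 := by ring
    _ ≤ y ^ 40 := Nat.pow_le_pow_right hy0 (by norm_num)

theorem log_le_of_lt_add_one_pow {d y : ℕ} (hd : 0 < d) (hy2 : d < (y + 1) ^ 40)
    (hy : (400 : ℝ) ^ 80 ≤ y) : Real.log d ≤ 40.5 * Real.log y := by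
  have hyR : (0 : ℝ) < y := lt_of_lt_of_le (pow_pos (by norm_num1) 80) hy
  have hy0 : 0 < y := by exact_mod_cast hyR
  have h2 : (d : ℝ) ≤ (2 * y) ^ 40 := by
    have h3 : d ≤ (2 * y) ^ 40 := by
      have : y + 1 ≤ 2 * y := by omega
      calc d ≤ (y + 1) ^ 40 := hy2.le
        _ ≤ (2 * y) ^ 40 := by gcongr
    exact_mod_cast h3
  have h3 := Real.log_le_log (by exact_mod_cast hd) h2
  rw [Real.log_pow, Real.log_mul two_ne_zero hyR.ne'] at h3
  have h5 := Real.log_le_log (pow_pos (by norm_num1) 80) hy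
  rw [Real.log_pow] at h5
  have h6 : Real.log 2 ≤ Real.log 400 := Real.log_le_log (by norm_num) (by norm_num)
  push_cast at h3 h5
  linarith

theorem exp_mul_log_le_pow {d y : ℝ} (hd : 1 ≤ d) (hy : 1 ≤ y) (h : Real.log d ≤ 40.5 * Real.log y) :
    Real.exp (0.54 * Real.log d) ≤ y ^ 22 := by
  have hly0 : 0 ≤ Real.log y := Real.log_nonneg hy
  have hld0 : 0 ≤ Real.log d := Real.log_nonneg hd
  calc Real.exp (0.54 * Real.log d) ≤ Real.exp ((22 : ℕ) * Real.log y) := by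
        refine Real.exp_le_exp.2 ?_
        push_cast
        linarith
    _ = y ^ 22 := by rw [Real.exp_nat_mul, Real.exp_log (by positivity)]

theorem le_of_sq_le {y X s b : ℝ} (hy : 1 ≤ y) (hX : 0 < X)
    (hs : y ^ 23 / (16 * X) ≤ s) (hb : b ≤ y ^ 22)
    (hsq : s ^ 2 ≤ b * (y ^ 7 * y ^ 16 + (y ^ 7) ^ 2 * (y ^ 8 + 1))) : y ≤ 768 * X ^ 2 := by
  have hy0 : 0 < y := by linarith
  have h3 : y ^ 7 * y ^ 16 + (y ^ 7) ^ 2 * (y ^ 8 + 1) ≤ 3 * y ^ 23 := by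
    have a1 : y ^ 22 ≤ y ^ 23 := pow_le_pow_right₀ hy (by norm_num)
    have a2 : y ^ 14 ≤ y ^ 23 := pow_le_pow_right₀ hy (by norm_num)
    nlinarith
  have h4 : (y ^ 23 / (16 * X)) ^ 2 ≤ y ^ 22 * (3 * y ^ 23) := by
    calc (y ^ 23 / (16 * X)) ^ 2 ≤ s ^ 2 := by gcongr
      _ ≤ _ := hsq
      _ ≤ y ^ 22 * (3 * y ^ 23) := by gcongr
  rw [div_pow, div_le_iff₀ (by positivity)] at h4
  have h5 : y ^ 45 * y ≤ y ^ 45 * (768 * X ^ 2) := by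
    calc y ^ 45 * y = (y ^ 23) ^ 2 := by ring
      _ ≤ _ := h4
      _ = _ := by ring
  exact le_of_mul_le_mul_left h5 (by positivity)

theorem sq_lt_pow_four {X V : ℝ} (hX0 : 0 < X) (hX : X ≤ V) (hV : 400 ≤ V) :
    768 * X ^ 2 < V ^ 4 := by
  have h8 : X ^ 2 ≤ V ^ 2 := by gcongr
  have : V ^ 4 = V ^ 2 * V ^ 2 := by ring
  rw [this]
  have : 768 < V ^ 2 := by nlinarith
  nlinarith

theorem exists_uniform_bound {S : Finset ℕ} {V : ℕ} {X : ℝ} (hV : 400 ≤ V) (hX1 : 1 ≤ X)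
    (hX : X ≤ V) (hS : ∀ p ∈ S, p.Prime ∧ V ^ 40000 ≤ p) (hSn : S.Nonempty)
    (hd : ∏ p ∈ S, p ≤ 2 ^ V) (hSV : #S ≤ V) :
    ∃ y : ℕ, 0 < y ∧ y ^ 40 ≤ ∏ p ∈ S, p ∧
      ∀ u, |incSum S (y ^ 16) u| < 1 / (2 * X) * (y ^ 16 : ℕ) := by
  classical
  set d := ∏ p ∈ S, p with hdd
  obtain ⟨y, hy1, hy2⟩ := exists_root 40 d (by norm_num)
  have hV0 : 0 < V := by omega
  have hV16 : 16 ≤ V := le_trans (by norm_num) hV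
  have hVR : (400 : ℝ) ≤ V := by exact_mod_cast hV
  have hd0 : 0 < d := prod_pos fun p hp => (hS p hp).1.pos
  have hyV : V ^ 1000 ≤ y := by
    obtain ⟨p, hp⟩ := hSn
    have h1 : p ≤ d := Nat.le_of_dvd hd0 (dvd_prod_of_mem (fun p => p) hp)
    have h2 : (V ^ 1000) ^ 40 < (y + 1) ^ 40 := by
      have h3 : (V ^ 1000) ^ 40 = V ^ 40000 := by rw [← pow_mul]
      rw [h3]
      exact ((hS p hp).2.trans h1).trans_lt hy2
    have := lt_of_pow_lt_pow_left₀ 40 (by omega) h2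
    omega
  have hVpow : ∀ n ≤ 1000, V ^ n ≤ y := fun n hn => (Nat.pow_le_pow_right hV0 hn).trans hyV
  have hVy : V ≤ y := by simpa using hVpow 1 (by norm_num)
  have hy0 : 0 < y := hV0.trans_le hVy
  have hy4 : 4 ≤ y := le_trans (by omega) hVy
  refine ⟨y, hy0, hy1, ?_⟩
  by_contra! hcon
  obtain ⟨u, hu⟩ := hcon
  set B := V ^ 400 with hB
  set 𝒜 := {α ∈ Ioc (y ^ 15) (y ^ 15 + y ^ 7) | α.Coprime d} with h𝒜
  have hβ : ∀ α : ℕ, ∃ b : ℤ, α ∈ 𝒜 → α * b ≡ 1 [ZMOD d] := by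
    intro α
    by_cases hα : α ∈ 𝒜
    · have hc : IsCoprime (α : ℤ) (d : ℤ) := Nat.isCoprime_iff_coprime.2 (mem_filter.1 hα).2
      obtain ⟨a, b, hab⟩ := hc
      refine ⟨a, fun _ => ?_⟩
      rw [Int.modEq_iff_dvd]
      exact ⟨b, by linarith⟩
    · exact ⟨0, fun h => absurd h hα⟩
  choose β hβ using hβ
  have hyR : (1 : ℝ) ≤ y := by exact_mod_cast hy0
  have hX0 : 0 < X := lt_of_lt_of_le one_pos hX1
  have hB0 : 0 < B := by positivity
  have hVB : 16 * (V : ℝ) * (B : ℕ) ≤ y := by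
    have h1 : 16 * V * B ≤ y := by
      refine le_trans ?_ (hVpow 402 (by norm_num))
      calc 16 * V * B ≤ V * V * B := by gcongr
        _ = V ^ 402 := by rw [hB]; ring
    exact_mod_cast h1
  have h1 : ∀ α ∈ 𝒜, 1 / (2 * X) * (y ^ 16 : ℕ) / 4 ≤
      #{t ∈ range (y ^ 16) | 1 / (2 * X) * B / 4 ≤ |incSum S B (β α * (u + (t : ℕ)))|} := by
    intro α hα
    refine card_filter_incSum_ge hB0 (by positivity) (hβ α hα) hu ?_
    exact four_mul_mul_le hy0 hX0 hX (mem_Ioc.1 (mem_filter.1 hα).1).2 hVB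
  have hcard : ((y ^ 7 : ℕ) : ℝ) / 2 ≤ #𝒜 := by
    refine half_le_card_coprime hV0 (fun p hp => ⟨(hS p hp).1, ?_⟩) hSV ?_
    · refine le_trans ?_ (hS p hp).2
      calc 4 * V ≤ V * V := Nat.mul_le_mul_right _ (by omega)
        _ = V ^ 2 := (sq V).symm
        _ ≤ V ^ 40000 := Nat.pow_le_pow_right hV0 (by norm_num)
    · calc 4 * V ≤ V * V := Nat.mul_le_mul_right _ (by omega)
        _ = V ^ 2 := (sq V).symm
        _ ≤ y := hVpow 2 (by norm_num)
        _ ≤ y ^ 7 := Nat.le_self_pow (by norm_num) y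
  have hsq := sq_sum_card_le (S := S) (B := B) (A := y ^ 15) (k := y ^ 7) (H := y ^ 16) (Q := y ^ 8)
    (θ := 1 / (2 * X) * B / 4) (𝒜 := 𝒜) (β := β) u (filter_subset _ _) hβ hd0 (by
      exact (two_mul_pow_add_pow_le hy4).trans hy1)
    (by
      intro a ha
      have h3 : y ^ 8 < a := by
        have : y ^ 8 * y ^ 7 < a * y ^ 7 := lt_of_eq_of_lt (by ring) ha
        exact lt_of_mul_lt_mul_right this (Nat.zero_le _)
      refine Nat.div_le_of_le_mul ?_
      calc y ^ 16 = y ^ 8 * y ^ 8 := by ring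
        _ ≤ a * y ^ 8 := Nat.mul_le_mul_right _ h3.le)
  set total := ∑ α ∈ 𝒜, #{t ∈ range (y ^ 16) | 1 / (2 * X) * B / 4 ≤
    |incSum S B (β α * (u + (t : ℕ)))|}
  have hlow : (y : ℝ) ^ 23 / (16 * X) ≤ total := by
    have := card_nsmul_le_sum 𝒜 (fun α => (#{t ∈ range (y ^ 16) | 1 / (2 * X) * B / 4 ≤
      |incSum S B (β α * (u + (t : ℕ)))|} : ℝ)) _ h1
    rw [nsmul_eq_mul, ← Nat.cast_sum] at this
    refine le_trans ?_ this
    calc (y : ℝ) ^ 23 / (16 * X) = ((y ^ 7 : ℕ) : ℝ) / 2 * (1 / (2 * X) * (y ^ 16 : ℕ) / 4) := by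
          push_cast; field_simp; ring
      _ ≤ _ := mul_le_mul_of_nonneg_right hcard
        (div_nonneg (mul_nonneg (by positivity) (Nat.cast_nonneg _)) (by norm_num))
  have hbig : (#(bigSet S B (1 / (2 * X) * B / 4)) : ℝ) ≤ y ^ 22 := by
    have e : 1 / (2 * X) * (B : ℝ) / 4 = ((V ^ 400 : ℕ) : ℝ) / (8 * X) := by
      rw [hB]; field_simp; norm_num1
    rw [e]
    refine (card_bigSet_le hV hX1 hX hS hSn hd).trans ?_
    have hly := log_le_of_lt_add_one_pow hd0 hy2 
      ((pow_le_pow_left₀ (by norm_num1) hVR 80).trans (by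
        rw [← Nat.cast_pow]; exact Nat.cast_le.2 (hVpow 80 (by norm_num1))))
    exact exp_mul_log_le_pow (by exact_mod_cast hd0) hyR hly
  exact absurd (le_of_sq_le hyR hX0 hlow hbig (by exact_mod_cast hsq))
    (not_le.2 (lt_of_lt_of_le (sq_lt_pow_four hX0 hX hVR) (by
      have := hVpow 4 (by norm_num)
      clear * - this
      exact_mod_cast this)))

end UniformBound

section PerModulus

theorem incSum_add (S : Finset ℕ) (a b : ℕ) (u : ℤ) :
    incSum S (a + b) u = incSum S a u + incSum S b (u + a) := by
  simp only [incSum, sum_range_add, Nat.cast_add, add_assoc]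

theorem abs_incSum_mul_le {S : Finset ℕ} {b : ℕ} {c : ℝ} (h : ∀ u, |incSum S b u| ≤ c) (n : ℕ)
    (u : ℤ) : |incSum S (b * n) u| ≤ c * n := by
  induction n with
  | zero => simp [incSum]
  | succ n ih =>
    rw [mul_add, mul_one, incSum_add, Nat.cast_succ, mul_add, mul_one]
    exact (abs_add_le _ _).trans (add_le_add ih (h _))

theorem abs_incSum_le_mul_add {S : Finset ℕ} {b : ℕ} {η : ℝ} (hb : 0 < b) (hη : 0 ≤ η)
    (h : ∀ u, |incSum S b u| ≤ η * b) (H : ℕ) (u : ℤ) : |incSum S H u| ≤ η * H + b := by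
  rw [← Nat.div_add_mod H b, incSum_add]
  refine (abs_add_le _ _).trans (add_le_add ((abs_incSum_mul_le h _ _).trans ?_)
    ((abs_incSum_le S _ _).trans ?_))
  · rw [mul_assoc, ← Nat.cast_mul]
    gcongr
    exact Nat.le_add_right _ _
  · exact_mod_cast (Nat.mod_lt _ hb).le

theorem bigSet_subset {S : Finset ℕ} {H : ℕ} {θ θ' : ℝ} (h : θ' ≤ θ) :
    bigSet S H θ ⊆ bigSet S H θ' := fun _ hu => by
  rw [bigSet, mem_filter] at hu ⊢
  exact ⟨hu.1, h.trans hu.2⟩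

theorem card_bigSet_div_le_of_large {S : Finset ℕ} {B H : ℕ} {X : ℝ} (hX : 1 ≤ X)
    (hd : 0 < ∏ p ∈ S, p) (hB : 0 < B) (hBH : 4 * B ≤ H / X)
    (hbig : #(bigSet S B (B / (8 * X))) ≤ Real.exp (0.54 * Real.log (∏ p ∈ S, p : ℕ)))
    (hlarge : 2.4 * Real.log H ≤ Real.log (∏ p ∈ S, p : ℕ)) :
    #(bigSet S H (H / X)) / ((∏ p ∈ S, p : ℕ) : ℝ) ≤ 4 * X * Real.exp (-1.104 * Real.log H) := by
  have hX0 : 0 < X := by linarith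
  have hdR : (0 : ℝ) < (∏ p ∈ S, p : ℕ) := by exact_mod_cast hd
  have h1 := card_bigSet_mul_le (S := S) (H := H) (η := 1 / X) hd hB (by positivity) (by
    rw [one_div_mul_eq_div]; exact hBH)
  rw [one_div_mul_eq_div] at h1
  have h2 : #(bigSet S B (1 / X * B / 4)) ≤ #(bigSet S B (B / (8 * X))) := by
    refine card_le_card (bigSet_subset ?_)
    rw [one_div_mul_eq_div, div_div]
    exact div_le_div_of_nonneg_left (Nat.cast_nonneg _) (by linarith) (by linarith)
  have h3 : (#(bigSet S H (H / X)) : ℝ) ≤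
      4 * X * Real.exp (0.54 * Real.log (∏ p ∈ S, p : ℕ)) := by
    have h4 : (#(bigSet S H (H / X)) : ℝ) * (1 / X / 4) ≤
      Real.exp (0.54 * Real.log (∏ p ∈ S, p : ℕ)) :=
      h1.trans (le_trans (by exact_mod_cast h2) hbig)
    calc (#(bigSet S H (H / X)) : ℝ) = 4 * X * (#(bigSet S H (H / X)) * (1 / X / 4)) := by
          field_simp
      _ ≤ _ := by gcongr
  calc #(bigSet S H (H / X)) / ((∏ p ∈ S, p : ℕ) : ℝ)
      ≤ 4 * X * Real.exp (0.54 * Real.log (∏ p ∈ S, p : ℕ)) / (∏ p ∈ S, p : ℕ) := by gcongr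
    _ = 4 * X * Real.exp (0.54 * Real.log (∏ p ∈ S, p : ℕ) - Real.log (∏ p ∈ S, p : ℕ)) := by
        rw [Real.exp_sub, Real.exp_log hdR, mul_div_assoc]
    _ ≤ 4 * X * Real.exp (-1.104 * Real.log H) := by
        refine mul_le_mul_of_nonneg_left (Real.exp_le_exp.2 ?_) (by positivity)
        linarith

theorem bigSet_eq_empty_of_uniform {S : Finset ℕ} {b H : ℕ} {X : ℝ} (hX : 0 < X) (hb : 0 < b)
    (hu : ∀ u, |incSum S b u| < 1 / (2 * X) * b) (hbH : 4 * X * b ≤ H) (hH : 0 < H) :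
    bigSet S H (H / X) = ∅ := by
  refine filter_eq_empty_iff.2 fun u _ => not_le.2 ?_
  have hHR : (0 : ℝ) < H := by exact_mod_cast hH
  refine (abs_incSum_le_mul_add hb (by positivity) (fun u => (hu u).le) H u).trans_lt ?_
  have h1 : (b : ℝ) ≤ H / (4 * X) := by rw [le_div_iff₀ (by positivity)]; linarith
  have h2 : 1 / (2 * X) * H + H / (4 * X) < H / X := by
    rw [← sub_pos]
    have : (H : ℝ) / X - (1 / (2 * X) * H + H / (4 * X)) = H / (4 * X) := by field_simp; ring
    rw [this]
    positivity
  linarith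

theorem card_bigSet_div_le {S : Finset ℕ} {V H : ℕ} {X : ℝ} (hV : 400 ≤ V) (hX1 : 1 ≤ X)
    (hX : X ≤ V) (hS : ∀ p ∈ S, p.Prime ∧ V ^ 40000 ≤ p) (hSn : S.Nonempty)
    (hd : ∏ p ∈ S, p ≤ 2 ^ V) (hSV : #S ≤ V) (hH : V ^ 500 ≤ H) :
    #(bigSet S H (H / X)) / ((∏ p ∈ S, p : ℕ) : ℝ) ≤ 4 * X * Real.exp (-1.104 * Real.log H) := by
  have hd0 : 0 < ∏ p ∈ S, p := prod_pos fun p hp => (hS p hp).1.pos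
  have hV0 : 0 < V := by omega
  have hVR : (400 : ℝ) ≤ V := by exact_mod_cast hV
  have hVR0 : (0 : ℝ) < V := by linarith
  have hVR1 : (1 : ℝ) ≤ V := by linarith
  have hX0 : 0 < X := by linarith
  have hH0 : 0 < H := lt_of_lt_of_le (pow_pos hV0 _) hH
  have hHR : (0 : ℝ) < H := by exact_mod_cast hH0
  have hHV : (V : ℝ) ^ 500 ≤ H := by
    rw [← Nat.cast_pow]
    exact Nat.cast_le.2 hH
  have h4X : 4 * X ≤ (V : ℝ) ^ 2 := by nlinarith
  by_cases hlarge : 2.4 * Real.log H ≤ Real.log (∏ p ∈ S, p : ℕ)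
  · refine card_bigSet_div_le_of_large hX1 hd0 (pow_pos hV0 400) ?_
      (card_bigSet_le hV hX1 hX hS hSn hd) hlarge
    rw [le_div_iff₀ hX0, Nat.cast_pow]
    calc 4 * (V : ℝ) ^ 400 * X = (V : ℝ) ^ 400 * (4 * X) := by ring
      _ ≤ (V : ℝ) ^ 400 * (V : ℝ) ^ 2 := mul_le_mul_of_nonneg_left h4X (pow_nonneg hVR0.le _)
      _ = (V : ℝ) ^ 402 := by ring
      _ ≤ (V : ℝ) ^ 500 := pow_le_pow_right₀ hVR1 (by norm_num1)
      _ ≤ H := hHV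
  · obtain ⟨y, hy0, hy, hu⟩ := exists_uniform_bound hV hX1 hX hS hSn hd hSV
    have hyR : (0 : ℝ) < y := by exact_mod_cast hy0
    rw [bigSet_eq_empty_of_uniform hX0 (pow_pos hy0 16) hu _ hH0, card_empty, Nat.cast_zero,
      zero_div]
    · exact mul_nonneg (by linarith) (Real.exp_pos _).le
    · have h1 : (40 : ℕ) * Real.log y ≤ Real.log (∏ p ∈ S, p : ℕ) := by
        rw [← Real.log_pow, ← Nat.cast_pow]
        exact Real.log_le_log (Nat.cast_pos.2 (pow_pos hy0 _)) (Nat.cast_le.2 hy)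
      have h2 := Real.log_le_log (pow_pos hVR0 _) hHV
      rw [Real.log_pow] at h2
      have h3 := Real.log_le_log (by linarith) h4X
      rw [Real.log_pow] at h3
      have h5 : 0 ≤ Real.log V := Real.log_nonneg hVR1
      push_cast at h2 h3
      rw [not_le] at hlarge
      rw [Nat.cast_ofNat] at h1
      rw [← Real.log_le_log_iff (mul_pos (by linarith) (Nat.cast_pos.2 (pow_pos hy0 16))) hHR,
        Real.log_mul (by linarith) (Nat.cast_pos.2 (pow_pos hy0 16)).ne', Nat.cast_pow,
        Real.log_pow]
      push_cast
      linarith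

end PerModulus

section LongGaps

theorem exp_neg_log_div_le {a V L : ℕ} {X : ℝ} (hV : 400 ≤ V) (hX1 : 1 ≤ X)
    (hX : X ≤ V) (ha0 : 0 < a) (ha : a ≤ V) (hL : V ^ 1000 ≤ L) :
    X * (4 * X * Real.exp (-1.104 * Real.log (L / a : ℕ))) ≤
      1 / V * (L : ℝ) ^ (-1.05 : ℝ) := by
  have hV0 : 0 < V := by omega
  have hVR : (400 : ℝ) ≤ V := by exact_mod_cast hV
  have hVR0 : (0 : ℝ) < V := by linarith
  have hX0 : 0 < X := by linarith
  have haR0 : (0 : ℝ) < a := by exact_mod_cast ha0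
  have haV : (a : ℝ) ≤ V := by exact_mod_cast ha
  have hL0 : 0 < L := lt_of_lt_of_le (pow_pos hV0 _) hL
  have hLR : (0 : ℝ) < L := by exact_mod_cast hL0
  have hlogV : Real.log 400 ≤ Real.log V := Real.log_le_log (by norm_num1) hVR
  have hlog400 : 0 < Real.log 400 := Real.log_pos (by norm_num1)
  have hlog4 : Real.log 4 ≤ Real.log 400 := Real.log_le_log (by norm_num1) (by norm_num1)
  have hlogX : Real.log X ≤ Real.log V := Real.log_le_log hX0 hX
  have hloga : Real.log a ≤ Real.log V := Real.log_le_log haR0 haV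
  have hlogL : 1000 * Real.log V ≤ Real.log L := by
    have h1 : ((V : ℝ)) ^ 1000 ≤ L := by
      rw [← Nat.cast_pow]; exact Nat.cast_le.2 hL
    have h2 := Real.log_le_log (pow_pos hVR0 _) h1
    rwa [Real.log_pow, Nat.cast_ofNat] at h2
  have haL : a ≤ L := by
    calc a ≤ V ^ 1 := by rwa [pow_one]
      _ ≤ V ^ 1000 := Nat.pow_le_pow_right hV0 (by norm_num1)
      _ ≤ L := hL
  have hH1 : 1 ≤ L / a := (Nat.one_le_div_iff ha0).2 haL
  have hHlog : Real.log L - Real.log 2 - Real.log a ≤ Real.log (L / a : ℕ) := by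
    have h1 : L ≤ 2 * a * (L / a) := by
      have := Nat.lt_mul_div_succ L ha0
      nlinarith
    have h2 : (L : ℝ) ≤ 2 * a * (L / a : ℕ) := by exact_mod_cast h1
    have hHR : (0 : ℝ) < (L / a : ℕ) := by exact_mod_cast hH1
    have h3 := Real.log_le_log hLR h2
    rw [Real.log_mul (mul_pos two_pos haR0).ne' hHR.ne', Real.log_mul two_ne_zero haR0.ne'] at h3
    linarith
  have hlog2 : Real.log 2 ≤ Real.log 400 := Real.log_le_log (by norm_num1) (by norm_num1)
  have e1 : X * (4 * X * Real.exp (-1.104 * Real.log (L / a : ℕ))) =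
      Real.exp (Real.log X + (Real.log 4 + Real.log X + -1.104 * Real.log (L / a : ℕ))) := by
    rw [Real.exp_add, Real.exp_add, Real.exp_add, Real.exp_log hX0, Real.exp_log (by norm_num1)]
  have e2 : 1 / V * (L : ℝ) ^ (-1.05 : ℝ) =
      Real.exp (-Real.log V + Real.log L * -1.05) := by
    rw [Real.exp_add, Real.exp_neg, Real.exp_log hVR0, Real.rpow_def_of_pos hLR, one_div]
  rw [e1, e2]
  refine Real.exp_le_exp.2 ?_
  linarith

theorem gapCount_div_le_rpow {M a V L : ℕ} [NeZero M] {S : Finset ℕ} (hV : 400 ≤ V)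
    (hM : M = a * ∏ p ∈ S, p) (hS : ∀ p ∈ S, p.Prime ∧ V ^ 40000 ≤ p)
    (ha : ∀ p ∈ S, a.Coprime p) (ha0 : 0 < a) (haV : a ≤ V) (hSV : 2 ^ #S ≤ V)
    (hMV : M ≤ 2 ^ V) (hL : V ^ 1000 ≤ L) :
    (gapCount M (QR M) L : ℝ) / M ≤ 1 / V * (L : ℝ) ^ (-1.05 : ℝ) := by
  have hV0 : 0 < V := by omega
  have hSR : ((2 : ℝ) ^ #S) ≤ V := by exact_mod_cast hSV
  have hX1 : (1 : ℝ) ≤ 2 ^ #S := one_le_pow₀ (by norm_num)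
  have hH : V ^ 500 ≤ L / a := by
    refine (Nat.le_div_iff_mul_le ha0).2 (le_trans ?_ hL)
    calc V ^ 500 * a ≤ V ^ 500 * V := Nat.mul_le_mul_left _ haV
      _ = V ^ 501 := (pow_succ V 500).symm
      _ ≤ V ^ 1000 := Nat.pow_le_pow_right hV0 (by norm_num1)
  refine (gapCount_div_le_sum hM (fun p hp => (hS p hp).1) ha (Nat.mul_div_le L a)
    (lt_of_lt_of_le (pow_pos hV0 _) hH)).trans (le_trans ?_
      (exp_neg_log_div_le hV hX1 hSR ha0 haV hL))
  refine (sum_le_card_nsmul _ _ (4 * 2 ^ #S * Real.exp (-1.104 * Real.log (L / a : ℕ)))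
    fun R hR => ?_).trans ?_
  · obtain ⟨hR0, hRS⟩ := mem_erase.1 hR
    rw [mem_powerset] at hRS
    refine card_bigSet_div_le hV hX1 hSR (fun p hp => hS p (hRS hp))
      (nonempty_iff_ne_empty.2 hR0) ?_ ?_ hH
    · refine le_trans ?_ hMV
      rw [hM]
      exact (prod_le_prod_of_subset_of_one_le' hRS fun p hp _ => (hS p hp).1.one_le).trans
        (Nat.le_mul_of_pos_left _ ha0)
    · exact (card_le_card hRS).trans (Nat.lt_two_pow_self.le.trans hSV)
  · rw [nsmul_eq_mul]
    refine mul_le_mul_of_nonneg_right ?_ (mul_nonneg (by linarith) (Real.exp_pos _).le)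
    have : #(S.powerset.erase ∅) ≤ 2 ^ #S := (card_erase_le).trans (card_powerset S).le
    exact_mod_cast this

theorem gapCount_div_le_av_add {M a V L : ℕ} [NeZero M] {S : Finset ℕ} (hV : 400 ≤ V)
    (hM : M = a * ∏ p ∈ S, p) (hS : ∀ p ∈ S, p.Prime ∧ V ^ 40000 ≤ p)
    (ha : ∀ p ∈ S, a.Coprime p) (hSV : 2 ^ #S ≤ V) (hL : L < V ^ 1000) :
    (gapCount M (QR M) L : ℝ) / M ≤
      av a (fun x => (1 - 1 / 2 ^ #S) ^ sqCount a L x) + 1 / (V : ℝ) ^ 2000 := by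
  have hV0 : 0 < V := by omega
  have hVR : (400 : ℝ) ≤ V := by exact_mod_cast hV
  have hVR0 : (0 : ℝ) < V := by linarith
  have hVR1 : (1 : ℝ) ≤ V := by linarith
  have hVp : ∀ p ∈ S, ∀ n ≤ 40000, V ^ n ≤ p := fun p hp n hn =>
    (Nat.pow_le_pow_right hV0 hn).trans (hS p hp).2
  refine (gapCount_div_le_av hM (fun p hp => ⟨(hS p hp).1, ?_, ?_⟩) ha).trans
    (add_le_add le_rfl ?_)
  · have := hVp p hp 1 (by norm_num1)
    rw [pow_one] at this
    exact ne_of_gt (lt_of_lt_of_le (by omega) this)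
  · exact hL.le.trans (hVp p hp 1000 (by norm_num1))
  · have hL' : (L : ℝ) ≤ (V : ℝ) ^ 1000 := by
      rw [← Nat.cast_pow]; exact Nat.cast_le.2 hL.le
    have h1 : ∀ p ∈ S, 200 * (L : ℝ) / √p ≤ 1 / (V : ℝ) ^ 2001 := by
      intro p hp
      have h2 : (V : ℝ) ^ 4000 ≤ √p := by
        refine Real.le_sqrt_of_sq_le ?_
        rw [← pow_mul, ← Nat.cast_pow]
        exact Nat.cast_le.2 (hVp p hp _ (by norm_num1))
      have h3 : (0 : ℝ) < (V : ℝ) ^ 4000 := pow_pos hVR0 _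
      rw [div_le_div_iff₀ (h3.trans_le h2) (pow_pos hVR0 _), one_mul]
      refine le_trans ?_ h2
      calc 200 * (L : ℝ) * (V : ℝ) ^ 2001 ≤ (V : ℝ) * (V : ℝ) ^ 1000 * (V : ℝ) ^ 2001 :=
            mul_le_mul_of_nonneg_right (mul_le_mul (by linarith) hL' (Nat.cast_nonneg _) hVR0.le)
              (pow_pos hVR0 _).le
        _ = (V : ℝ) ^ 3002 := by ring
        _ ≤ (V : ℝ) ^ 4000 := pow_le_pow_right₀ hVR1 (by norm_num1)
    refine (sum_le_card_nsmul _ _ _ h1).trans ?_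
    have h4 : (#S : ℝ) ≤ V := by exact_mod_cast Nat.lt_two_pow_self.le.trans hSV
    rw [nsmul_eq_mul, mul_one_div, div_le_div_iff₀ (pow_pos hVR0 _) (pow_pos hVR0 _), one_mul,
      pow_succ' _ 2000]
    exact mul_le_mul_of_nonneg_right h4 (pow_pos hVR0 _).le

end LongGaps

section CardQR

theorem two_mul_card_QR_le {p : ℕ} (hp : Odd p) : 2 * #(QR p) ≤ p + 1 := by
  have h : QR p ⊆ (range ((p + 1) / 2)).image (fun a : ℕ => (a : ZMod p) ^ 2) := by
    intro x hx
    rw [QR, mem_image] at hx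
    obtain ⟨b, hb, rfl⟩ := hx
    rw [mem_range] at hb
    rcases lt_or_ge b ((p + 1) / 2) with h | h
    · exact mem_image_of_mem _ (mem_range.2 h)
    · refine mem_image.2 ⟨p - b, mem_range.2 ?_, ?_⟩
      · obtain ⟨m, rfl⟩ := hp
        omega
      · rw [Nat.cast_sub hb.le, ZMod.natCast_self, zero_sub, neg_sq]
  have h1 := (card_le_card h).trans card_image_le
  rw [card_range] at h1
  omega

theorem card_QR_mul_le {m n : ℕ} [NeZero m] [NeZero n] (h : m.Coprime n) :
    #(QR (m * n)) ≤ #(QR m) * #(QR n) := by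
  have : NeZero (m * n) := ⟨mul_ne_zero (NeZero.ne m) (NeZero.ne n)⟩
  rw [← card_product]
  refine card_le_card_of_injOn (ZMod.chineseRemainder h) (fun x hx => ?_)
    (ZMod.chineseRemainder h).injective.injOn
  rw [mem_coe, mem_QR_iff] at hx
  have h2 := hx.map (ZMod.chineseRemainder h)
  rw [mem_coe, mem_product, mem_QR_iff, mem_QR_iff]
  obtain ⟨y, hy⟩ := h2
  rw [hy]
  exact ⟨⟨y.1, rfl⟩, ⟨y.2, rfl⟩⟩

theorem card_QR_mul_prod_le {a : ℕ} (ha0 : 0 < a) {S : Finset ℕ} (hS : ∀ p ∈ S, p.Prime ∧ p ≠ 2)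
    (ha : ∀ p ∈ S, a.Coprime p) :
    (#(QR (a * ∏ p ∈ S, p)) : ℝ) ≤ #(QR a) * ∏ p ∈ S, ((p : ℝ) + 1) / 2 := by
  classical
  induction S using Finset.induction_on with
  | empty => rw [prod_empty, prod_empty, mul_one, mul_one]
  | insert p S hp ih =>
    have hp' := (hS p (mem_insert_self p S)).1
    have : NeZero p := ⟨hp'.ne_zero⟩
    have hS' : ∀ q ∈ S, q.Prime ∧ q ≠ 2 := fun q hq => hS q (mem_insert_of_mem hq)
    have : NeZero (a * ∏ p ∈ S, p) :=
      ⟨(mul_pos ha0 (prod_pos fun q hq => (hS' q hq).1.pos)).ne'⟩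
    have hcop : (a * ∏ p ∈ S, p).Coprime p := by
      refine Nat.Coprime.mul_left (ha p (mem_insert_self p S))
        (Nat.Coprime.prod_left fun q hq => ?_)
      rw [Nat.coprime_primes (hS' q hq).1 hp']
      rintro rfl
      exact hp hq
    have e : a * ∏ q ∈ insert p S, q = (a * ∏ q ∈ S, q) * p := by
      rw [prod_insert hp]; ring
    have h1 := card_QR_mul_le hcop
    rw [e, prod_insert hp]
    have h2 : (#(QR p) : ℝ) ≤ ((p : ℝ) + 1) / 2 := by
      have h3 : 2 * #(QR p) ≤ p + 1 := by
        exact two_mul_card_QR_le (hp'.odd_of_ne_two (hS p (mem_insert_self p S)).2)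
      have h4 : 2 * (#(QR p) : ℝ) ≤ p + 1 := by exact_mod_cast h3
      linarith
    calc (#(QR ((a * ∏ q ∈ S, q) * p)) : ℝ) ≤ #(QR (a * ∏ q ∈ S, q)) * #(QR p) := by
          exact_mod_cast h1
      _ ≤ (#(QR a) * ∏ p ∈ S, ((p : ℝ) + 1) / 2) * (((p : ℝ) + 1) / 2) :=
          mul_le_mul (ih hS' fun q hq => ha q (mem_insert_of_mem hq)) h2 (Nat.cast_nonneg _)
            (by positivity)
      _ = _ := by ring

theorem prod_add_one_le_prod_add_one {ι : Type*} {S : Finset ι} (hS : S.Nonempty) {x : ι → ℝ}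
    (hx : ∀ i ∈ S, 0 ≤ x i) : ∏ i ∈ S, x i + 1 ≤ ∏ i ∈ S, (x i + 1) := by
  classical
  induction hS using Finset.Nonempty.cons_induction with
  | singleton a => simp
  | cons a s ha hs ih =>
    rw [prod_cons, prod_cons]
    have h1 := ih fun i hi => hx i (mem_cons_of_mem hi)
    have h2 : 0 ≤ ∏ i ∈ s, x i := prod_nonneg fun i hi => hx i (mem_cons_of_mem hi)
    have h3 := hx a (mem_cons_self a s)
    nlinarith

theorem le_div_card_QR_add_one {a : ℕ} (ha0 : 0 < a) {S : Finset ℕ} (hSn : S.Nonempty)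
    (hS : ∀ p ∈ S, p.Prime ∧ p ≠ 2) (ha : ∀ p ∈ S, a.Coprime p) (hk : 1 ≤ #(QR a)) :
    (a : ℝ) / (1 / 2 ^ #S * #(QR a)) * (1 - ∑ p ∈ S, 3 / (p : ℝ)) ≤
      ((a * ∏ p ∈ S, p : ℕ) : ℝ) / (#(QR (a * ∏ p ∈ S, p)) + 1) := by
  have hkR : (1 : ℝ) ≤ #(QR a) := by exact_mod_cast hk
  have hp0 : ∀ p ∈ S, (0 : ℝ) < p := fun p hp => by exact_mod_cast (hS p hp).1.pos
  have h1 := card_QR_mul_prod_le ha0 hS ha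
  have h2 := prod_add_one_le_prod_add_one hSn (x := fun p : ℕ => ((p : ℝ) + 1) / 2)
    (fun p _ => by positivity)
  have h3 : (#(QR (a * ∏ p ∈ S, p)) : ℝ) + 1 ≤
      #(QR a) * (∏ p ∈ S, (p : ℝ)) / 2 ^ #S * ∏ p ∈ S, (1 + 3 / (p : ℝ)) := by
    calc (#(QR (a * ∏ p ∈ S, p)) : ℝ) + 1 ≤ #(QR a) * ∏ p ∈ S, ((p : ℝ) + 1) / 2 + #(QR a) := by
          linarith
      _ = #(QR a) * (∏ p ∈ S, ((p : ℝ) + 1) / 2 + 1) := by ring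
      _ ≤ #(QR a) * ∏ p ∈ S, (((p : ℝ) + 1) / 2 + 1) := by gcongr
      _ = #(QR a) * ∏ p ∈ S, ((p : ℝ) / 2 * (1 + 3 / (p : ℝ))) := by
          congr 1
          refine prod_congr rfl fun p hp => ?_
          have := (hp0 p hp).ne'
          field_simp
          ring
      _ = _ := by rw [prod_mul_distrib, prod_div_distrib, prod_const]; ring
  have h4 : (1 - ∑ p ∈ S, 3 / (p : ℝ)) * ∏ p ∈ S, (1 + 3 / (p : ℝ)) ≤ 1 := by
    have h5 : 1 - ∑ p ∈ S, 3 / (p : ℝ) ≤ Real.exp (-∑ p ∈ S, 3 / (p : ℝ)) := by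
      have := Real.add_one_le_exp (-∑ p ∈ S, 3 / (p : ℝ))
      linarith
    have h6 : ∏ p ∈ S, (1 + 3 / (p : ℝ)) ≤ Real.exp (∑ p ∈ S, 3 / (p : ℝ)) := by
      rw [Real.exp_sum]
      refine prod_le_prod (fun p _ => by positivity) fun p _ => ?_
      have := Real.add_one_le_exp (3 / (p : ℝ))
      linarith
    calc (1 - ∑ p ∈ S, 3 / (p : ℝ)) * ∏ p ∈ S, (1 + 3 / (p : ℝ))
        ≤ Real.exp (-∑ p ∈ S, 3 / (p : ℝ)) * Real.exp (∑ p ∈ S, 3 / (p : ℝ)) :=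
          mul_le_mul h5 h6 (prod_nonneg fun p _ => by positivity) (Real.exp_pos _).le
      _ = 1 := by rw [← Real.exp_add]; simp
  have haR : (0 : ℝ) < a := by exact_mod_cast ha0
  have hq : 0 < ∏ p ∈ S, (p : ℝ) := prod_pos hp0
  rcases le_or_gt (1 - ∑ p ∈ S, 3 / (p : ℝ)) 0 with hneg | hpos
  · exact (mul_nonpos_of_nonneg_of_nonpos (by positivity) hneg).trans (by positivity)
  rw [le_div_iff₀ (by positivity)]
  push_cast
  calc (a : ℝ) / (1 / 2 ^ #S * #(QR a)) * (1 - ∑ p ∈ S, 3 / (p : ℝ)) *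
        (#(QR (a * ∏ p ∈ S, p)) + 1)
      ≤ (a : ℝ) / (1 / 2 ^ #S * #(QR a)) * (1 - ∑ p ∈ S, 3 / (p : ℝ)) *
        (#(QR a) * (∏ p ∈ S, (p : ℝ)) / 2 ^ #S * ∏ p ∈ S, (1 + 3 / (p : ℝ))) := by gcongr
    _ = a * (∏ p ∈ S, (p : ℝ)) *
        ((1 - ∑ p ∈ S, 3 / (p : ℝ)) * ∏ p ∈ S, (1 + 3 / (p : ℝ))) := by field_simp
    _ ≤ a * (∏ p ∈ S, (p : ℝ)) * 1 := by gcongr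
    _ = _ := mul_one _

end CardQR

section Criterion

/-- The sum of `n ^ (-1.05)` over all natural numbers. -/
noncomputable def tailConst : ℝ := ∑' n : ℕ, (n : ℝ) ^ (-1.05 : ℝ)

theorem sum_rpow_le_tailConst (s : Finset ℕ) : ∑ n ∈ s, (n : ℝ) ^ (-1.05 : ℝ) ≤ tailConst := by
  have h : Summable fun n : ℕ => (n : ℝ) ^ (-1.05 : ℝ) :=
    Real.summable_nat_rpow.2 (by norm_num)
  exact h.sum_le_tsum s fun n _ => Real.rpow_nonneg (Nat.cast_nonneg n) _

theorem tailConst_nonneg : 0 ≤ tailConst := by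
  simpa using sum_rpow_le_tailConst ∅

theorem sum_gapCount_div_le {M a V : ℕ} [NeZero M] {S : Finset ℕ} (hV : 400 ≤ V)
    (hM : M = a * ∏ p ∈ S, p) (hS : ∀ p ∈ S, p.Prime ∧ V ^ 40000 ≤ p)
    (ha : ∀ p ∈ S, a.Coprime p) (ha0 : 0 < a) (h4 : 4 ∣ a) (haV : a ≤ 2 ^ #S) (hSV : 2 ^ #S ≤ V)
    (hMV : M ≤ 2 ^ V) :
    ∑ L ∈ Ico 1 M, (gapCount M (QR M) L : ℝ) / M ≤
      a / (1 / 2 ^ #S * #(QR a)) - 3 / 2 + 3 * (1 / 2 ^ #S) * a ^ 3 + (1 + tailConst) / V := by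
  have : NeZero a := ⟨ha0.ne'⟩
  have hV0 : 0 < V := by omega
  have hVR : (400 : ℝ) ≤ V := by exact_mod_cast hV
  have hVR0 : (0 : ℝ) < V := by linarith
  have hVR1 : (1 : ℝ) ≤ V := by linarith
  set n := V ^ 1000 with hn
  have hn1 : 1 ≤ n := Nat.one_le_pow _ _ hV0
  clear_value n
  set G : ℕ → ℝ := fun L => av a (fun x => (1 - 1 / 2 ^ #S) ^ sqCount a L x) with hG
  have h2S : (0 : ℝ) < 2 ^ #S := by positivity
  have hρ1 : (1 : ℝ) / 2 ^ #S ≤ 1 := by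
    rw [div_le_one h2S]; exact one_le_pow₀ (by norm_num)
  have hG0 : ∀ L, 0 ≤ G L := fun L => av_nonneg fun x => pow_nonneg (by linarith) _
  have hGz : G 0 = 1 := by
    have : ∀ x : ℤ, sqCount a 0 x = 0 := fun x => by simp [sqCount]
    simp only [hG, this, pow_zero]
    exact av_const ha0.ne' 1
  have hterm : ∀ L ∈ Ico 1 M, (gapCount M (QR M) L : ℝ) / M ≤
      (if L < n then G L + 1 / (V : ℝ) ^ 2000 else 0) + 1 / V * (L : ℝ) ^ (-1.05 : ℝ) := by
    intro L _
    have h0 : 0 ≤ 1 / (V : ℝ) * (L : ℝ) ^ (-1.05 : ℝ) :=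
      mul_nonneg (by positivity) (Real.rpow_nonneg (Nat.cast_nonneg L) _)
    split_ifs with h
    · have := gapCount_div_le_av_add hV hM hS ha hSV (hn ▸ h)
      linarith
    · rw [zero_add]
      exact gapCount_div_le_rpow hV hM hS ha ha0 (haV.trans hSV) hSV hMV (hn ▸ not_lt.1 h)
  have hhead : ∑ L ∈ Ico 1 M, (if L < n then G L + 1 / (V : ℝ) ^ 2000 else 0) ≤
      (∑ L ∈ range n, G L - 1) + 1 / V := by
    have hsub : {L ∈ Ico 1 M | L < n} ⊆ Ico 1 n := fun L hL => by
      rw [mem_filter, mem_Ico] at hL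
      exact mem_Ico.2 ⟨hL.1.1, hL.2⟩
    have hc : 0 ≤ 1 / (V : ℝ) ^ 2000 := div_nonneg zero_le_one (pow_nonneg hVR0.le _)
    rw [← sum_filter]
    refine (sum_le_sum_of_subset_of_nonneg hsub fun L _ _ => add_nonneg (hG0 L) hc).trans ?_
    rw [sum_add_distrib, range_eq_Ico, sum_eq_sum_Ico_succ_bot hn1, hGz, sum_const, Nat.card_Ico,
      nsmul_eq_mul]
    have h1 : ((n - 1 : ℕ) : ℝ) ≤ (V : ℝ) ^ 1000 := by
      rw [← Nat.cast_pow, ← hn]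
      exact Nat.cast_le.2 (Nat.sub_le _ _)
    have h2 : ((n - 1 : ℕ) : ℝ) * (1 / (V : ℝ) ^ 2000) ≤ 1 / V := by
      rw [mul_one_div, div_le_div_iff₀ (pow_pos hVR0 _) hVR0, one_mul]
      calc ((n - 1 : ℕ) : ℝ) * V ≤ (V : ℝ) ^ 1000 * V := mul_le_mul_of_nonneg_right h1 hVR0.le
        _ = (V : ℝ) ^ 1001 := (pow_succ _ _).symm
        _ ≤ (V : ℝ) ^ 2000 := pow_le_pow_right₀ hVR1 (by norm_num1)
    rw [zero_add]
    linarith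
  have hmain := sum_av_pow_sqCount_le (a := a) h4 (ρ := 1 / 2 ^ #S) (by positivity) (by
    rw [one_div_mul_eq_div, div_le_one h2S]
    exact_mod_cast haV) n
  have htail : ∑ L ∈ Ico 1 M, 1 / (V : ℝ) * (L : ℝ) ^ (-1.05 : ℝ) ≤ 1 / V * tailConst := by
    rw [← mul_sum]
    exact mul_le_mul_of_nonneg_left (sum_rpow_le_tailConst _) (by positivity)
  have h5 := sum_le_sum hterm
  rw [sum_add_distrib] at h5
  have h6 : (1 + tailConst) / V = 1 / V + 1 / V * tailConst := by ring
  rw [h6]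
  linarith

theorem stoch_lt_savg {a V : ℕ} {S : Finset ℕ} (hV : 400 ≤ V) (hVc : 8 * (2 + tailConst) ≤ V)
    (hS : ∀ p ∈ S, p.Prime ∧ V ^ 40000 ≤ p) (ha : ∀ p ∈ S, a.Coprime p) (ha0 : 0 < a)
    (h4 : 4 ∣ a) (haS : 48 * a ^ 3 ≤ 2 ^ #S) (hSV : 2 ^ #S ≤ V)
    (hMV : a * ∏ p ∈ S, p ≤ 2 ^ V) :
    (stoch (a * ∏ p ∈ S, p) (QR (a * ∏ p ∈ S, p)) : ℚ) <
      savg (a * ∏ p ∈ S, p) #(QR (a * ∏ p ∈ S, p)) := by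
  have hMpos : 0 < a * ∏ p ∈ S, p := mul_pos ha0 (prod_pos fun p hp => (hS p hp).1.pos)
  have hV0 : 0 < V := by omega
  have hVR : (400 : ℝ) ≤ V := by exact_mod_cast hV
  have hVR0 : (0 : ℝ) < V := by linarith
  have hVR1 : (1 : ℝ) ≤ V := by linarith
  have hp2 : ∀ p ∈ S, V ≤ p := fun p hp => by
    have h := (Nat.pow_le_pow_right hV0 (by norm_num1 : 1 ≤ 40000)).trans (hS p hp).2
    rwa [pow_one] at h
  have haV : a ≤ 2 ^ #S := by
    have : a ≤ a ^ 3 := Nat.le_self_pow (by norm_num) a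
    omega
  have hSn : S.Nonempty := by
    rw [nonempty_iff_ne_empty]
    rintro rfl
    have : 1 ≤ a ^ 3 := Nat.one_le_pow _ _ ha0
    simp at haS
    omega
  have hSV' : (2 : ℝ) ^ #S ≤ V := by exact_mod_cast hSV
  have : NeZero a := ⟨ha0.ne'⟩
  have : NeZero (a * ∏ p ∈ S, p) := ⟨hMpos.ne'⟩
  have hk : 1 ≤ #(QR a) := one_le_card_QR
  have hkR : (1 : ℝ) ≤ #(QR a) := by exact_mod_cast hk
  refine stoch_lt_savg_of_sum_gapCount_lt ?_
  have h1 := sum_gapCount_div_le hV rfl hS ha ha0 h4 haV hSV hMV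
  have h2 := le_div_card_QR_add_one ha0 hSn
    (fun p hp => ⟨(hS p hp).1, by have := hp2 p hp; omega⟩) ha hk
  have haR : (1 : ℝ) ≤ a := by exact_mod_cast ha0
  have h3 : 3 * (1 / 2 ^ #S) * (a : ℝ) ^ 3 ≤ 1 / 16 := by
    have h : 48 * (a : ℝ) ^ 3 ≤ 2 ^ #S := by exact_mod_cast haS
    have h2S : (0 : ℝ) < 2 ^ #S := by positivity
    have e : 3 * (1 / 2 ^ #S) * (a : ℝ) ^ 3 = 48 * (a : ℝ) ^ 3 / 2 ^ #S / 16 := by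
      field_simp; norm_num
    rw [e]
    have := (div_le_one h2S).2 h
    linarith
  have h5 : (a : ℝ) / (1 / 2 ^ #S * #(QR a)) * ∑ p ∈ S, 3 / (p : ℝ) ≤ 1 / V := by
    have b1 : (a : ℝ) / (1 / 2 ^ #S * #(QR a)) ≤ (V : ℝ) ^ 2 := by
      have haV' : (a : ℝ) ≤ V := le_trans (by exact_mod_cast haV) hSV'
      calc (a : ℝ) / (1 / 2 ^ #S * #(QR a)) = a * 2 ^ #S / #(QR a) := by field_simp
        _ ≤ a * 2 ^ #S := div_le_self (by positivity) hkR
        _ ≤ V * V := mul_le_mul haV' hSV' (by positivity) hVR0.le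
        _ = (V : ℝ) ^ 2 := (sq _).symm
    have b2 : ∑ p ∈ S, 3 / (p : ℝ) ≤ 1 / (V : ℝ) ^ 3 := by
      have b3 : ∀ p ∈ S, 3 / (p : ℝ) ≤ 1 / (V : ℝ) ^ 4 := by
        intro p hp
        have b4 : (V : ℝ) ^ 5 ≤ p := by
          rw [← Nat.cast_pow]
          exact Nat.cast_le.2 ((Nat.pow_le_pow_right hV0 (by norm_num1)).trans (hS p hp).2)
        have hp0 : (0 : ℝ) < p := (pow_pos hVR0 5).trans_le b4
        rw [div_le_div_iff₀ hp0 (pow_pos hVR0 4), one_mul]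
        refine le_trans ?_ b4
        rw [pow_succ' _ 4]
        exact mul_le_mul_of_nonneg_right (by linarith) (pow_pos hVR0 4).le
      refine (sum_le_card_nsmul _ _ _ b3).trans ?_
      have b5 : (#S : ℝ) ≤ V := by exact_mod_cast Nat.lt_two_pow_self.le.trans hSV
      rw [nsmul_eq_mul, mul_one_div, div_le_div_iff₀ (pow_pos hVR0 _) (pow_pos hVR0 _), one_mul,
        pow_succ' _ 3]
      exact mul_le_mul_of_nonneg_right b5 (pow_pos hVR0 _).le
    calc _ ≤ (V : ℝ) ^ 2 * (1 / (V : ℝ) ^ 3) := mul_le_mul b1 b2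
            (sum_nonneg fun p _ => div_nonneg (by norm_num1) (Nat.cast_nonneg p))
            (pow_pos hVR0 2).le
      _ = 1 / V := by field_simp
  have h6 : (1 + tailConst) / V + 1 / V ≤ 1 / 8 := by
    rw [← add_div, div_le_iff₀ hVR0]
    linarith
  have h7 : ((a * ∏ p ∈ S, p : ℕ) : ℝ) / (#(QR (a * ∏ p ∈ S, p)) + 1) ≤
      (((a * ∏ p ∈ S, p : ℕ) : ℝ) + 1) / (#(QR (a * ∏ p ∈ S, p)) + 1) := by
    gcongr
    linarith
  rw [mul_sub, mul_one] at h2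
  linarith

end Criterion

section SmoothRough

/-- All prime factors of `n` are smaller than `Y`. -/
def IsSmooth (Y n : ℕ) : Prop := ∀ p : ℕ, p.Prime → p ∣ n → p < Y

/-- All prime factors of `n` are at least `Y`. -/
def IsRough (Y n : ℕ) : Prop := ∀ p : ℕ, p.Prime → p ∣ n → Y ≤ p

open Classical in
/-- The positive integers up to `X` without prime factors `≥ Y`. -/
noncomputable def smoothUpTo (Y X : ℕ) : Finset ℕ := (Icc 1 X).filter (IsSmooth Y)

open Classical in
/-- The positive integers up to `X` without prime factors `< Y`. -/
noncomputable def roughUpTo (Y X : ℕ) : Finset ℕ := (Icc 1 X).filter (IsRough Y)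

lemma mem_smoothUpTo {Y X n : ℕ} : n ∈ smoothUpTo Y X ↔ (1 ≤ n ∧ n ≤ X) ∧ IsSmooth Y n := by
  simp [smoothUpTo]

lemma mem_roughUpTo {Y X n : ℕ} : n ∈ roughUpTo Y X ↔ (1 ≤ n ∧ n ≤ X) ∧ IsRough Y n := by
  simp [roughUpTo]

lemma IsSmooth.mul {Y m n : ℕ} (hm : IsSmooth Y m) (hn : IsSmooth Y n) : IsSmooth Y (m * n) :=
  fun p hp hd => (hp.dvd_mul.1 hd).elim (hm p hp) (hn p hp)

lemma IsRough.mul {Y m n : ℕ} (hm : IsRough Y m) (hn : IsRough Y n) : IsRough Y (m * n) :=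
  fun p hp hd => (hp.dvd_mul.1 hd).elim (hm p hp) (hn p hp)

lemma IsSmooth.of_dvd {Y m n : ℕ} (hn : IsSmooth Y n) (h : m ∣ n) : IsSmooth Y m :=
  fun p hp hd => hn p hp (hd.trans h)

lemma isSmooth_of_lt {Y n : ℕ} (h0 : 0 < n) (h : n < Y) : IsSmooth Y n :=
  fun _ _ hd => (Nat.le_of_dvd h0 hd).trans_lt h

lemma IsSmooth.coprime {Y m n : ℕ} (hm : IsSmooth Y m) (hn : IsRough Y n) : m.Coprime n :=
  Nat.coprime_of_dvd fun p hp h1 h2 => (hm p hp h1).not_ge (hn p hp h2)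

lemma exists_isSmooth_mul_isRough (Y : ℕ) {n : ℕ} (hn : n ≠ 0) :
    ∃ s m, s * m = n ∧ IsSmooth Y s ∧ IsRough Y m := by
  induction n using induction_on_primes with
  | zero => exact absurd rfl hn
  | one =>
    exact ⟨1, 1, rfl, fun p hp h => absurd (Nat.dvd_one.1 h) hp.one_lt.ne',
      fun p hp h => absurd (Nat.dvd_one.1 h) hp.one_lt.ne'⟩
  | prime_mul p a hp ih =>
    have ha : a ≠ 0 := by rintro rfl; simp at hn
    obtain ⟨s, m, rfl, hs, hm⟩ := ih ha
    have hp' : p.Prime := hp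
    rcases lt_or_ge p Y with h | h
    · refine ⟨p * s, m, by ring, IsSmooth.mul ?_ hs, hm⟩
      intro q hq hd
      rwa [(Nat.prime_dvd_prime_iff_eq hq hp').1 hd]
    · refine ⟨s, p * m, by ring, hs, IsRough.mul ?_ hm⟩
      intro q hq hd
      rwa [(Nat.prime_dvd_prime_iff_eq hq hp').1 hd]

lemma smooth_mul_rough_inj {Y s m s' m' : ℕ} (hs : IsSmooth Y s) (hm : IsRough Y m)
    (hs' : IsSmooth Y s') (hm' : IsRough Y m') (h0 : s ≠ 0) (h : s * m = s' * m') :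
    s = s' ∧ m = m' := by
  have h1 : s ∣ s' := (hs.coprime hm').dvd_of_dvd_mul_right (h ▸ Dvd.intro _ rfl)
  have h2 : s' ∣ s := (hs'.coprime hm).dvd_of_dvd_mul_right (h ▸ Dvd.intro _ rfl)
  have h3 := Nat.dvd_antisymm h1 h2
  subst h3
  exact ⟨rfl, Nat.eq_of_mul_eq_mul_left (Nat.pos_of_ne_zero h0) h⟩

lemma harmonic_real (X : ℕ) : ((harmonic X : ℚ) : ℝ) = ∑ n ∈ Icc 1 X, 1 / (n : ℝ) := by
  rw [harmonic_eq_sum_Icc]; push_cast; simp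

lemma log_le_sum_Icc (X : ℕ) : Real.log X ≤ ∑ n ∈ Icc 1 X, 1 / (n : ℝ) := by
  rw [← harmonic_real]
  refine le_trans ?_ (log_add_one_le_harmonic X)
  rcases Nat.eq_zero_or_pos X with rfl | h
  · simp
  · exact Real.log_le_log (by exact_mod_cast h) (by push_cast; linarith)

lemma sum_Icc_le_log (X : ℕ) : ∑ n ∈ Icc 1 X, 1 / (n : ℝ) ≤ 1 + Real.log X := by
  rw [← harmonic_real]; exact harmonic_le_one_add_log X

/-- Reciprocal sums over smooth and rough numbers together dominate the harmonic sum. -/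
lemma log_le_smooth_mul_rough (Y X : ℕ) :
    Real.log X ≤ (∑ s ∈ smoothUpTo Y X, 1 / (s : ℝ)) * ∑ m ∈ roughUpTo Y X, 1 / (m : ℝ) := by
  refine (log_le_sum_Icc X).trans ?_
  rw [sum_mul_sum, ← sum_product']
  calc ∑ n ∈ Icc 1 X, 1 / (n : ℝ)
      ≤ ∑ n ∈ (smoothUpTo Y X ×ˢ roughUpTo Y X).image (fun z : ℕ × ℕ => z.1 * z.2),
          1 / (n : ℝ) := by
        refine sum_le_sum_of_subset_of_nonneg ?_ (fun _ _ _ => by positivity)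
        intro n hn
        rw [mem_Icc] at hn
        obtain ⟨s, m, rfl, hs, hm⟩ := exists_isSmooth_mul_isRough Y (n := n) (by omega)
        have hpos : 0 < s * m := hn.1
        have h1' : 0 < s := Nat.pos_of_ne_zero (by rintro rfl; simp at hpos)
        have h2' : 0 < m := Nat.pos_of_ne_zero (by rintro rfl; simp at hpos)
        exact mem_image.2 ⟨(s, m), mem_product.2 ⟨mem_smoothUpTo.2
          ⟨⟨h1', (Nat.le_mul_of_pos_right s h2').trans hn.2⟩, hs⟩, mem_roughUpTo.2
          ⟨⟨h2', (Nat.le_mul_of_pos_left m h1').trans hn.2⟩, hm⟩⟩, rfl⟩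
    _ ≤ ∑ z ∈ smoothUpTo Y X ×ˢ roughUpTo Y X, 1 / ((z.1 * z.2 : ℕ) : ℝ) :=
        sum_image_le_of_nonneg (f := fun n : ℕ => 1 / (n : ℝ)) (fun _ _ => by positivity)
    _ = _ := by
        refine sum_congr rfl fun z _ => ?_
        push_cast
        rw [one_div_mul_one_div]

lemma sum_log_primeFactors_le {n : ℕ} (hn : n ≠ 0) :
    ∑ p ∈ n.primeFactors, Real.log p ≤ Real.log n := by
  rw [← Real.log_prod (fun p hp => by
    exact_mod_cast (Nat.prime_of_mem_primeFactors hp).ne_zero)]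
  refine Real.log_le_log (prod_pos fun p hp => by
    exact_mod_cast (Nat.prime_of_mem_primeFactors hp).pos) ?_
  rw [← Nat.cast_prod]
  exact Nat.cast_le.2 (Nat.le_of_dvd (Nat.pos_of_ne_zero hn) (Nat.prod_primeFactors_dvd n))

/-- A weak form of the upper bound in Mertens' first theorem. -/
lemma sum_log_div_le (N : ℕ) :
    ∑ p ∈ (Icc 1 N).filter Nat.Prime, Real.log p / p ≤ 2 * Real.log N := by
  rcases Nat.eq_zero_or_pos N with rfl | hN
  · simp
  have hNr : (0 : ℝ) < N := by exact_mod_cast hN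
  have h1 : ∑ n ∈ Icc 1 N, ∑ p ∈ n.primeFactors, Real.log p ≤ N * Real.log N := by
    calc _ ≤ ∑ n ∈ Icc 1 N, Real.log N := by
          refine sum_le_sum fun n hn => ?_
          rw [mem_Icc] at hn
          refine (sum_log_primeFactors_le (by omega)).trans (Real.log_le_log ?_ ?_)
          · exact_mod_cast hn.1
          · exact_mod_cast hn.2
      _ = _ := by simp
  have h2 : ∑ n ∈ Icc 1 N, ∑ p ∈ n.primeFactors, Real.log p
      = ∑ p ∈ (Icc 1 N).filter Nat.Prime, ((N / p : ℕ) : ℝ) * Real.log p := by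
    rw [sum_comm' (t' := (Icc 1 N).filter Nat.Prime)
      (s' := fun p => (Icc 1 N).filter (fun n => p ∣ n))]
    · refine sum_congr rfl fun p _ => ?_
      rw [sum_const, nsmul_eq_mul, ← Nat.Ioc_filter_dvd_card_eq_div]
      rfl
    · intro n p
      simp only [mem_Icc, mem_filter, Nat.mem_primeFactors]
      constructor
      · rintro ⟨h, hp, hd, h0⟩
        exact ⟨⟨h, hd⟩, ⟨hp.one_lt.le, (Nat.le_of_dvd h.1 hd).trans h.2⟩, hp⟩
      · rintro ⟨⟨h, hd⟩, h', hp⟩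
        exact ⟨h, hp, hd, by omega⟩
  have h3 : ∀ p ∈ (Icc 1 N).filter Nat.Prime,
      (N : ℝ) / 2 * (Real.log p / p) ≤ ((N / p : ℕ) : ℝ) * Real.log p := by
    intro p hp
    rw [mem_filter, mem_Icc] at hp
    have hpr : (0 : ℝ) < p := by exact_mod_cast hp.2.pos
    have hfl : (N : ℝ) / 2 / p ≤ ((N / p : ℕ) : ℝ) := by
      have hq : 1 ≤ N / p := (Nat.one_le_div_iff hp.2.pos).2 hp.1.2
      have hlt : N < p * (N / p + 1) := Nat.lt_mul_div_succ N hp.2.pos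
      have : N ≤ 2 * (N / p) * p := by nlinarith
      rw [div_div, div_le_iff₀ (by positivity)]
      have h' : (N : ℝ) ≤ 2 * ((N / p : ℕ) : ℝ) * p := by exact_mod_cast this
      linarith
    calc (N : ℝ) / 2 * (Real.log p / p) = (N : ℝ) / 2 / p * Real.log p := by ring
      _ ≤ _ := mul_le_mul_of_nonneg_right hfl (Real.log_natCast_nonneg p)
  have h4 := sum_le_sum h3
  rw [← mul_sum, ← h2] at h4
  have h5 := h4.trans h1
  have h6 : (N : ℝ) * (∑ p ∈ (Icc 1 N).filter Nat.Prime, Real.log p / p)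
      ≤ N * (2 * Real.log N) := by linarith
  exact le_of_mul_le_mul_left h6 hNr

end SmoothRough

section SmoothRoughBounds

lemma mul_sum_factorization_div_le (Y X : ℕ) {p : ℕ} (hp : p.Prime) :
    ((p : ℝ) - 1) * ∑ s ∈ smoothUpTo Y X, (s.factorization p : ℝ) / s
      ≤ ∑ s ∈ smoothUpTo Y X, 1 / (s : ℝ) := by
  have hp0 : (0 : ℝ) < p := by exact_mod_cast hp.pos
  have key : ∑ s ∈ smoothUpTo Y X, (s.factorization p : ℝ) / s
      ≤ ∑ s ∈ smoothUpTo Y X, ((s.factorization p : ℝ) + 1) / (p * s) := by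
    calc ∑ s ∈ smoothUpTo Y X, (s.factorization p : ℝ) / s
        = ∑ s ∈ (smoothUpTo Y X).filter (fun s => p ∣ s), (s.factorization p : ℝ) / s := by
          rw [sum_filter]
          refine sum_congr rfl fun s _ => ?_
          split_ifs with h
          · rfl
          · simp [Nat.factorization_eq_zero_of_not_dvd h]
      _ ≤ ∑ s ∈ (smoothUpTo Y X).image (fun s => p * s), (s.factorization p : ℝ) / s := by
          refine sum_le_sum_of_subset_of_nonneg ?_ (fun _ _ _ => by positivity)
          intro s hs
          rw [mem_filter, mem_smoothUpTo] at hs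
          obtain ⟨⟨⟨h1, h2⟩, h3⟩, k, rfl⟩ := hs
          have hk : 0 < k := Nat.pos_of_ne_zero (by rintro rfl; simp at h1)
          exact mem_image.2 ⟨k, mem_smoothUpTo.2
            ⟨⟨hk, (Nat.le_mul_of_pos_left k hp.pos).trans h2⟩, h3.of_dvd (Dvd.intro_left _ rfl)⟩, rfl⟩
      _ ≤ ∑ s ∈ smoothUpTo Y X, ((p * s).factorization p : ℝ) / ((p * s : ℕ) : ℝ) :=
          sum_image_le_of_nonneg (f := fun s : ℕ => (s.factorization p : ℝ) / s)
            (fun _ _ => by positivity)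
      _ = _ := by
          refine sum_congr rfl fun s hs => ?_
          rw [mem_smoothUpTo] at hs
          rw [Nat.factorization_mul hp.ne_zero (by omega)]
          simp only [Finsupp.add_apply, hp.factorization_self]
          push_cast
          ring
  have h2 : ∑ s ∈ smoothUpTo Y X, ((s.factorization p : ℝ) + 1) / (p * s)
      = (∑ s ∈ smoothUpTo Y X, (s.factorization p : ℝ) / s
        + ∑ s ∈ smoothUpTo Y X, 1 / (s : ℝ)) / p := by
    rw [← sum_add_distrib, sum_div]
    refine sum_congr rfl fun s _ => ?_
    rw [← add_div, div_div, mul_comm]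
  rw [h2, le_div_iff₀ hp0] at key
  linarith

lemma log_le_sum_factorization {Y s : ℕ} (hs : s ≠ 0) (h : IsSmooth Y s) :
    Real.log s ≤ ∑ p ∈ (Icc 1 Y).filter Nat.Prime, (s.factorization p : ℝ) * Real.log p := by
  have h1 : (s : ℝ) = ∏ p ∈ s.primeFactors, (p : ℝ) ^ s.factorization p := by
    have := Nat.prod_factorization_pow_eq_self hs
    rw [Finsupp.prod, Nat.support_factorization] at this
    exact_mod_cast this.symm
  have h2 : Real.log s = ∑ p ∈ s.primeFactors, (s.factorization p : ℝ) * Real.log p := by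
    conv_lhs => rw [h1]
    rw [Real.log_prod (fun p hp => pow_ne_zero _ (by
      exact_mod_cast (Nat.prime_of_mem_primeFactors hp).ne_zero))]
    exact sum_congr rfl fun p _ => Real.log_pow _ _
  rw [h2]
  refine sum_le_sum_of_subset_of_nonneg ?_ (fun p _ _ =>
    mul_nonneg (Nat.cast_nonneg _) (Real.log_natCast_nonneg p))
  intro p hp
  have hp' := Nat.prime_of_mem_primeFactors hp
  exact mem_filter.2 ⟨mem_Icc.2 ⟨hp'.one_lt.le, (h p hp' (Nat.dvd_of_mem_primeFactors hp)).le⟩, hp'⟩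

lemma sum_log_div_smooth_le (Y X : ℕ) :
    ∑ s ∈ smoothUpTo Y X, Real.log s / s
      ≤ 4 * Real.log Y * ∑ s ∈ smoothUpTo Y X, 1 / (s : ℝ) := by
  set T := ∑ s ∈ smoothUpTo Y X, 1 / (s : ℝ) with hT
  have hT0 : 0 ≤ T := sum_nonneg fun _ _ => by positivity
  calc ∑ s ∈ smoothUpTo Y X, Real.log s / s
      ≤ ∑ s ∈ smoothUpTo Y X, ∑ p ∈ (Icc 1 Y).filter Nat.Prime,
          Real.log p * ((s.factorization p : ℝ) / s) := by
        refine sum_le_sum fun s hs => ?_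
        rw [mem_smoothUpTo] at hs
        calc Real.log s / s ≤ (∑ p ∈ (Icc 1 Y).filter Nat.Prime,
              (s.factorization p : ℝ) * Real.log p) / s :=
              div_le_div_of_nonneg_right (log_le_sum_factorization (by omega) hs.2)
                (Nat.cast_nonneg _)
          _ = _ := by
              rw [sum_div]
              exact sum_congr rfl fun p _ => by ring
    _ = ∑ p ∈ (Icc 1 Y).filter Nat.Prime,
          Real.log p * ∑ s ∈ smoothUpTo Y X, (s.factorization p : ℝ) / s := by
        rw [sum_comm]
        exact sum_congr rfl fun p _ => (mul_sum _ _ _).symm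
    _ ≤ ∑ p ∈ (Icc 1 Y).filter Nat.Prime, 2 * T * (Real.log p / p) := by
        refine sum_le_sum fun p hp => ?_
        have hp' := (mem_filter.1 hp).2
        have h2 : (2 : ℝ) ≤ p := by exact_mod_cast hp'.two_le
        have h := mul_sum_factorization_div_le Y X hp'
        set U := ∑ s ∈ smoothUpTo Y X, (s.factorization p : ℝ) / s
        have hU0 : 0 ≤ U := sum_nonneg fun _ _ => by positivity
        have hU : U ≤ 2 * T / p := by
          rw [le_div_iff₀ (by linarith)]
          nlinarith
        calc Real.log p * U ≤ Real.log p * (2 * T / p) :=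
              mul_le_mul_of_nonneg_left hU (Real.log_natCast_nonneg p)
          _ = _ := by ring
    _ = 2 * T * ∑ p ∈ (Icc 1 Y).filter Nat.Prime, Real.log p / p := (mul_sum _ _ _).symm
    _ ≤ 2 * T * (2 * Real.log Y) := mul_le_mul_of_nonneg_left (sum_log_div_le Y) (by linarith)
    _ = _ := by ring

lemma one_le_log {Y : ℕ} (hY : 3 ≤ Y) : 1 ≤ Real.log Y := by
  rw [Real.le_log_iff_exp_le (by exact_mod_cast (by omega : 0 < Y))]
  have := Real.exp_one_lt_d9
  have h : (3 : ℝ) ≤ Y := by exact_mod_cast hY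
  linarith

lemma sum_smooth_le {Y : ℕ} (hY : 3 ≤ Y) (X : ℕ) :
    ∑ s ∈ smoothUpTo Y X, 1 / (s : ℝ) ≤ 18 * Real.log Y := by
  have hl := one_le_log hY
  have h1 := sum_log_div_smooth_le Y X
  have h2 : ∑ s ∈ (smoothUpTo Y X).filter (fun s => ¬ s ≤ Y ^ 8), 8 * Real.log Y * (1 / (s : ℝ))
      ≤ ∑ s ∈ smoothUpTo Y X, Real.log s / s := by
    refine le_trans (sum_le_sum fun s hs => ?_) (sum_le_sum_of_subset_of_nonneg (filter_subset _ _)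
      fun s _ _ => div_nonneg (Real.log_natCast_nonneg s) (Nat.cast_nonneg s))
    rw [mem_filter] at hs
    have : 8 * Real.log Y ≤ Real.log s := by
      rw [show (8 : ℝ) * Real.log Y = Real.log ((Y : ℝ) ^ 8) by rw [Real.log_pow]; norm_num]
      refine Real.log_le_log (pow_pos (by exact_mod_cast (by omega : 0 < Y)) _) ?_
      exact_mod_cast (not_le.1 hs.2).le
    rw [mul_one_div]
    exact div_le_div_of_nonneg_right this (Nat.cast_nonneg _)
  have h3 : ∑ s ∈ (smoothUpTo Y X).filter (fun s => s ≤ Y ^ 8), 1 / (s : ℝ)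
      ≤ 1 + 8 * Real.log Y := by
    refine le_trans (sum_le_sum_of_subset_of_nonneg (t := Icc 1 (Y ^ 8)) ?_
      (fun _ _ _ => by positivity)) ((sum_Icc_le_log _).trans ?_)
    · intro s hs
      rw [mem_filter, mem_smoothUpTo] at hs
      exact mem_Icc.2 ⟨hs.1.1.1, hs.2⟩
    · push_cast
      rw [Real.log_pow]
      norm_num
  have h4 := sum_filter_add_sum_filter_not (smoothUpTo Y X) (fun s => s ≤ Y ^ 8)
    (fun s => 1 / (s : ℝ))
  rw [← mul_sum] at h2
  set A := ∑ s ∈ (smoothUpTo Y X).filter (fun s => s ≤ Y ^ 8), 1 / (s : ℝ)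
  set B := ∑ s ∈ (smoothUpTo Y X).filter (fun s => ¬ s ≤ Y ^ 8), 1 / (s : ℝ)
  rw [← h4] at h1 ⊢
  have h5 : Real.log Y * (8 * B) ≤ Real.log Y * (4 * (A + B)) := by linarith
  have h6 := le_of_mul_le_mul_left h5 (by linarith)
  linarith

lemma log_le_mul_sum_rough {Y : ℕ} (hY : 3 ≤ Y) (X : ℕ) :
    Real.log X ≤ 18 * Real.log Y * ∑ m ∈ roughUpTo Y X, 1 / (m : ℝ) :=
  (log_le_smooth_mul_rough Y X).trans (mul_le_mul_of_nonneg_right (sum_smooth_le hY X)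
    (sum_nonneg fun _ _ => by positivity))

lemma sum_log_mul_card_rough_le (Y X : ℕ) :
    ∑ p ∈ (Icc Y X).filter Nat.Prime, Real.log p * #(roughUpTo Y (X / p))
      ≤ #(roughUpTo Y X) * Real.log X := by
  calc ∑ p ∈ (Icc Y X).filter Nat.Prime, Real.log p * #(roughUpTo Y (X / p))
      ≤ ∑ p ∈ (Icc Y X).filter Nat.Prime,
          Real.log p * #((roughUpTo Y X).filter (fun m => p ∣ m)) := by
        refine sum_le_sum fun p hp => mul_le_mul_of_nonneg_left ?_ (Real.log_natCast_nonneg p)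
        rw [mem_filter, mem_Icc] at hp
        rw [← card_image_of_injective (roughUpTo Y (X / p))
          (f := fun m => p * m)
          (fun a b h => Nat.eq_of_mul_eq_mul_left hp.2.pos h)]
        refine Nat.cast_le.2 (card_le_card ?_)
        intro m hm
        obtain ⟨k, hk, rfl⟩ := mem_image.1 hm
        rw [mem_roughUpTo] at hk
        refine mem_filter.2 ⟨mem_roughUpTo.2 ⟨⟨Nat.mul_pos hp.2.pos hk.1.1, ?_⟩, ?_⟩,
          Dvd.intro _ rfl⟩
        · exact (Nat.mul_le_mul_left p hk.1.2).trans (Nat.mul_div_le X p)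
        · refine IsRough.mul (fun q hq hd => ?_) hk.2
          rw [(Nat.prime_dvd_prime_iff_eq hq hp.2).1 hd]
          exact hp.1.1
    _ = ∑ m ∈ roughUpTo Y X, ∑ p ∈ m.primeFactors, Real.log p := by
        rw [sum_comm' (t' := (Icc Y X).filter Nat.Prime)
          (s' := fun p => (roughUpTo Y X).filter (fun m => p ∣ m))]
        · refine sum_congr rfl fun p _ => ?_
          rw [sum_const, nsmul_eq_mul, mul_comm]
        · intro m p
          simp only [mem_Icc, mem_filter, Nat.mem_primeFactors, mem_roughUpTo]
          constructor
          · rintro ⟨h, hp, hd, h0⟩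
            exact ⟨⟨h, hd⟩, ⟨h.2 p hp hd, (Nat.le_of_dvd h.1.1 hd).trans h.1.2⟩, hp⟩
          · rintro ⟨⟨h, hd⟩, h', hp⟩
            exact ⟨h, hp, hd, by omega⟩
    _ ≤ ∑ m ∈ roughUpTo Y X, Real.log X := by
        refine sum_le_sum fun m hm => ?_
        rw [mem_roughUpTo] at hm
        refine (sum_log_primeFactors_le (by omega)).trans (Real.log_le_log ?_ ?_)
        · exact_mod_cast hm.1.1
        · exact_mod_cast hm.1.2
    _ = _ := by simp

lemma sum_sum_log_le (Y X Q : ℕ) (hQ : Q ≤ X) :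
    ∑ m ∈ roughUpTo Y Q, ∑ p ∈ (Icc Y (X / m)).filter Nat.Prime, Real.log p
      ≤ #(roughUpTo Y X) * Real.log X := by
  refine le_trans ?_ (sum_log_mul_card_rough_le Y X)
  calc ∑ m ∈ roughUpTo Y Q, ∑ p ∈ (Icc Y (X / m)).filter Nat.Prime, Real.log p
      ≤ ∑ m ∈ roughUpTo Y X, ∑ p ∈ (Icc Y (X / m)).filter Nat.Prime, Real.log p := by
        refine sum_le_sum_of_subset_of_nonneg ?_ (fun m _ _ => sum_nonneg fun p _ =>
          Real.log_natCast_nonneg p)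
        intro m hm
        rw [mem_roughUpTo] at hm ⊢
        exact ⟨⟨hm.1.1, hm.1.2.trans hQ⟩, hm.2⟩
    _ = ∑ p ∈ (Icc Y X).filter Nat.Prime, ∑ m ∈ roughUpTo Y (X / p), Real.log p := by
        refine sum_comm' ?_
        intro m p
        simp only [mem_Icc, mem_filter, mem_roughUpTo]
        constructor
        · rintro ⟨⟨⟨h1, h2⟩, h3⟩, ⟨h4, h5⟩, hp⟩
          rw [Nat.le_div_iff_mul_le (by omega)] at h5
          refine ⟨⟨⟨h1, (Nat.le_div_iff_mul_le hp.pos).2 (by linarith [mul_comm m p])⟩, h3⟩,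
            ⟨h4, (Nat.le_mul_of_pos_right p (by omega)).trans h5⟩, hp⟩
        · rintro ⟨⟨⟨h1, h2⟩, h3⟩, ⟨h4, h5⟩, hp⟩
          rw [Nat.le_div_iff_mul_le hp.pos] at h2
          refine ⟨⟨⟨h1, (Nat.le_mul_of_pos_right m hp.pos).trans h2⟩, h3⟩,
            ⟨h4, (Nat.le_div_iff_mul_le (by omega)).2 (by linarith [mul_comm m p])⟩, hp⟩
    _ = _ := by
        refine sum_congr rfl fun p _ => ?_
        rw [sum_const, nsmul_eq_mul, mul_comm]

end SmoothRoughBounds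

section RoughCount

lemma eventually_half_le_theta : ∀ᶠ n : ℕ in Filter.atTop, (n : ℝ) / 2 ≤ Chebyshev.theta n := by
  have h := (isLittleO_log_rpow_atTop (r := 1 / 2) (by norm_num)).bound
    (show (0 : ℝ) < 1 / 20 by norm_num)
  have h' := tendsto_natCast_atTop_atTop (R := ℝ) |>.eventually h
  filter_upwards [h', Filter.eventually_ge_atTop 100] with n hn h100
  have hn1 : (100 : ℝ) ≤ n := by exact_mod_cast h100
  rw [← Real.sqrt_eq_rpow, Real.norm_of_nonneg (Real.log_natCast_nonneg n),
    Real.norm_of_nonneg (Real.sqrt_nonneg _)] at hn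
  have h1 : Real.log ((n : ℝ) + 1) ≤ Real.log 2 + Real.log n := by
    rw [← Real.log_mul (by norm_num) (by linarith)]
    exact Real.log_le_log (by linarith) (by linarith)
  have h2 := Chebyshev.theta_ge n
  have h3 := Real.log_two_gt_d9
  have h4 := Real.log_two_lt_d9
  have hs : √(n : ℝ) * √(n : ℝ) = n := Real.mul_self_sqrt (by linarith)
  have hs0 := Real.sqrt_nonneg (n : ℝ)
  have h5 : 2 * √(n : ℝ) * Real.log n ≤ n / 10 := by nlinarith
  have h6 : √(n : ℝ) ≤ n := by nlinarith
  nlinarith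

lemma theta_sub_theta_le (Y n : ℕ) :
    Chebyshev.theta n - Chebyshev.theta Y
      ≤ ∑ p ∈ (Icc Y n).filter Nat.Prime, Real.log p := by
  rw [Chebyshev.theta_eq_sum_Icc, Chebyshev.theta_eq_sum_Icc, Nat.floor_natCast, Nat.floor_natCast,
    sub_le_iff_le_add]
  refine le_trans (sum_le_sum_of_subset_of_nonneg (t := (Icc Y n).filter Nat.Prime ∪
    (Icc 0 Y).filter Nat.Prime) ?_ fun p _ _ => Real.log_natCast_nonneg p) ?_
  · intro p hp
    simp only [mem_union, mem_filter, mem_Icc] at hp ⊢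
    rcases le_total Y p with h | h
    · exact Or.inl ⟨⟨h, hp.1.2⟩, hp.2⟩
    · exact Or.inr ⟨⟨Nat.zero_le _, h⟩, hp.2⟩
  · rw [← sum_union_inter]
    exact le_add_of_nonneg_right (sum_nonneg fun p _ => Real.log_natCast_nonneg p)

lemma exists_quarter_le_sum_log : ∃ Y₀ : ℕ, 6 ≤ Y₀ ∧ ∀ Y n : ℕ, Y₀ ≤ Y → Y ^ 2 ≤ n →
    (n : ℝ) / 4 ≤ ∑ p ∈ (Icc Y n).filter Nat.Prime, Real.log p := by
  obtain ⟨a, ha⟩ := Filter.eventually_atTop.1 eventually_half_le_theta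
  refine ⟨a + 6, by omega, fun Y n hY hn => ?_⟩
  have hYn : Y ≤ n := le_trans (by nlinarith) hn
  refine le_trans ?_ (theta_sub_theta_le Y n)
  have h1 := ha n (by omega)
  have h2 := Chebyshev.theta_le_log4_mul_x (x := (Y : ℝ)) (Nat.cast_nonneg _)
  have h3 : Real.log 4 = 2 * Real.log 2 := by
    rw [show (4 : ℝ) = 2 ^ 2 by norm_num, Real.log_pow]; norm_num
  have h4 := Real.log_two_lt_d9
  have h5 : (Y : ℝ) ^ 2 ≤ n := by exact_mod_cast hn
  have h6 : (6 : ℝ) ≤ Y := by exact_mod_cast (by omega : 6 ≤ Y)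
  nlinarith

lemma exists_le_card_rough : ∃ Y₀ : ℕ, 6 ≤ Y₀ ∧ ∀ Y X : ℕ, Y₀ ≤ Y → Y ^ 4 ≤ X →
    (X : ℝ) / (576 * Real.log Y) ≤ #(roughUpTo Y X) := by
  obtain ⟨Y₀, h6, hY₀⟩ := exists_quarter_le_sum_log
  refine ⟨Y₀, h6, fun Y X hY hX => ?_⟩
  have hY6 : 6 ≤ Y := h6.trans hY
  have hYpos : 0 < Y ^ 2 := by positivity
  have hl := one_le_log (Y := Y) (by omega)
  set Q := X / Y ^ 2 with hQ
  have hQX : Q ≤ X := Nat.div_le_self _ _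
  have hQ1 : Y ^ 2 ≤ Q := by
    rw [hQ, Nat.le_div_iff_mul_le hYpos]; calc _ = Y ^ 4 := by ring
      _ ≤ X := hX
  have hQ2 : X < Y ^ 2 * (Q + 1) := Nat.lt_mul_div_succ X hYpos
  have hQ36 : 36 ≤ Q := le_trans (by nlinarith) hQ1
  have hQ3 : X ≤ Q ^ 4 := by
    have h1 : X ≤ Q * (Q + 1) := hQ2.le.trans (Nat.mul_le_mul_right _ hQ1)
    have h2 : Q + 1 ≤ Q ^ 3 := by nlinarith [Nat.pow_le_pow_left hQ36 2]
    calc X ≤ Q * (Q + 1) := h1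
      _ ≤ Q * Q ^ 3 := Nat.mul_le_mul_left _ h2
      _ = _ := by ring
  have hX0 : 0 < X := by omega
  have hXr : (0 : ℝ) < X := by exact_mod_cast hX0
  have hlX : 0 < Real.log X := Real.log_pos (by exact_mod_cast (by omega : 1 < X))
  have hlQ : Real.log X ≤ 4 * Real.log Q := by
    rw [show (4 : ℝ) * Real.log Q = Real.log ((Q : ℝ) ^ 4) by rw [Real.log_pow]; norm_num]
    exact Real.log_le_log hXr (by exact_mod_cast hQ3)
  have h1 := sum_sum_log_le Y X Q hQX
  have h2 : ∑ m ∈ roughUpTo Y Q, (X : ℝ) / 8 * (1 / (m : ℝ))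
      ≤ ∑ m ∈ roughUpTo Y Q, ∑ p ∈ (Icc Y (X / m)).filter Nat.Prime, Real.log p := by
    refine sum_le_sum fun m hm => ?_
    rw [mem_roughUpTo] at hm
    have hm0 : 0 < m := hm.1.1
    have hmY : Y ^ 2 ≤ X / m := by
      rw [Nat.le_div_iff_mul_le hm0]
      calc Y ^ 2 * m ≤ Y ^ 2 * Q := Nat.mul_le_mul_left _ hm.1.2
        _ ≤ X := Nat.mul_div_le X _
    refine le_trans ?_ (hY₀ Y (X / m) hY hmY)
    have h3 : X < m * (X / m + 1) := Nat.lt_mul_div_succ X hm0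
    have h4 : X ≤ 2 * (X / m) * m := by nlinarith
    have h5 : (X : ℝ) ≤ 2 * ((X / m : ℕ) : ℝ) * m := by exact_mod_cast h4
    have hmr : (0 : ℝ) < m := by exact_mod_cast hm0
    rw [mul_one_div, div_le_iff₀ hmr]
    linarith
  rw [← mul_sum] at h2
  have h3 := log_le_mul_sum_rough (Y := Y) (by omega) Q
  set R := ∑ m ∈ roughUpTo Y Q, 1 / (m : ℝ)
  have h4 : (X : ℝ) / 8 * R ≤ #(roughUpTo Y X) * Real.log X := h2.trans h1
  rw [div_le_iff₀ (by linarith)]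
  have h5 : X * Real.log X ≤ #(roughUpTo Y X) * (576 * Real.log Y) * Real.log X := by
    calc X * Real.log X ≤ X * (4 * (18 * Real.log Y * R)) :=
          mul_le_mul_of_nonneg_left (hlQ.trans (by linarith)) hXr.le
      _ = 576 * Real.log Y * (X / 8 * R) := by ring
      _ ≤ 576 * Real.log Y * (#(roughUpTo Y X) * Real.log X) :=
          mul_le_mul_of_nonneg_left h4 (by linarith)
      _ = _ := by ring
  exact le_of_mul_le_mul_right h5 hlX

end RoughCount

section ExceptionalSets

/-- Number of primes in `P` dividing `n`. -/
def primeCount (P : Finset ℕ) (n : ℕ) : ℕ := #(P.filter (fun p => p ∣ n))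

lemma card_filter_dvd_Icc (N k : ℕ) : #((Icc 1 N).filter (fun n => k ∣ n)) = N / k := by
  rw [← Nat.Ioc_filter_dvd_card_eq_div]; rfl

lemma cast_primeCount (P : Finset ℕ) (n : ℕ) :
    (primeCount P n : ℝ) = ∑ p ∈ P, if p ∣ n then (1 : ℝ) else 0 := by
  rw [primeCount, ← sum_filter]; simp

lemma sum_ite_dvd (N k : ℕ) :
    ∑ n ∈ Icc 1 N, (if k ∣ n then (1 : ℝ) else 0) = ((N / k : ℕ) : ℝ) := by
  rw [← sum_filter, sum_const, nsmul_eq_mul, mul_one, card_filter_dvd_Icc]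

lemma sum_primeCount_ge {P : Finset ℕ} (N : ℕ) :
    (N : ℝ) * ∑ p ∈ P, 1 / (p : ℝ) - #P ≤ ∑ n ∈ Icc 1 N, (primeCount P n : ℝ) := by
  simp_rw [cast_primeCount]
  rw [sum_comm, mul_sum, sub_le_iff_le_add]
  have : (#P : ℝ) = ∑ p ∈ P, (1 : ℝ) := by simp
  rw [this, ← sum_add_distrib]
  refine sum_le_sum fun p _ => ?_
  rw [sum_ite_dvd, mul_one_div]
  exact (Nat.lt_floor_add_one _).le.trans (by rw [Nat.floor_div_eq_div])

lemma sum_primeCount_sq_le {P : Finset ℕ} (hP : ∀ p ∈ P, p.Prime) (N : ℕ) :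
    ∑ n ∈ Icc 1 N, (primeCount P n : ℝ) ^ 2
      ≤ N * ((∑ p ∈ P, 1 / (p : ℝ)) ^ 2 + ∑ p ∈ P, 1 / (p : ℝ)) := by
  have h1 : ∀ n, (primeCount P n : ℝ) ^ 2 = ∑ p ∈ P, ∑ q ∈ P,
      if p ∣ n ∧ q ∣ n then (1 : ℝ) else 0 := by
    intro n
    rw [cast_primeCount, sq, sum_mul_sum]
    refine sum_congr rfl fun p _ => sum_congr rfl fun q _ => ?_
    by_cases hp : p ∣ n <;> by_cases hq : q ∣ n <;> simp [hp, hq]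
  simp_rw [h1]
  rw [sum_comm, sq, sum_mul_sum, ← sum_add_distrib, mul_sum]
  refine sum_le_sum fun p hp => ?_
  rw [sum_comm]
  have h2 : ∀ q ∈ P, ∑ n ∈ Icc 1 N, (if p ∣ n ∧ q ∣ n then (1 : ℝ) else 0)
      ≤ N * (1 / (p : ℝ) * (1 / (q : ℝ))) + if q = p then N * (1 / (p : ℝ)) else 0 := by
    intro q hq
    have hp0 : (0 : ℝ) < p := by exact_mod_cast (hP p hp).pos
    have hq0 : (0 : ℝ) < q := by exact_mod_cast (hP q hq).pos
    split_ifs with h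
    · subst h
      simp only [and_self]
      rw [sum_ite_dvd]
      have h3 : ((N / q : ℕ) : ℝ) ≤ N / q := Nat.cast_div_le
      rw [← mul_one_div] at h3
      have h4 : (0 : ℝ) ≤ N * (1 / (q : ℝ) * (1 / (q : ℝ))) := by positivity
      linarith
    · have hc : p.Coprime q := (Nat.coprime_primes (hP p hp) (hP q hq)).2 (Ne.symm h)
      have h5 : ∀ n, (p ∣ n ∧ q ∣ n) ↔ p * q ∣ n := fun n =>
        ⟨fun h => hc.mul_dvd_of_dvd_of_dvd h.1 h.2,
          fun h => ⟨(Dvd.intro _ rfl).trans h, (Dvd.intro_left _ rfl).trans h⟩⟩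
      simp only [h5]
      rw [sum_ite_dvd, add_zero, one_div_mul_one_div, mul_one_div]
      exact le_trans Nat.cast_div_le (by push_cast; exact le_rfl)
  refine (sum_le_sum h2).trans (le_of_eq ?_)
  rw [sum_add_distrib, sum_ite_eq' P p, if_pos hp, ← mul_sum, mul_add]

/-- Turán's variance bound, as a bound for the number of integers with few prime factors. -/
lemma card_primeCount_le_mul_le {P : Finset ℕ} (hP : ∀ p ∈ P, p.Prime) (N : ℕ) {k : ℝ}
    (hk : k ≤ ∑ p ∈ P, 1 / (p : ℝ)) :
    #((Icc 1 N).filter (fun n => (primeCount P n : ℝ) ≤ k)) * (∑ p ∈ P, 1 / (p : ℝ) - k) ^ 2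
      ≤ N * (∑ p ∈ P, 1 / (p : ℝ)) + 2 * (∑ p ∈ P, 1 / (p : ℝ)) * #P := by
  set μ := ∑ p ∈ P, 1 / (p : ℝ) with hμ
  have hμ0 : 0 ≤ μ := sum_nonneg fun _ _ => by positivity
  have h1 := sum_primeCount_sq_le hP N
  have h2 := sum_primeCount_ge (P := P) N
  rw [← hμ] at h1 h2
  calc #((Icc 1 N).filter (fun n => (primeCount P n : ℝ) ≤ k)) * (μ - k) ^ 2
      = ∑ n ∈ (Icc 1 N).filter (fun n => (primeCount P n : ℝ) ≤ k), (μ - k) ^ 2 := by simp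
    _ ≤ ∑ n ∈ (Icc 1 N).filter (fun n => (primeCount P n : ℝ) ≤ k),
          (μ - primeCount P n) ^ 2 := by
        refine sum_le_sum fun n hn => ?_
        have := (mem_filter.1 hn).2
        exact pow_le_pow_left₀ (by linarith) (by linarith) 2
    _ ≤ ∑ n ∈ Icc 1 N, (μ - primeCount P n) ^ 2 :=
        sum_le_sum_of_subset_of_nonneg (filter_subset _ _) fun _ _ _ => sq_nonneg _
    _ = N * μ ^ 2 - 2 * μ * ∑ n ∈ Icc 1 N, (primeCount P n : ℝ)
          + ∑ n ∈ Icc 1 N, (primeCount P n : ℝ) ^ 2 := by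
        simp_rw [sub_sq]
        rw [sum_add_distrib, sum_sub_distrib, ← mul_sum]
        simp
    _ ≤ _ := by nlinarith [mul_le_mul_of_nonneg_left h2 (show 0 ≤ 2 * μ by linarith)]

lemma sum_rough_le_prod {Y : ℕ} (hY : 6 ≤ Y) (X : ℕ) :
    ∑ m ∈ roughUpTo Y X, 1 / (m : ℝ)
      ≤ Real.exp (6 / 5 * ∑ p ∈ (Icc Y X).filter Nat.Prime, 1 / (p : ℝ)) := by
  let f : ℕ →* ℝ :=
    { toFun := fun n => ((n : ℝ))⁻¹
      map_one' := by simp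
      map_mul' := fun a b => by push_cast; rw [mul_inv] }
  have hf : ∀ n : ℕ, f n = (n : ℝ)⁻¹ := fun _ => rfl
  have hlt : ∀ {p : ℕ}, p.Prime → ‖f p‖ < 1 := by
    intro p hp
    rw [hf, norm_inv, Real.norm_natCast]
    exact inv_lt_one_of_one_lt₀ (by exact_mod_cast hp.one_lt)
  obtain ⟨-, hsum⟩ := EulerProduct.summable_and_hasSum_factoredNumbers_prod_filter_prime_geometric
    hlt (Icc Y X)
  have hmem : ∀ m ∈ roughUpTo Y X, m ∈ Nat.factoredNumbers (Icc Y X) := by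
    intro m hm
    rw [mem_roughUpTo] at hm
    rw [Nat.mem_factoredNumbers']
    intro p hp hd
    exact mem_Icc.2 ⟨hm.2 p hp hd, (Nat.le_of_dvd hm.1.1 hd).trans hm.1.2⟩
  have h1 : ∑ m ∈ roughUpTo Y X, 1 / (m : ℝ)
      ≤ ∏ p ∈ (Icc Y X).filter Nat.Prime, (1 - f p)⁻¹ := by
    have h2 : ∑ m ∈ roughUpTo Y X, 1 / (m : ℝ)
        = ∑ m ∈ (roughUpTo Y X).subtype (fun m => m ∈ Nat.factoredNumbers (Icc Y X)),
          f (m : ℕ) := by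
      rw [sum_subtype_eq_sum_filter (fun m => f m), filter_true_of_mem hmem]
      exact sum_congr rfl fun m _ => by rw [hf, one_div]
    rw [h2]
    exact sum_le_hasSum _ (fun m _ => by rw [hf]; positivity) hsum
  refine h1.trans ?_
  rw [mul_sum, Real.exp_sum]
  refine prod_le_prod (fun p hp => ?_) (fun p hp => ?_)
  · have := hlt (mem_filter.1 hp).2
    rw [Real.norm_eq_abs, abs_lt] at this
    exact inv_nonneg.2 (by linarith)
  · rw [mem_filter, mem_Icc] at hp
    have hp6 : (6 : ℝ) ≤ p := by exact_mod_cast hY.trans hp.1.1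
    have hx : (p : ℝ)⁻¹ ≤ 1 / 6 := by rw [inv_le_comm₀ (by linarith) (by norm_num)]; linarith
    have hx0 : 0 < (p : ℝ)⁻¹ := by positivity
    rw [hf, one_div]
    set x := (p : ℝ)⁻¹
    have h3 := Real.add_one_le_exp (6 / 5 * x)
    refine le_trans ?_ h3
    rw [inv_le_iff_one_le_mul₀ (by linarith)]
    nlinarith

lemma log_le_mul_exp_sum_primes {Y : ℕ} (hY : 6 ≤ Y) (X : ℕ) :
    Real.log X ≤ 18 * Real.log Y *
      Real.exp (6 / 5 * ∑ p ∈ (Icc Y X).filter Nat.Prime, 1 / (p : ℝ)) :=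
  (log_le_mul_sum_rough (by omega) X).trans (mul_le_mul_of_nonneg_left (sum_rough_le_prod hY X)
    (by have := Real.log_natCast_nonneg Y; linarith))

open Classical in
/-- Few integers are divisible by the square of a large number. -/
lemma card_sq_dvd_le {Y : ℕ} (hY : 0 < Y) (N : ℕ) :
    (#((Icc 1 N).filter (fun n => ∃ k, Y ≤ k ∧ k ^ 2 ∣ n)) : ℝ) ≤ 2 * N / Y := by
  have h1 : (Icc 1 N).filter (fun n => ∃ k, Y ≤ k ∧ k ^ 2 ∣ n) ⊆
      (Ioo (Y - 1) (N + 1)).biUnion (fun k => (Icc 1 N).filter (fun n => k ^ 2 ∣ n)) := by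
    intro n hn
    rw [mem_filter, mem_Icc] at hn
    obtain ⟨⟨h1, h2⟩, k, hk, hd⟩ := hn
    have h3 := Nat.le_of_dvd h1 hd
    have h4 : k ≤ k ^ 2 := Nat.le_self_pow two_ne_zero k
    exact mem_biUnion.2 ⟨k, mem_Ioo.2 ⟨by omega, by omega⟩,
      mem_filter.2 ⟨mem_Icc.2 ⟨h1, h2⟩, hd⟩⟩
  have h2 : (#((Icc 1 N).filter (fun n => ∃ k, Y ≤ k ∧ k ^ 2 ∣ n)) : ℝ)
      ≤ ∑ k ∈ Ioo (Y - 1) (N + 1), (N : ℝ) * ((k : ℝ) ^ 2)⁻¹ := by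
    refine (Nat.cast_le.2 ((card_le_card h1).trans card_biUnion_le)).trans ?_
    push_cast
    refine sum_le_sum fun k _ => ?_
    rw [card_filter_dvd_Icc, ← div_eq_mul_inv]
    exact le_trans Nat.cast_div_le (by push_cast; exact le_rfl)
  refine h2.trans ?_
  rw [← mul_sum]
  refine (mul_le_mul_of_nonneg_left (sum_Ioo_inv_sq_le (Y - 1) (N + 1))
    (Nat.cast_nonneg N)).trans (le_of_eq ?_)
  rw [Nat.cast_sub hY]
  push_cast
  ring

lemma two_pow_card_primeFactors_le {n : ℕ} (hn : n ≠ 0) :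
    2 ^ #n.primeFactors ≤ #n.divisors := by
  rw [Nat.card_divisors hn, ← prod_const]
  refine prod_le_prod' fun p hp => ?_
  have := (Nat.prime_of_mem_primeFactors hp).factorization_pos_of_dvd hn
    (Nat.dvd_of_mem_primeFactors hp)
  omega

lemma sum_card_divisors_le (N : ℕ) :
    ∑ n ∈ Icc 1 N, (#n.divisors : ℝ) ≤ N * (1 + Real.log N) := by
  have h1 : ∑ n ∈ Icc 1 N, (#n.divisors : ℝ) = ∑ d ∈ Icc 1 N, ((N / d : ℕ) : ℝ) := by
    have : ∀ n : ℕ, (#n.divisors : ℝ) = ∑ d ∈ n.divisors, (1 : ℝ) := by simp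
    simp_rw [this]
    rw [sum_comm' (t' := Icc 1 N) (s' := fun d => (Icc 1 N).filter (fun n => d ∣ n))]
    · refine sum_congr rfl fun d _ => ?_
      rw [sum_const, nsmul_eq_mul, mul_one, card_filter_dvd_Icc]
    · intro n d
      simp only [mem_Icc, mem_filter, Nat.mem_divisors]
      constructor
      · rintro ⟨h, hd, h0⟩
        exact ⟨⟨h, hd⟩, Nat.pos_of_dvd_of_pos hd h.1, (Nat.le_of_dvd h.1 hd).trans h.2⟩
      · rintro ⟨⟨h, hd⟩, h'⟩
        exact ⟨h, hd, by omega⟩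
  rw [h1]
  refine le_trans (sum_le_sum fun d _ => (Nat.cast_div_le : ((N / d : ℕ) : ℝ) ≤ N / d)) ?_
  have : ∑ d ∈ Icc 1 N, (N : ℝ) / d = N * ∑ d ∈ Icc 1 N, 1 / (d : ℝ) := by
    rw [mul_sum]; exact sum_congr rfl fun d _ => by rw [mul_one_div]
  rw [this]
  exact mul_le_mul_of_nonneg_left (sum_Icc_le_log N) (Nat.cast_nonneg N)

lemma card_many_primeFactors_le (N k : ℕ) :
    (#((Icc 1 N).filter (fun n => k ≤ #n.primeFactors)) : ℝ) * 2 ^ k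
      ≤ N * (1 + Real.log N) := by
  refine le_trans ?_ (sum_card_divisors_le N)
  calc (#((Icc 1 N).filter (fun n => k ≤ #n.primeFactors)) : ℝ) * 2 ^ k
      = ∑ n ∈ (Icc 1 N).filter (fun n => k ≤ #n.primeFactors), (2 : ℝ) ^ k := by simp
    _ ≤ ∑ n ∈ (Icc 1 N).filter (fun n => k ≤ #n.primeFactors), (#n.divisors : ℝ) := by
        refine sum_le_sum fun n hn => ?_
        rw [mem_filter, mem_Icc] at hn
        have h1 := two_pow_card_primeFactors_le (n := n) (by omega)
        have h2 := (Nat.pow_le_pow_right two_pos hn.2).trans h1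
        exact_mod_cast h2
    _ ≤ _ := sum_le_sum_of_subset_of_nonneg (filter_subset _ _) fun _ _ _ => Nat.cast_nonneg _

open Classical in
/-- Positive proportion of integers whose `Y`-smooth part is at most `Z`. -/
lemma exists_le_card_small_smooth_part : ∃ Y₀ : ℕ, 6 ≤ Y₀ ∧ ∀ Y Z N : ℕ, Y₀ ≤ Y → Z < Y →
    Z * Y ^ 4 ≤ N → (N : ℝ) * Real.log Z / (1152 * Real.log Y)
      ≤ #((Icc 1 N).filter (fun n => ∃ s m, s * m = n ∧ s ≤ Z ∧ IsSmooth Y s ∧ IsRough Y m)) := by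
  obtain ⟨Y₀, h6, hY₀⟩ := exists_le_card_rough
  refine ⟨Y₀, h6, fun Y Z N hY hZ hN => ?_⟩
  have hl := one_le_log (Y := Y) (by omega)
  have hinj : Set.InjOn (fun z : (_ : ℕ) × ℕ => z.1 * z.2)
      ((Icc 1 Z).sigma (fun d => roughUpTo Y (N / d)) : Finset ((_ : ℕ) × ℕ)) := by
    rintro ⟨d, m⟩ h1 ⟨d', m'⟩ h2 h
    simp only [coe_sigma, Set.mem_sigma_iff, mem_coe, mem_Icc, mem_roughUpTo] at h1 h2
    obtain ⟨rfl, rfl⟩ := smooth_mul_rough_inj (isSmooth_of_lt h1.1.1 (h1.1.2.trans_lt hZ)) h1.2.2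
      (isSmooth_of_lt h2.1.1 (h2.1.2.trans_lt hZ)) h2.2.2 (by omega) h
    rfl
  have hsub : ((Icc 1 Z).sigma (fun d => roughUpTo Y (N / d))).image (fun z => z.1 * z.2) ⊆
      (Icc 1 N).filter (fun n => ∃ s m, s * m = n ∧ s ≤ Z ∧ IsSmooth Y s ∧ IsRough Y m) := by
    intro n hn
    obtain ⟨⟨d, m⟩, h, rfl⟩ := mem_image.1 hn
    simp only [mem_sigma, mem_Icc, mem_roughUpTo] at h
    refine mem_filter.2 ⟨mem_Icc.2 ⟨Nat.mul_pos h.1.1 h.2.1.1, ?_⟩, d, m, rfl, h.1.2,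
      isSmooth_of_lt h.1.1 (h.1.2.trans_lt hZ), h.2.2⟩
    exact (Nat.mul_le_mul_left d h.2.1.2).trans (Nat.mul_div_le N d)
  have hcard := card_le_card hsub
  rw [card_image_of_injOn hinj, card_sigma] at hcard
  refine le_trans ?_ (Nat.cast_le.2 hcard)
  push_cast
  calc (N : ℝ) * Real.log Z / (1152 * Real.log Y)
      ≤ N * (∑ d ∈ Icc 1 Z, 1 / (d : ℝ)) / (1152 * Real.log Y) :=
        div_le_div_of_nonneg_right (mul_le_mul_of_nonneg_left (log_le_sum_Icc Z)
          (Nat.cast_nonneg _)) (by linarith)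
    _ = ∑ d ∈ Icc 1 Z, (N / (2 * d) : ℝ) / (576 * Real.log Y) := by
        rw [mul_sum, sum_div]
        refine sum_congr rfl fun d _ => ?_
        rw [mul_one_div, div_div, div_div]
        ring_nf
    _ ≤ _ := by
        refine sum_le_sum fun d hd => ?_
        rw [mem_Icc] at hd
        have h4 : Y ^ 4 ≤ N / d := by
          rw [Nat.le_div_iff_mul_le hd.1, mul_comm]
          exact (Nat.mul_le_mul_right _ hd.2).trans hN
        refine le_trans (div_le_div_of_nonneg_right ?_ (by linarith)) (hY₀ Y (N / d) hY h4)
        have hY1 : 0 < Y ^ 4 := pow_pos (by omega) 4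
        have h5 : N < d * (N / d + 1) := Nat.lt_mul_div_succ N hd.1
        have h6 : N ≤ (N / d) * (2 * d) := by nlinarith
        have h7 : (N : ℝ) ≤ ((N / d : ℕ) : ℝ) * (2 * d) := by exact_mod_cast h6
        have hd0 : (0 : ℝ) < d := by exact_mod_cast hd.1
        rw [div_le_iff₀ (by linarith)]
        exact h7

end ExceptionalSets

section GoodModuli

lemma stoch_lt_savg_four_mul {V Y Z X n s m j K : ℕ} (hV : 400 ≤ V)
    (hVc : 8 * (2 + tailConst) ≤ V) (hY : V ^ 40000 ≤ Y) (hVY : V ≤ Y)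
    (hn : s * m = n) (hn0 : n ≠ 0)
    (hsZ : s ≤ Z) (hs : IsSmooth Y s) (hm : IsRough Y m) (hsq : ¬ ∃ k, Y ≤ k ∧ k ^ 2 ∣ n)
    (hj : j ≤ primeCount ((Icc Y X).filter Nat.Prime) n) (hZ : 48 * (4 * Z) ^ 3 ≤ 2 ^ j)
    (hK : #n.primeFactors ≤ K) (hKV : 2 ^ K ≤ V) (hM : 4 * n ≤ 2 ^ V) :
    (stoch (4 * n) (QR (4 * n)) : ℚ) < savg (4 * n) #(QR (4 * n)) := by
  have hs0 : s ≠ 0 := by rintro rfl; simp at hn; exact hn0 hn.symm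
  have hm0 : m ≠ 0 := by rintro rfl; simp at hn; exact hn0 hn.symm
  have hmn : m ∣ n := hn ▸ Dvd.intro_left _ rfl
  have hsqf : Squarefree m := by
    rw [Nat.squarefree_iff_prime_squarefree]
    intro p hp hd
    exact hsq ⟨p, hm p hp ((Dvd.intro _ rfl).trans hd), by rw [sq]; exact hd.trans hmn⟩
  have hprod : ∏ p ∈ m.primeFactors, p = m := Nat.prod_primeFactors_of_squarefree hsqf
  have hM' : 4 * n = 4 * s * ∏ p ∈ m.primeFactors, p := by rw [hprod, mul_assoc, hn]
  have hSj : j ≤ #m.primeFactors := by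
    refine hj.trans (card_le_card ?_)
    intro p hp
    rw [mem_filter, mem_filter, mem_Icc] at hp
    obtain ⟨⟨⟨hp1, -⟩, hp2⟩, hp3⟩ := hp
    rw [← hn] at hp3
    rcases hp2.dvd_mul.1 hp3 with h | h
    · exact absurd (hs p hp2 h) (not_lt.2 hp1)
    · exact Nat.mem_primeFactors.2 ⟨hp2, h, hm0⟩
  have hSK : #m.primeFactors ≤ K := (card_le_card (Nat.primeFactors_mono hmn hn0)).trans hK
  rw [hM'] at hM ⊢
  refine stoch_lt_savg hV hVc ?_ ?_ (by omega) (Dvd.intro _ rfl) ?_ ?_ hM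
  · intro p hp
    have hp' := Nat.prime_of_mem_primeFactors hp
    exact ⟨hp', hY.trans (hm p hp' (Nat.dvd_of_mem_primeFactors hp))⟩
  · intro p hp
    have hp' := Nat.prime_of_mem_primeFactors hp
    have hpY := hm p hp' (Nat.dvd_of_mem_primeFactors hp)
    refine Nat.Coprime.mul_left ?_ ?_
    · have h2 : Nat.Coprime 2 p := (Nat.coprime_primes Nat.prime_two hp').2 (by omega)
      exact Nat.Coprime.pow_left 2 h2
    · refine ((Nat.Prime.coprime_iff_not_dvd hp').2 fun hd => ?_).symm
      exact absurd (hs p hp' hd) (not_lt.2 hpY)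
  · exact ((Nat.mul_le_mul_left 48 (Nat.pow_le_pow_left (Nat.mul_le_mul_left 4 hsZ) 3)).trans
      hZ).trans (Nat.pow_le_pow_right two_pos hSj)
  · exact (Nat.pow_le_pow_right two_pos hSK).trans hKV

open Classical in
lemma card_small_smooth_part_le {V Y Z X N j K : ℕ} (hV : 400 ≤ V)
    (hVc : 8 * (2 + tailConst) ≤ V) (hY : V ^ 40000 ≤ Y) (hVY : V ≤ Y)
    (hZ : 48 * (4 * Z) ^ 3 ≤ 2 ^ j) (hKV : 2 ^ K ≤ V) (hN : N ≤ 2 ^ V) {k : ℝ} (hk : (j : ℝ) ≤ k) :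
    #((Icc 1 (N / 4)).filter (fun n => ∃ s m, s * m = n ∧ s ≤ Z ∧ IsSmooth Y s ∧ IsRough Y m)) ≤
      #((Icc 1 N).filter (fun M => (stoch M (QR M) : ℚ) < savg M #(QR M)))
      + #((Icc 1 (N / 4)).filter (fun n => ∃ k, Y ≤ k ∧ k ^ 2 ∣ n))
      + #((Icc 1 (N / 4)).filter (fun n => K ≤ #n.primeFactors))
      + #((Icc 1 (N / 4)).filter (fun n =>
          (primeCount ((Icc Y X).filter Nat.Prime) n : ℝ) ≤ k)) := by
  set B₁ := (Icc 1 (N / 4)).filter (fun n => ∃ k, Y ≤ k ∧ k ^ 2 ∣ n)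
  set B₂ := (Icc 1 (N / 4)).filter (fun n => K ≤ #n.primeFactors)
  set B₃ := (Icc 1 (N / 4)).filter (fun n =>
    (primeCount ((Icc Y X).filter Nat.Prime) n : ℝ) ≤ k)
  set G := (Icc 1 (N / 4)).filter (fun n =>
    (stoch (4 * n) (QR (4 * n)) : ℚ) < savg (4 * n) #(QR (4 * n)))
  have hG : #G ≤ #((Icc 1 N).filter (fun M => (stoch M (QR M) : ℚ) < savg M #(QR M))) := by
    rw [← card_image_of_injective G (f := fun n => 4 * n) (fun a b h => by simpa using h)]
    refine card_le_card ?_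
    intro M hM
    obtain ⟨n, hn, rfl⟩ := mem_image.1 hM
    rw [mem_filter, mem_Icc] at hn
    exact mem_filter.2 ⟨mem_Icc.2 ⟨by omega, by omega⟩, hn.2⟩
  have hsub : (Icc 1 (N / 4)).filter
      (fun n => ∃ s m, s * m = n ∧ s ≤ Z ∧ IsSmooth Y s ∧ IsRough Y m) ⊆ G ∪ B₁ ∪ B₂ ∪ B₃ := by
    intro n hn
    rw [mem_filter] at hn
    obtain ⟨hnI, s, m, hsm, hsZ, hs, hm⟩ := hn
    by_cases h1 : n ∈ B₁
    · simp [h1]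
    by_cases h2 : n ∈ B₂
    · simp [h2]
    by_cases h3 : n ∈ B₃
    · simp [h3]
    have hG' : n ∈ G := by
      refine mem_filter.2 ⟨hnI, ?_⟩
      have h1' : ¬ ∃ k, Y ≤ k ∧ k ^ 2 ∣ n := fun h => h1 (mem_filter.2 ⟨hnI, h⟩)
      have h2' : ¬ K ≤ #n.primeFactors := fun h => h2 (mem_filter.2 ⟨hnI, h⟩)
      have h3' : ¬ (primeCount ((Icc Y X).filter Nat.Prime) n : ℝ) ≤ k :=
        fun h => h3 (mem_filter.2 ⟨hnI, h⟩)
      rw [mem_Icc] at hnI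
      have hj : j ≤ primeCount ((Icc Y X).filter Nat.Prime) n := by
        have := hk.trans (not_le.1 h3').le
        exact_mod_cast this
      exact stoch_lt_savg_four_mul hV hVc hY hVY hsm (by omega) hsZ hs hm h1' hj hZ
        (not_le.1 h2').le hKV (le_trans (by omega) hN)
    simp [hG']
  refine (card_le_card hsub).trans ?_
  refine (card_union_le _ _).trans (Nat.add_le_add_right ?_ _)
  refine (card_union_le _ _).trans (Nat.add_le_add_right ?_ _)
  exact (card_union_le _ _).trans (Nat.add_le_add_right hG _)

end GoodModuli

section Parameters

open Classical in
lemma card_primeCount_mul_le {Y X N : ℕ} {k : ℝ} (hY : 1 ≤ Y) (hX : 2 * X ≤ N) (hk : 0 < k)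
    (hμ : 6 / 5 * k ≤ ∑ p ∈ (Icc Y X).filter Nat.Prime, 1 / (p : ℝ)) :
    #((Icc 1 N).filter (fun n =>
      (primeCount ((Icc Y X).filter Nat.Prime) n : ℝ) ≤ k)) * k ≤ 60 * N := by
  have hP : #((Icc Y X).filter Nat.Prime) ≤ X :=
    (card_filter_le _ _).trans (by rw [Nat.card_Icc]; omega)
  have h := card_primeCount_le_mul_le (P := (Icc Y X).filter Nat.Prime)
    (fun p hp => (mem_filter.1 hp).2) N (k := k) (by linarith)
  set μ := ∑ p ∈ (Icc Y X).filter Nat.Prime, 1 / (p : ℝ)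
  set c : ℝ := (#((Icc 1 N).filter (fun n =>
    (primeCount ((Icc Y X).filter Nat.Prime) n : ℝ) ≤ k)) : ℝ) with hc
  have h' : c * (μ - k) ^ 2 ≤ N * μ + 2 * μ * #((Icc Y X).filter Nat.Prime) := by
    rw [hc]; convert h
  have hc0 : 0 ≤ c := Nat.cast_nonneg _
  have hPN : 2 * (#((Icc Y X).filter Nat.Prime) : ℝ) ≤ N := by
    exact_mod_cast (by omega : 2 * #((Icc Y X).filter Nat.Prime) ≤ N)
  have hμ0 : 0 < μ := by linarith
  have h1 : c * (μ / 6) ^ 2 ≤ c * (μ - k) ^ 2 :=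
    mul_le_mul_of_nonneg_left (pow_le_pow_left₀ (by linarith) (by linarith) 2) hc0
  have h2 : μ * (c * μ) ≤ μ * (72 * N) := by nlinarith
  have h3 := le_of_mul_le_mul_left h2 hμ0
  nlinarith

lemma eventually_parameters (C : ℝ) : ∀ᶠ J : ℕ in Filter.atTop,
    52 ≤ J ∧ C ≤ J ∧ C ≤ (2 : ℝ) ^ (3 * J) ∧ 480001 * (J : ℝ) + 6 ≤ Real.exp J ∧
    18 * (120000 * (J : ℝ)) * Real.exp (18 / 25 * J) ≤ Real.exp J / 2 ∧
    C * (1 + Real.exp (J + 1)) ≤ (2 : ℝ) ^ (3 * J) := by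
  have hJ : Filter.Tendsto (fun J : ℕ => (J : ℝ)) Filter.atTop Filter.atTop :=
    tendsto_natCast_atTop_atTop
  have h8 : Filter.Tendsto (fun J : ℕ => (8 : ℝ) ^ J) Filter.atTop Filter.atTop :=
    tendsto_pow_atTop_atTop_of_one_lt (by norm_num)
  have h83 : Filter.Tendsto (fun J : ℕ => ((8 : ℝ) / 3) ^ J) Filter.atTop Filter.atTop :=
    tendsto_pow_atTop_atTop_of_one_lt (by norm_num)
  have hlin : ∀ᶠ x : ℝ in Filter.atTop, ‖x ^ 1‖ ≤ 1 / 1000000 * ‖Real.exp (1 * x)‖ :=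
    (isLittleO_pow_exp_pos_mul_atTop 1 (by norm_num)).bound (by norm_num)
  have hlin' : ∀ᶠ x : ℝ in Filter.atTop, ‖x ^ 1‖ ≤ 1 / 5000000 * ‖Real.exp (7 / 25 * x)‖ :=
    (isLittleO_pow_exp_pos_mul_atTop 1 (by norm_num)).bound (by norm_num)
  filter_upwards [Filter.eventually_ge_atTop 52, hJ.eventually_ge_atTop C,
    h8.eventually_ge_atTop C, hJ.eventually hlin, hJ.eventually hlin',
    h83.eventually_ge_atTop (4 * |C|)] with J h1 h2 h3 h4 h5 h6
  have hJ0 : (52 : ℝ) ≤ J := by exact_mod_cast h1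
  have hpow : (2 : ℝ) ^ (3 * J) = 8 ^ J := by rw [pow_mul]; norm_num
  rw [pow_one, one_mul, Real.norm_of_nonneg (by linarith), Real.norm_of_nonneg
    (Real.exp_pos _).le] at h4
  rw [pow_one, Real.norm_of_nonneg (by linarith), Real.norm_of_nonneg (Real.exp_pos _).le] at h5
  refine ⟨h1, h2, hpow ▸ h3, by linarith, ?_, ?_⟩
  · have h7 : Real.exp J = Real.exp (18 / 25 * J) * Real.exp (7 / 25 * J) := by
      rw [← Real.exp_add]; congr 1; ring
    rw [h7]
    have := Real.exp_pos (18 / 25 * (J : ℝ))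
    nlinarith
  · rw [hpow]
    have he : Real.exp 1 ≤ 3 := by have := Real.exp_one_lt_d9; linarith
    have h7 : Real.exp ((J : ℝ) + 1) ≤ 3 ^ J * 3 := by
      rw [Real.exp_add, ← Real.exp_one_pow]
      exact mul_le_mul (pow_le_pow_left₀ (Real.exp_pos _).le he J) he (Real.exp_pos _).le
        (by positivity)
    have h8 : (1 : ℝ) ≤ 3 ^ J := one_le_pow₀ (by norm_num)
    have h9 : ((8 : ℝ) / 3) ^ J * 3 ^ J = 8 ^ J := by rw [← mul_pow]; norm_num
    have h10 : 0 < Real.exp ((J : ℝ) + 1) := Real.exp_pos _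
    calc C * (1 + Real.exp (J + 1)) ≤ |C| * (1 + Real.exp (J + 1)) :=
          mul_le_mul_of_nonneg_right (le_abs_self C) (by linarith)
      _ ≤ |C| * (4 * 3 ^ J) := mul_le_mul_of_nonneg_left (by linarith) (abs_nonneg C)
      _ = 4 * |C| * 3 ^ J := by ring
      _ ≤ (8 / 3) ^ J * 3 ^ J := mul_le_mul_of_nonneg_right h6 (by linarith)
      _ = _ := h9

lemma le_eighth_mul {δ n x c b : ℝ} (hx : 0 < x) (hn : 0 ≤ n) (hb : 960 * b ≤ δ * x)
    (hc : c * x ≤ 120 * b * n) : c ≤ δ / 8 * n := by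
  refine le_of_mul_le_mul_right ?_ hx
  have := mul_le_mul_of_nonneg_right hb hn
  linarith

lemma log_two_pow (k : ℕ) : Real.log (((2 ^ k : ℕ) : ℝ)) = k * Real.log 2 := by
  push_cast; rw [Real.log_pow]

lemma two_pow_le_of_le_exp {k : ℕ} {x y : ℝ} (hx : Real.exp x ≤ y) (hk : (k : ℝ) ≤ x) :
    (2 : ℝ) ^ k ≤ y := by
  refine le_trans ?_ hx
  have h2 : (2 : ℝ) ≤ Real.exp 1 := by have := Real.exp_one_gt_d9; linarith
  calc (2 : ℝ) ^ k ≤ Real.exp 1 ^ k := pow_le_pow_left₀ (by norm_num) h2 k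
    _ = Real.exp k := Real.exp_one_pow k
    _ ≤ Real.exp x := Real.exp_le_exp.2 hk

set_option maxHeartbeats 1600000 in
open Classical in
theorem exists_card_good_ge : ∃ δ : ℝ, 0 < δ ∧ ∀ᶠ J : ℕ in Filter.atTop, ∀ N : ℕ,
    Real.exp (Real.exp J) ≤ N → (N : ℝ) ≤ Real.exp (Real.exp (J + 1)) →
    δ * N ≤ #((Icc 1 N).filter (fun M => (stoch M (QR M) : ℚ) < savg M #(QR M))) := by
  obtain ⟨Y₀, hY₀6, hY₀⟩ := exists_le_card_small_smooth_part
  set δ : ℝ := 1 / 3317760000 with hδ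
  have hδ0 : 0 < δ := by norm_num
  refine ⟨δ / 16, by norm_num, ?_⟩
  set C : ℝ := 960 / δ + 400 + Y₀ + 8 * (2 + tailConst) with hC
  have ht := tailConst_nonneg
  have hY₀c : (0 : ℝ) ≤ Y₀ := Nat.cast_nonneg _
  have hCδ : 960 / δ ≤ C := by rw [hC]; linarith
  have hδ960 : 0 < 960 / δ := by positivity
  filter_upwards [eventually_parameters C] with J hJ N hN1 hN2
  obtain ⟨hJ52, hCJ, hCV, hexp, hturan, hmany⟩ := hJ
  have hJr : (52 : ℝ) ≤ J := by exact_mod_cast hJ52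
  obtain ⟨V, hV⟩ : ∃ V : ℕ, V = 2 ^ (3 * J) := ⟨_, rfl⟩
  obtain ⟨Y, hY⟩ : ∃ Y : ℕ, Y = 2 ^ (120000 * J) := ⟨_, rfl⟩
  obtain ⟨Z, hZ⟩ : ∃ Z : ℕ, Z = 2 ^ (J / 12) := ⟨_, rfl⟩
  have hVr : (V : ℝ) = 2 ^ (3 * J) := by rw [hV, Nat.cast_pow, Nat.cast_ofNat]
  have hVY : V ≤ Y := by rw [hV, hY]; exact Nat.pow_le_pow_right two_pos (by omega)
  have hVYp : V ^ 40000 ≤ Y := by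
    rw [hV, hY, ← pow_mul]; exact Nat.pow_le_pow_right two_pos (by omega)
  have hZY : Z < Y := by rw [hZ, hY]; exact Nat.pow_lt_pow_right one_lt_two (by omega)
  rw [← hVr] at hCV hmany
  have hV400 : 400 ≤ V := by
    have : (400 : ℝ) ≤ V := by rw [hC] at hCV; linarith
    exact_mod_cast this
  have hVc : 8 * (2 + tailConst) ≤ V := by rw [hC] at hCV; linarith
  have hYY₀ : Y₀ ≤ Y := by
    have : (Y₀ : ℝ) ≤ V := by rw [hC] at hCV; linarith
    exact le_trans (by exact_mod_cast this) hVY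
  have hlogY : Real.log Y = 120000 * J * Real.log 2 := by
    rw [hY, log_two_pow, Nat.cast_mul, Nat.cast_ofNat]
  have hl2 := Real.log_two_gt_d9
  have hl2' := Real.log_two_lt_d9
  have hlogZ : J / 24 * Real.log 2 ≤ Real.log Z := by
    rw [hZ, log_two_pow]
    refine mul_le_mul_of_nonneg_right ?_ (by linarith)
    have : (J : ℝ) ≤ 24 * ((J / 12 : ℕ) : ℝ) := by exact_mod_cast (by omega : J ≤ 24 * (J / 12))
    linarith
  have hN64 : 2 ^ 6 ≤ N := by
    have := two_pow_le_of_le_exp (k := 6) hN1 (by push_cast; linarith)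
    exact_mod_cast this
  have hNr : (64 : ℝ) ≤ N := by exact_mod_cast hN64
  have hZN : Z * Y ^ 4 ≤ N / 4 := by
    rw [Nat.le_div_iff_mul_le (by norm_num)]
    have h1 : Z * Y ^ 4 * 4 = 2 ^ (J / 12 + 120000 * J * 4 + 2) := by
      rw [hZ, hY, ← pow_mul, pow_add, pow_add]; rfl
    rw [h1]
    have h2 := two_pow_le_of_le_exp (k := J / 12 + 120000 * J * 4 + 2) hN1 (by
      have : J / 12 + 120000 * J * 4 + 2 ≤ 480001 * J + 6 := by omega
      have h3 : ((J / 12 + 120000 * J * 4 + 2 : ℕ) : ℝ) ≤ ((480001 * J + 6 : ℕ) : ℝ) :=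
        Nat.cast_le.2 this
      rw [Nat.cast_add (480001 * J), Nat.cast_mul] at h3
      refine h3.trans (le_trans (le_of_eq ?_) hexp)
      norm_num)
    rw [← Nat.cast_ofNat, ← Nat.cast_pow] at h2
    exact Nat.cast_le.1 h2
  have hNV : N ≤ 2 ^ V := by
    have h1 : (N : ℝ) ≤ 2 ^ V := by
      refine hN2.trans ?_
      rw [← Real.exp_log (show (0 : ℝ) < 2 ^ V from pow_pos two_pos V), Real.log_pow]
      refine Real.exp_le_exp.2 ?_
      have he : 0 < Real.exp ((J : ℝ) + 1) := Real.exp_pos _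
      have hC2 : 2 ≤ C := by rw [hC]; linarith
      nlinarith
    exact_mod_cast h1
  have hZ3 : 48 * (4 * Z) ^ 3 ≤ 2 ^ (J / 2) := by
    calc 48 * (4 * Z) ^ 3 ≤ 2 ^ 12 * (2 ^ (J / 12)) ^ 3 := by rw [hZ, mul_pow]; omega
      _ = 2 ^ (12 + J / 12 * 3) := by rw [← pow_mul, pow_add]
      _ ≤ _ := Nat.pow_le_pow_right two_pos (by omega)
  have hj : ((J / 2 : ℕ) : ℝ) ≤ J / 2 := Nat.cast_div_le
  obtain ⟨X, hX⟩ : ∃ X : ℕ, X = N / 8 := ⟨_, rfl⟩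
  have hlogX : Real.exp J / 2 ≤ Real.log X := by
    have h1 : (N : ℝ) ≤ 16 * X := by exact_mod_cast (by omega : N ≤ 16 * X)
    have h2 : Real.exp J ≤ Real.log N := by
      rwa [Real.le_log_iff_exp_le (by linarith)]
    have hX0 : (0 : ℝ) < X := by linarith
    have h3 : Real.log N ≤ 4 * Real.log 2 + Real.log X := by
      rw [show 4 * Real.log 2 = Real.log 16 by
        rw [show (16 : ℝ) = 2 ^ 4 by norm_num, Real.log_pow]; norm_num,
        ← Real.log_mul (by norm_num) hX0.ne']
      exact Real.log_le_log (by linarith) h1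
    linarith
  have hμ : 6 / 5 * ((J : ℝ) / 2) ≤ ∑ p ∈ (Icc Y X).filter Nat.Prime, 1 / (p : ℝ) := by
    by_contra! hlt
    have h1 := log_le_mul_exp_sum_primes (Y := Y) (by omega) X
    set μ := ∑ p ∈ (Icc Y X).filter Nat.Prime, 1 / (p : ℝ)
    have h2 : Real.exp (6 / 5 * μ) < Real.exp (18 / 25 * J) := Real.exp_lt_exp.2 (by linarith)
    have h3 : Real.log Y ≤ 120000 * J := by rw [hlogY]; nlinarith
    have h4 : 0 < Real.log Y := by rw [hlogY]; exact mul_pos (by linarith) (by linarith)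
    have h5 : 18 * Real.log Y * Real.exp (6 / 5 * μ)
        < 18 * Real.log Y * Real.exp (18 / 25 * J) := mul_lt_mul_of_pos_left h2 (by linarith)
    have h6 : 18 * Real.log Y * Real.exp (18 / 25 * J)
        ≤ 18 * (120000 * J) * Real.exp (18 / 25 * J) :=
      mul_le_mul_of_nonneg_right (by linarith) (Real.exp_pos _).le
    linarith
  have hcount := card_small_smooth_part_le (V := V) (Y := Y) (Z := Z) (X := X) (N := N)
    (j := J / 2) (K := 3 * J) hV400 hVc hVYp hVY hZ3 hV.ge hNV hj
  have hmain := hY₀ Y Z (N / 4) hYY₀ hZY hZN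
  have hsq := card_sq_dvd_le (Y := Y) (by omega) (N / 4)
  have hpf := card_many_primeFactors_le (N / 4) (3 * J)
  have htur := card_primeCount_mul_le (Y := Y) (X := X) (N := N / 4) (k := (J : ℝ) / 2)
    (by omega) (by omega) (by linarith) hμ
  rw [← hVr] at hpf
  have hN4 : (N : ℝ) ≤ 8 * ((N / 4 : ℕ) : ℝ) := by exact_mod_cast (by omega : N ≤ 8 * (N / 4))
  have hN4' : ((N / 4 : ℕ) : ℝ) ≤ N := by exact_mod_cast Nat.div_le_self _ _
  have hcountr := (Nat.cast_le (α := ℝ)).2 hcount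
  simp only [Nat.cast_add] at hcountr
  set n : ℝ := ((N / 4 : ℕ) : ℝ)
  have hn0 : 0 < n := by linarith
  have hlogn : Real.log n ≤ Real.exp (J + 1) := by
    rw [Real.log_le_iff_le_exp hn0]; exact hN4'.trans hN2
  have hV0 : (0 : ℝ) < V := by linarith
  have hδV : 960 ≤ δ * V := by
    have := hCδ.trans hCV
    rwa [div_le_iff₀ hδ0, mul_comm] at this
  have hδJ : 960 ≤ δ * J := by
    have := hCδ.trans hCJ
    rwa [div_le_iff₀ hδ0, mul_comm] at this
  have hmain' : δ * n ≤ n * Real.log Z / (1152 * Real.log Y) := by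
    have h4 : 0 < Real.log Y := by rw [hlogY]; exact mul_pos (by linarith) (by linarith)
    rw [le_div_iff₀ (by linarith), hlogY, hδ]
    have := mul_le_mul_of_nonneg_left hlogZ hn0.le
    linarith
  have hY0 : (0 : ℝ) < Y := hV0.trans_le (Nat.cast_le.2 hVY)
  have hδY : 960 ≤ δ * Y :=
    hδV.trans (mul_le_mul_of_nonneg_left (Nat.cast_le.2 hVY) hδ0.le)
  have hδL : 960 * (1 + Real.exp (J + 1)) ≤ δ * V := by
    have h2 : 960 / δ * (1 + Real.exp (J + 1)) ≤ V :=
      le_trans (mul_le_mul_of_nonneg_right hCδ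
        (add_nonneg zero_le_one (Real.exp_pos _).le)) hmany
    rwa [div_mul_eq_mul_div, div_le_iff₀ hδ0, mul_comm (V : ℝ)] at h2
  have e1 := le_eighth_mul hV0 hn0.le hδL (hpf.trans
    (calc n * (1 + Real.log n) ≤ n * (1 + Real.exp (J + 1)) :=
          mul_le_mul_of_nonneg_left (add_le_add le_rfl hlogn) hn0.le
      _ ≤ 120 * (1 + Real.exp (J + 1)) * n := by
          have := mul_nonneg hn0.le (add_nonneg zero_le_one (Real.exp_pos ((J : ℝ) + 1)).le)
          linarith))
  have e2 := le_eighth_mul (δ := δ) (b := 1 / 2) (x := J / 2) (by linarith) hn0.le (by linarith)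
    (htur.trans (by linarith))
  have e3 := hsq.trans (le_eighth_mul (δ := δ) (b := 1) hY0 hn0.le (by linarith)
    (show 2 * n / Y * Y ≤ 120 * 1 * n by rw [div_mul_cancel₀ _ hY0.ne']; linarith))
  have e4 := hmain'.trans hmain
  have e5 : δ / 16 * N ≤ δ * n - 3 * (δ / 8 * n) := by
    have := mul_le_mul_of_nonneg_left hN4 hδ0.le
    linarith
  refine e5.trans ?_
  linarith

theorem stmt_1 :
    0 < Filter.liminf
      (fun N : ℕ =>
        (((Finset.Icc 1 N).filter
          (fun M => (stoch M (QR M) : ℚ) < savg M (QR M).card)).card : ℝ) / (N : ℝ))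
      Filter.atTop := by
  obtain ⟨δ, hδ, h⟩ := exists_card_good_ge
  refine lt_of_lt_of_le hδ (Filter.le_liminf_of_le ?_ ?_)
  · refine Filter.IsBoundedUnder.isCoboundedUnder_ge ⟨1, Filter.eventually_map.2
      (Filter.Eventually.of_forall fun N => ?_)⟩
    refine div_le_one_of_le₀ (Nat.cast_le.2 ?_) (Nat.cast_nonneg N)
    exact (card_filter_le _ _).trans (by simp)
  · have hlog : Filter.Tendsto (fun N : ℕ => ⌊Real.log (Real.log N)⌋₊) Filter.atTop Filter.atTop :=
      tendsto_nat_floor_atTop.comp (Real.tendsto_log_atTop.comp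
        (Real.tendsto_log_atTop.comp tendsto_natCast_atTop_atTop))
    have hlog' : Filter.Tendsto (fun N : ℕ => Real.log (Real.log N)) Filter.atTop Filter.atTop :=
      Real.tendsto_log_atTop.comp
        (Real.tendsto_log_atTop.comp tendsto_natCast_atTop_atTop)
    have hlog1 : Filter.Tendsto (fun N : ℕ => Real.log N) Filter.atTop Filter.atTop :=
      Real.tendsto_log_atTop.comp tendsto_natCast_atTop_atTop
    filter_upwards [hlog.eventually h, hlog'.eventually_ge_atTop 0, hlog1.eventually_gt_atTop 0,
      Filter.eventually_gt_atTop 0] with N hN h0 h1 hN0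
    have hNr : (0 : ℝ) < N := by exact_mod_cast hN0
    rw [le_div_iff₀ hNr]
    refine le_of_le_of_eq (hN N ?_ ?_) ?_
    · rw [← Real.le_log_iff_exp_le hNr, ← Real.le_log_iff_exp_le h1]
      exact Nat.floor_le h0
    · rw [← Real.log_le_iff_le_exp hNr, ← Real.log_le_iff_le_exp h1]
      exact (Nat.lt_floor_add_one _).le
    · congr

end Parameters
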